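/- For every p < 1/2 and r ∈ [0,1]: (a) limsup_{n→∞} ℙ_{p,r}(V^b_{n,3n}) = 1 if and only if Θ(p,r) > 0; and (b) limsup_{n→∞} ℙ_{p,r}(V^{w*}_{n,3n}) = 1 if and only if Θ*(p,1−r) > 0. -/

import Mathlib

/-!
Common definitions for the Divide-and-Colour (DaC) model of
Bálint, Camia and Meester, "Sharp phase transition and critical
behaviour in 2D divide and colour models".

The model is built concretely: a single uniform random variable on `(0,1]`
is decomposed into countably many i.i.d. uniform random variables (via its
binary digits); one family of uniforms drives the Bernoulli(p) bond
percolation (the edge configuration), and an independent family of uniforms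
attaches an independent Bernoulli(r) colour to each bond cluster (the colour
of a cluster is determined by the uniform label of its canonical
representative, the vertex of minimal encoding).  The DaC measure
`ℙ_{p,r}` is the pushforward of Lebesgue measure on `(0,1]` under the map
producing the pair (edge configuration, colour configuration).
-/

open MeasureTheory ENNReal

namespace DaC

/-- Vertices of the lattice. -/
abbrev V : Type := ℤ × ℤ

/-- Square lattice adjacency: Euclidean distance `1`. -/
def SqAdj (u v : V) : Prop := (u.1 - v.1) ^ 2 + (u.2 - v.2) ^ 2 = 1

/-- `*`-adjacency (matching graph of the square lattice):
Euclidean distance `1` or `√2`. -/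
def StarAdj (u v : V) : Prop :=
  (u.1 - v.1) ^ 2 + (u.2 - v.2) ^ 2 = 1 ∨ (u.1 - v.1) ^ 2 + (u.2 - v.2) ^ 2 = 2

/-- Triangular lattice adjacency. -/
def TriAdj (u v : V) : Prop :=
  (u.1 - v.1, u.2 - v.2) ∈
    ({(1, 0), (-1, 0), (0, 1), (0, -1), (1, 1), (-1, -1)} : Set (ℤ × ℤ))

/-- Classical indicator of a proposition, as a boolean. -/
noncomputable def boolOf (P : Prop) : Bool := @decide P (Classical.propDecidable P)

/-- The `n`-th binary digit of a real number `x ∈ (0,1]`. -/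
noncomputable def bit (n : ℕ) (x : ℝ) : Bool := boolOf (⌊x * 2 ^ (n + 1)⌋ % 2 = 1)

/-- A countable family of i.i.d. uniform random variables on `[0,1]`, extracted
from a single uniform sample `x` by splitting its binary digits. -/
noncomputable def unif (i : ℕ) (x : ℝ) : ℝ :=
  ∑' k : ℕ, if bit (Nat.pair i k) x then ((2 : ℝ)⁻¹) ^ (k + 1) else 0

/-- A symmetric encoding of (unordered) pairs of vertices. -/
noncomputable def eIdx (u v : V) : ℕ :=
  min (Encodable.encode (u, v)) (Encodable.encode (v, u))

/-- The uniform label attached to the edge `{u,v}`. -/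
noncomputable def edgeU (u v : V) (x : ℝ) : ℝ := unif (2 * eIdx u v) x

/-- The uniform label attached to the vertex `v` (independent of the edge labels). -/
noncomputable def vtxU (v : V) (x : ℝ) : ℝ := unif (2 * Encodable.encode v + 1) x

/-- Edge configurations: a boolean (open/closed) for each (ordered) pair of
vertices; configurations arising from the model are symmetric and are
supported on pairs of adjacent vertices. -/
abbrev EdgeCfg : Type := V → V → Bool

/-- Colour configurations: a colour (black = `true`, white = `false`) for each vertex. -/
abbrev ColourCfg : Type := V → Bool

/-- Full configurations of the DaC model: an edge configuration together with
a colour configuration. -/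
abbrev Config : Type := EdgeCfg × ColourCfg

/-- The Bernoulli(p) edge configuration determined by the uniform sample `x`,
on the lattice with adjacency `adj`: an edge `{u,v}` of the lattice is open
iff its uniform label is `< p`. -/
noncomputable def edgeCfg (adj : V → V → Prop) (p : ℝ) (x : ℝ) : EdgeCfg :=
  fun u v => boolOf (adj u v) && boolOf (edgeU u v x < p)

/-- Connectivity through open edges of the edge configuration `η`. -/
def Conn (η : EdgeCfg) (u v : V) : Prop :=
  Relation.ReflTransGen (fun a b => η a b = true) u v

/-- The `p`-cluster of the vertex `v`: its connected component in the graph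
retaining only open edges. -/
def pCluster (η : EdgeCfg) (v : V) : Set V := {w | Conn η v w}

/-- Canonical representative of the `p`-cluster of `v`: the vertex of the
cluster with minimal encoding. -/
noncomputable def clusterRep (η : EdgeCfg) (v : V) : V :=
  (Encodable.decode (α := V) (sInf (Encodable.encode '' pCluster η v))).getD v

/-- The colour configuration with parameters `p, r` determined by the uniform
sample `x`: every `p`-cluster is coloured black (with probability `r`)
or white, independently of all other `p`-clusters, according to the uniform
label of its canonical representative. -/
noncomputable def colourCfg (adj : V → V → Prop) (p r : ℝ) (x : ℝ) : ColourCfg :=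
  fun v => boolOf (vtxU (clusterRep (edgeCfg adj p x) v) x < r)

/-- The uniform sample: Lebesgue measure on `(0,1]`. -/
noncomputable def base : Measure ℝ := volume.restrict (Set.Ioc 0 1)

/-- `ν_p`: the product Bernoulli(p) measure on edge configurations of the
lattice with adjacency `adj`. -/
noncomputable def edgeMeasure (adj : V → V → Prop) (p : ℝ) : Measure EdgeCfg :=
  base.map (edgeCfg adj p)

/-- `ℙ_{p,r}`: the DaC measure on pairs (edge configuration, colour
configuration) for the lattice with adjacency `adj`. -/
noncomputable def DaCMeasure (adj : V → V → Prop) (p r : ℝ) : Measure Config :=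
  base.map (fun x => (edgeCfg adj p x, colourCfg adj p r x))

/-- Monochromatic connectivity: `u` and `v` are joined by a path (for the
adjacency `adj`) all of whose vertices have colour `c`. -/
def MonoConn (adj : V → V → Prop) (ξ : ColourCfg) (c : Bool) (u v : V) : Prop :=
  Relation.ReflTransGen (fun a b => adj a b ∧ ξ a = c ∧ ξ b = c) u v

/-- The colour-`c` cluster of `v` (for the adjacency `adj`): empty if `v` does
not have colour `c`, and otherwise the maximal `adj`-connected set of
`c`-coloured vertices containing `v`. -/
def monoCluster (adj : V → V → Prop) (ξ : ColourCfg) (c : Bool) (v : V) : Set V :=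
  {w | ξ v = c ∧ MonoConn adj ξ c v w}

/-- The origin. -/
def origin : V := (0, 0)

/-- The size (cardinality) of a set of vertices, with values in `ℝ≥0∞`. -/
noncomputable def sizeE (S : Set V) : ℝ≥0∞ := S.encard

/-- The probability, under the DaC measure with edge adjacency `eadj` and
parameters `p, r`, that the origin lies in an infinite colour-`c` cluster for
the adjacency `cadj`. -/
noncomputable def percProb (eadj cadj : V → V → Prop) (c : Bool) (p r : ℝ) : ℝ≥0∞ :=
  DaCMeasure eadj p r {ω | (monoCluster cadj ω.2 c origin).Infinite}

/-- `Θ(p,r)` for the square lattice: probability that the origin lies in an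
infinite black `r`-cluster. -/
noncomputable def thetaSq (p r : ℝ) : ℝ≥0∞ := percProb SqAdj SqAdj true p r

/-- `Θ*(p,s)` for the square lattice: the `ℙ_{p,1-s}`-probability that the
origin lies in an infinite white `*`-cluster. -/
noncomputable def thetaStarSq (p s : ℝ) : ℝ≥0∞ := percProb SqAdj StarAdj false p (1 - s)

/-- `Θ(p,r)` for the triangular lattice. -/
noncomputable def thetaTri (p r : ℝ) : ℝ≥0∞ := percProb TriAdj TriAdj true p r

/-- The critical colouring density `r_c(p)` of the square lattice DaC model. -/
noncomputable def rcSq (p : ℝ) : ℝ :=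
  sSup {r : ℝ | r ∈ Set.Icc (0 : ℝ) 1 ∧ thetaSq p r = 0}

/-- The critical colouring density `r_c*(p)` for white `*`-percolation. -/
noncomputable def rcStarSq (p : ℝ) : ℝ :=
  sSup {s : ℝ | s ∈ Set.Icc (0 : ℝ) 1 ∧ thetaStarSq p s = 0}

/-- The critical colouring density `r_c(p)` of the triangular lattice DaC model. -/
noncomputable def rcTri (p : ℝ) : ℝ :=
  sSup {r : ℝ | r ∈ Set.Icc (0 : ℝ) 1 ∧ thetaTri p r = 0}

/-! ### Rectangles and crossings -/

/-- The rectangle `S_{n,m} = ([0,n] × [0,m]) ∩ ℤ²`. -/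
def Rect (n m : ℕ) : Set V :=
  {v | 0 ≤ v.1 ∧ v.1 ≤ (n : ℤ) ∧ 0 ≤ v.2 ∧ v.2 ≤ (m : ℤ)}

/-- The top side of `S_{n,m}`. -/
def TopSide (n m : ℕ) : Set V := {v | v ∈ Rect n m ∧ v.2 = (m : ℤ)}

/-- The bottom side of `S_{n,m}`. -/
def BotSide (n m : ℕ) : Set V := {v | v ∈ Rect n m ∧ v.2 = 0}

/-- The left side of `S_{n,m}`. -/
def LeftSide (n m : ℕ) : Set V := {v | v ∈ Rect n m ∧ v.1 = 0}

/-- The right side of `S_{n,m}`. -/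
def RightSide (n m : ℕ) : Set V := {v | v ∈ Rect n m ∧ v.1 = (n : ℤ)}

/-- There is a path (for the adjacency `adj`), all of whose vertices lie in the
region `R` and satisfy the predicate `good`, from the set `A` to the set `B`. -/
def HasCrossing (adj : V → V → Prop) (good : V → Prop) (R A B : Set V) : Prop :=
  ∃ (k : ℕ) (f : Fin (k + 1) → V),
    (∀ i, f i ∈ R ∧ good (f i)) ∧
    (∀ i : Fin k, adj (f i.castSucc) (f i.succ)) ∧
    f 0 ∈ A ∧ f (Fin.last k) ∈ B

/-- `V^b_{n,m}` as a set of colour configurations: there is a black vertical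
crossing of `S_{n,m}` (for the adjacency `adj`). -/
def VertBC (adj : V → V → Prop) (n m : ℕ) : Set ColourCfg :=
  {ξ | HasCrossing adj (fun v => ξ v = true) (Rect n m) (TopSide n m) (BotSide n m)}

/-- `V^{w*}_{n,m}` as a set of colour configurations: there is a white vertical
`*`-crossing of `S_{n,m}`. -/
def VertWStarC (n m : ℕ) : Set ColourCfg :=
  {ξ | HasCrossing StarAdj (fun v => ξ v = false) (Rect n m) (TopSide n m) (BotSide n m)}

/-- `H^{w*}_{n,m}` as a set of colour configurations: there is a white
horizontal `*`-crossing of `S_{n,m}`. -/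
def HorizWStarC (n m : ℕ) : Set ColourCfg :=
  {ξ | HasCrossing StarAdj (fun v => ξ v = false) (Rect n m) (LeftSide n m) (RightSide n m)}

/-- The event (set of full configurations) determined by a set of colour
configurations. -/
def colourEvent (C : Set ColourCfg) : Set Config := {ω | ω.2 ∈ C}

/-! ### Events depending on colours, increasing events, pivotal clusters -/

/-- The event `A` is defined in terms of the colours of the vertices in `W`. -/
def DependsOnColoursIn (A : Set Config) (W : Set V) : Prop :=
  ∀ ω ω' : Config, (∀ v ∈ W, ω.2 v = ω'.2 v) → (ω ∈ A ↔ ω' ∈ A)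

/-- The event `A` is increasing (for the partial order comparing colour
configurations pointwise, black = `true` above white = `false`). -/
def IncreasingColourEvent (A : Set Config) : Prop :=
  ∀ ω ω' : Config, (∀ v : V, ω.2 v = true → ω'.2 v = true) → ω ∈ A → ω' ∈ A

/-- Flip the colours of the vertices of `C`. -/
noncomputable def flipOn (C : Set V) (ξ : ColourCfg) : ColourCfg :=
  fun v => @ite _ (v ∈ C) (Classical.propDecidable _) (!ξ v) (ξ v)

/-- The set `C` is a pivotal `p`-cluster for the event `A` in the
configuration `ω`: `C` is a `p`-cluster of the edge configuration of `ω`, and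
flipping the colour of (all the vertices of) `C` changes whether the
configuration belongs to `A`. -/
def IsPivotal (A : Set Config) (ω : Config) (C : Set V) : Prop :=
  (∃ v : V, C = pCluster ω.1 v) ∧ ¬ (ω ∈ A ↔ (ω.1, flipOn C ω.2) ∈ A)

/-- `n(A)`: the number of pivotal `p`-clusters for the event `A`, with values
in `ℝ≥0∞`. -/
noncomputable def numPivotal (A : Set Config) (ω : Config) : ℝ≥0∞ :=
  {C : Set V | IsPivotal A ω C}.encard

/-! ### Barriers -/

/-- Connectivity in the square lattice avoiding the edges of `E`. -/
def AvoidConn (E : Set (V × V)) (u v : V) : Prop :=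
  Relation.ReflTransGen (fun a b => SqAdj a b ∧ (a, b) ∉ E ∧ (b, a) ∉ E) u v

/-- `E` is a barrier: a set of edges of the square lattice whose removal
(keeping the end-vertices) separates `ℤ²` into two or more connected
components, exactly one of which is infinite. -/
def IsBarrier (E : Set (V × V)) : Prop :=
  (∀ e ∈ E, SqAdj e.1 e.2) ∧
  (∃ v, {w | AvoidConn E v w}.Infinite) ∧
  (∀ v w, {x | AvoidConn E v x}.Infinite → {x | AvoidConn E w x}.Infinite → AvoidConn E v w) ∧
  (∃ v, {w | AvoidConn E v w}.Finite)

/-- The exterior of a barrier: its unique infinite complementary component. -/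
def barrierExt (E : Set (V × V)) : Set V := {v | {w | AvoidConn E v w}.Infinite}

/-- The interior of a barrier: the union of the finite complementary components. -/
def barrierInt (E : Set (V × V)) : Set V := {v | {w | AvoidConn E v w}.Finite}

/-- The event `A ⊆ EdgeCfg` is increasing (opening edges preserves it). -/
def IncreasingEdgeEvent (A : Set EdgeCfg) : Prop :=
  ∀ η η' : EdgeCfg, (∀ a b : V, η a b = true → η' a b = true) → η ∈ A → η' ∈ A

/-- The event `A ⊆ EdgeCfg` depends only on the states of the edges both of
whose endpoints lie in `W`. -/
def DependsOnEdgesIn (A : Set EdgeCfg) (W : Set V) : Prop :=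
  ∀ η η' : EdgeCfg, (∀ a b : V, a ∈ W → b ∈ W → η a b = η' a b) → (η ∈ A ↔ η' ∈ A)

/-! ### Translations -/

/-- Translation of configurations by the vector `u`. -/
def shift (u : V) (ω : Config) : Config :=
  (fun a b => ω.1 (a + u) (b + u), fun a => ω.2 (a + u))

end DaC
namespace DaC

set_option linter.all false

/-! ## Topology -/

theorem sqAdj_iff (u v : V) : SqAdj u v ↔
    (u.1 = v.1 ∧ (u.2 = v.2 + 1 ∨ v.2 = u.2 + 1)) ∨ (u.2 = v.2 ∧ (u.1 = v.1 + 1 ∨ v.1 = u.1 + 1)) := by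
  unfold SqAdj
  constructor
  · intro h
    have h1 : u.1 - v.1 ≤ 1 := by nlinarith [sq_nonneg (u.2 - v.2)]
    have h2 : -1 ≤ u.1 - v.1 := by nlinarith [sq_nonneg (u.2 - v.2)]
    have h3 : u.2 - v.2 ≤ 1 := by nlinarith [sq_nonneg (u.1 - v.1)]
    have h4 : -1 ≤ u.2 - v.2 := by nlinarith [sq_nonneg (u.1 - v.1)]
    generalize hx : u.1 - v.1 = x at *
    generalize hy : u.2 - v.2 = y at *
    interval_cases x <;> interval_cases y <;> simp at h <;> omega
  · rintro (⟨h1, h2 | h2⟩ | ⟨h1, h2 | h2⟩) <;> rw [h1, h2] <;> ring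

theorem starAdj_iff (u v : V) : StarAdj u v ↔
    (u.1 ≠ v.1 ∨ u.2 ≠ v.2) ∧ u.1 ≤ v.1 + 1 ∧ v.1 ≤ u.1 + 1 ∧ u.2 ≤ v.2 + 1 ∧ v.2 ≤ u.2 + 1 := by
  unfold StarAdj
  constructor
  · intro h
    have h0 : (u.1 - v.1) ^ 2 + (u.2 - v.2) ^ 2 ≤ 2 := by omega
    have h1 : u.1 - v.1 ≤ 1 := by nlinarith [sq_nonneg (u.2 - v.2)]
    have h2 : -1 ≤ u.1 - v.1 := by nlinarith [sq_nonneg (u.2 - v.2)]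
    have h3 : u.2 - v.2 ≤ 1 := by nlinarith [sq_nonneg (u.1 - v.1)]
    have h4 : -1 ≤ u.2 - v.2 := by nlinarith [sq_nonneg (u.1 - v.1)]
    generalize hx : u.1 - v.1 = x at *
    generalize hy : u.2 - v.2 = y at *
    interval_cases x <;> interval_cases y <;> simp at h <;> omega
  · rintro ⟨h0, h1, h2, h3, h4⟩
    generalize hx : u.1 - v.1 = x at *
    generalize hy : u.2 - v.2 = y at *
    have a1 : x ≤ 1 := by omega
    have a2 : -1 ≤ x := by omega
    have a3 : y ≤ 1 := by omega
    have a4 : -1 ≤ y := by omega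
    interval_cases x <;> interval_cases y <;> simp <;> omega

/-- The two adjacencies, indexed by a boolean. -/
def Ad (s : Bool) : V → V → Prop := if s then StarAdj else SqAdj

@[simp] theorem Ad_true : Ad true = StarAdj := rfl
@[simp] theorem Ad_false : Ad false = SqAdj := rfl

theorem sqAdj_symm {u v : V} (h : SqAdj u v) : SqAdj v u := by
  rw [sqAdj_iff] at *; omega

theorem Ad_symm {s : Bool} {u v : V} (h : Ad s u v) : Ad s v u := by
  cases s
  · simp only [Ad_false, sqAdj_iff] at *; omega
  · simp only [Ad_true, starAdj_iff] at *; omega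

theorem Ad_of_sq {s : Bool} {u v : V} (h : SqAdj u v) : Ad s u v := by
  cases s
  · exact h
  · exact Or.inl h

theorem Ad_star {s : Bool} {u v : V} (h : Ad s u v) : StarAdj u v := by
  cases s
  · exact Or.inl h
  · exact h

theorem Ad_le {s : Bool} {u v : V} (h : Ad s u v) :
    u.1 ≤ v.1 + 1 ∧ v.1 ≤ u.1 + 1 ∧ u.2 ≤ v.2 + 1 ∧ v.2 ≤ u.2 + 1 :=
  ((starAdj_iff u v).1 (Ad_star h)).2

/-- Connection inside a set. -/
def Cn (adj : V → V → Prop) (S : Set V) (u v : V) : Prop :=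
  u ∈ S ∧ Relation.ReflTransGen (fun a b => adj a b ∧ b ∈ S) u v

theorem Cn.refl {adj : V → V → Prop} {S : Set V} {u : V} (h : u ∈ S) : Cn adj S u u :=
  ⟨h, Relation.ReflTransGen.refl⟩

theorem Cn.left {adj : V → V → Prop} {S : Set V} {u v : V} (h : Cn adj S u v) : u ∈ S := h.1

theorem Cn.right {adj : V → V → Prop} {S : Set V} {u v : V} (h : Cn adj S u v) : v ∈ S := by
  obtain ⟨h1, h2⟩ := h
  cases h2 with
  | refl => exact h1
  | tail _ h => exact h.2

theorem Cn.trans {adj : V → V → Prop} {S : Set V} {u v w : V} (h : Cn adj S u v)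
    (h' : Cn adj S v w) : Cn adj S u w := ⟨h.1, h.2.trans h'.2⟩

theorem Cn.step {adj : V → V → Prop} {S : Set V} {u v w : V} (h : Cn adj S u v)
    (h' : adj v w) (hw : w ∈ S) : Cn adj S u w := ⟨h.1, h.2.tail ⟨h', hw⟩⟩

theorem Cn.one {adj : V → V → Prop} {S : Set V} {u v : V} (hu : u ∈ S)
    (h' : adj u v) (hv : v ∈ S) : Cn adj S u v := (Cn.refl hu).step h' hv

theorem Cn.mono {adj : V → V → Prop} {S T : Set V} {u v : V} (h : Cn adj S u v)
    (hST : S ⊆ T) : Cn adj T u v :=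
  ⟨hST h.1, Relation.ReflTransGen.mono (fun _ _ h => ⟨h.1, hST h.2⟩) _ _ h.2⟩

theorem Cn.induct {adj : V → V → Prop} {S : Set V} {u v : V} {P : V → Prop} (h : Cn adj S u v)
    (h0 : P u) (hs : ∀ a b, Cn adj S u a → adj a b → b ∈ S → P a → P b) : P v := by
  obtain ⟨h1, h2⟩ := h
  induction h2 with
  | refl => exact h0
  | tail hab hbc ih => exact hs _ _ ⟨h1, hab⟩ hbc.1 hbc.2 ih

theorem Cn.symm {s : Bool} {S : Set V} {u v : V} (h : Cn (Ad s) S u v) : Cn (Ad s) S v u := by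
  refine h.induct (P := fun v => Cn (Ad s) S v u) (Cn.refl h.1) ?_
  intro a b hua hab hb ih
  exact (Cn.one hb (Ad_symm hab) hua.right).trans ih

theorem Cn.map {adj adj' : V → V → Prop} {S T : Set V} {u v : V} (φ : V → V) (h : Cn adj S u v)
    (hadj : ∀ a b, adj a b → adj' (φ a) (φ b)) (hS : ∀ a ∈ S, φ a ∈ T) :
    Cn adj' T (φ u) (φ v) := by
  refine h.induct (P := fun v => Cn adj' T (φ u) (φ v)) (Cn.refl (hS _ h.1)) ?_
  intro a b _ hab hb ih
  exact ih.step (hadj _ _ hab) (hS _ hb)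

/-- The part of a set connected to `u`. -/
theorem Cn.restrict {adj : V → V → Prop} {S : Set V} {u v : V} (h : Cn adj S u v) :
    Cn adj {w | Cn adj S u w} u v := by
  refine h.induct (P := fun v => Cn adj {w | Cn adj S u w} u v) (Cn.refl (Cn.refl h.1)) ?_
  intro a b hua hab hb ih
  exact ih.step hab (hua.step hab hb)

theorem Cn.last_exit {adj : V → V → Prop} {S P : Set V} {u v : V} (h : Cn adj S u v)
    (hu : u ∈ P) (hv : v ∉ P) :
    ∃ a b, a ∈ P ∧ Cn adj S u a ∧ adj a b ∧ Cn adj (S \ P) b v := by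
  revert hv
  refine h.induct (P := fun v => v ∉ P → ∃ a b, a ∈ P ∧ Cn adj S u a ∧ adj a b ∧
    Cn adj (S \ P) b v) (fun h => absurd hu h) ?_
  intro a b hua hab hb ih hbP
  by_cases ha : a ∈ P
  · exact ⟨a, b, ha, hua, hab, Cn.refl ⟨hb, hbP⟩⟩
  · obtain ⟨c, d, h1, h2, h3, h4⟩ := ih ha
    exact ⟨c, d, h1, h2, h3, h4.step hab ⟨hb, hbP⟩⟩

theorem Cn.first_exit {adj : V → V → Prop} {S P : Set V} {u v : V} (h : Cn adj S u v)
    (hu : u ∈ P) (hv : v ∉ P) :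
    ∃ a b, Cn adj (S ∩ P) u a ∧ adj a b ∧ b ∈ S ∧ b ∉ P := by
  have key : (Cn adj (S ∩ P) u v) ∨ ∃ a b, Cn adj (S ∩ P) u a ∧ adj a b ∧ b ∈ S ∧ b ∉ P := by
    refine h.induct (P := fun v => (Cn adj (S ∩ P) u v) ∨
      ∃ a b, Cn adj (S ∩ P) u a ∧ adj a b ∧ b ∈ S ∧ b ∉ P) (Or.inl (Cn.refl ⟨h.1, hu⟩)) ?_
    rintro a b hua hab hb (h1 | h1)
    · by_cases hbP : b ∈ P
      · exact Or.inl (h1.step hab ⟨hb, hbP⟩)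
      · exact Or.inr ⟨a, b, h1, hab, hb, hbP⟩
    · exact Or.inr h1
  rcases key with h1 | h1
  · exact absurd h1.right.2 hv
  · exact h1

theorem Cn.toFun {adj : V → V → Prop} {S : Set V} {u v : V} (h : Cn adj S u v) :
    ∃ (k : ℕ) (f : ℕ → V), f 0 = u ∧ f k = v ∧ (∀ i ≤ k, f i ∈ S) ∧
      ∀ i < k, adj (f i) (f (i + 1)) := by
  refine h.induct (P := fun v => ∃ (k : ℕ) (f : ℕ → V), f 0 = u ∧ f k = v ∧ (∀ i ≤ k, f i ∈ S) ∧
      ∀ i < k, adj (f i) (f (i + 1))) ⟨0, fun _ => u, rfl, rfl, fun _ _ => h.1, by simp⟩ ?_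
  rintro a b - hab hb ⟨k, f, h0, hk, hS, hadj⟩
  refine ⟨k + 1, fun i => if i ≤ k then f i else b, by simp [h0], by simp, ?_, ?_⟩
  · intro i hi
    by_cases h : i ≤ k
    · simpa [h] using hS i h
    · simpa [h] using hb
  · intro i hi
    by_cases h : i + 1 ≤ k
    · have : i ≤ k := by omega
      simpa [h, this] using hadj i (by omega)
    · have : i = k := by omega
      subst this
      simpa [hk] using hab

theorem Cn.ofFun {adj : V → V → Prop} {S : Set V} {k : ℕ} {f : ℕ → V}
    (hS : ∀ i ≤ k, f i ∈ S) (hadj : ∀ i < k, adj (f i) (f (i + 1))) : Cn adj S (f 0) (f k) := by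
  induction k with
  | zero => exact Cn.refl (hS 0 le_rfl)
  | succ n ih =>
    exact (ih (fun i hi => hS i (by omega)) (fun i hi => hadj i (by omega))).step
      (hadj n (by omega)) (hS _ le_rfl)

/-- vertical / horizontal segments -/
theorem Cn.vline {s : Bool} {S : Set V} (x y y' : ℤ) (hy : y ≤ y')
    (h : ∀ t, y ≤ t → t ≤ y' → ((x, t) : V) ∈ S) : Cn (Ad s) S (x, y) (x, y') := by
  obtain ⟨k, rfl⟩ := Int.le.dest hy
  clear hy
  induction k with
  | zero => simpa using Cn.refl (h y le_rfl (by simp))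
  | succ n ih =>
    refine (ih fun t h1 h2 => h t h1 (by push_cast; omega)).step (Ad_of_sq ?_)
      (h _ (by push_cast; omega) le_rfl)
    rw [sqAdj_iff]; left; push_cast; simp; omega

theorem Cn.hline {s : Bool} {S : Set V} (x x' y : ℤ) (hy : x ≤ x')
    (h : ∀ t, x ≤ t → t ≤ x' → ((t, y) : V) ∈ S) : Cn (Ad s) S (x, y) (x', y) := by
  obtain ⟨k, rfl⟩ := Int.le.dest hy
  clear hy
  induction k with
  | zero => simpa using Cn.refl (h x le_rfl (by simp))
  | succ n ih =>
    refine (ih fun t h1 h2 => h t h1 (by push_cast; omega)).step (Ad_of_sq ?_)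
      (h _ (by push_cast; omega) le_rfl)
    rw [sqAdj_iff]; right; push_cast; simp; omega

/-! ### The crossing lemma -/

open Classical in
/-- contribution of the edge `pq` to the parity at `v` -/
noncomputable def tc (v p q : V) : ZMod 2 :=
  if p.2 = q.2 ∧ p.2 < v.2 ∧ ((p.1 = v.1 ∧ q.1 = v.1 + 1) ∨ (q.1 = v.1 ∧ p.1 = v.1 + 1)) then 1 else 0

open Classical in
noncomputable def kc (w p : V) : ZMod 2 := if p.1 = w.1 ∧ p.2 < w.2 then 1 else 0

theorem tc_step {v w p q : V} (hvw : StarAdj v w) (h1 : w.1 = v.1 + 1) (hpq : SqAdj p q)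
    (n1 : p ≠ v) (n2 : p ≠ w) (n3 : q ≠ v) (n4 : q ≠ w) :
    tc v p q + tc w p q = kc w p + kc w q := by
  have n1' : ¬ (p.1 = v.1 ∧ p.2 = v.2) := fun h => n1 (Prod.ext h.1 h.2)
  have n2' : ¬ (p.1 = w.1 ∧ p.2 = w.2) := fun h => n2 (Prod.ext h.1 h.2)
  have n3' : ¬ (q.1 = v.1 ∧ q.2 = v.2) := fun h => n3 (Prod.ext h.1 h.2)
  have n4' : ¬ (q.1 = w.1 ∧ q.2 = w.2) := fun h => n4 (Prod.ext h.1 h.2)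
  rw [starAdj_iff] at hvw
  rw [sqAdj_iff] at hpq
  have two : (1 : ZMod 2) + 1 = 0 := by decide
  unfold tc kc
  split_ifs <;> first | omega | simp [two] | (exfalso; omega)

theorem tc_vert {v w p q : V} (hvw : StarAdj v w) (h1 : w.1 = v.1) (hpq : SqAdj p q)
    (n1 : p ≠ v) (n2 : p ≠ w) (n3 : q ≠ v) (n4 : q ≠ w) : tc v p q = tc w p q := by
  have n1' : ¬ (p.1 = v.1 ∧ p.2 = v.2) := fun h => n1 (Prod.ext h.1 h.2)
  have n2' : ¬ (p.1 = w.1 ∧ p.2 = w.2) := fun h => n2 (Prod.ext h.1 h.2)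
  have n3' : ¬ (q.1 = v.1 ∧ q.2 = v.2) := fun h => n3 (Prod.ext h.1 h.2)
  have n4' : ¬ (q.1 = w.1 ∧ q.2 = w.2) := fun h => n4 (Prod.ext h.1 h.2)
  rw [starAdj_iff] at hvw
  rw [sqAdj_iff] at hpq
  unfold tc
  split_ifs <;> first | rfl | (exfalso; omega)

theorem zmod2_add_self (a : ZMod 2) : a + a = 0 := by revert a; decide

theorem zmod2_tele (f : ℕ → ZMod 2) (k : ℕ) :
    ∑ i ∈ Finset.range k, (f i + f (i + 1)) = f 0 + f k := by
  induction k with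
  | zero => simp [zmod2_add_self]
  | succ n ih =>
    rw [Finset.sum_range_succ, ih]
    have := zmod2_add_self (f n)
    linear_combination this

theorem cross_fun (γ δ : ℕ → V) (k l : ℕ) (hγ : ∀ i < k, SqAdj (γ i) (γ (i + 1)))
    (hδ : ∀ i < l, StarAdj (δ i) (δ (i + 1)))
    (h1 : ∀ j ≤ l, (γ 0).1 ≤ (δ j).1 ∧ (δ j).1 < (γ k).1)
    (h2 : ∀ i ≤ k, (δ 0).2 ≤ (γ i).2 ∧ (γ i).2 < (δ l).2) :
    ∃ i ≤ k, ∃ j ≤ l, γ i = δ j := by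
  classical
  by_contra hcon
  push Not at hcon
  set c : V → ZMod 2 := fun v => ∑ i ∈ Finset.range k, tc v (γ i) (γ (i + 1)) with hc
  have step1 : ∀ v w : V, ∀ j j', j ≤ l → j' ≤ l → v = δ j → w = δ j' → StarAdj v w → w.1 = v.1 + 1 →
      c v = c w := by
    intro v w j j' hj hj' hv hw hvw hx
    have hsum : c v + c w = kc w (γ 0) + kc w (γ k) := by
      rw [hc, ← Finset.sum_add_distrib, ← zmod2_tele (fun i => kc w (γ i))]
      refine Finset.sum_congr rfl fun i hi => ?_
      have hi' := Finset.mem_range.1 hi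
      exact tc_step hvw hx (hγ i hi') (hv ▸ hcon i (by omega) j hj) (hw ▸ hcon i (by omega) j' hj')
        (hv ▸ hcon (i+1) (by omega) j hj) (hw ▸ hcon (i+1) (by omega) j' hj')
    have e1 : kc w (γ 0) = 0 := by
      have := (h1 j hj).1
      rw [← hv] at this
      unfold kc; rw [if_neg]; omega
    have e2 : kc w (γ k) = 0 := by
      have := (h1 j' hj').2
      rw [← hw] at this
      unfold kc; rw [if_neg]; omega
    rw [e1, e2, add_zero] at hsum
    have := zmod2_add_self (c w)
    linear_combination hsum - this
  have hconst : ∀ j ≤ l, c (δ j) = c (δ 0) := by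
    intro j
    induction j with
    | zero => intro _; rfl
    | succ n ih =>
      intro hn
      rw [← ih (by omega)]
      have hs := hδ n (by omega)
      have hs' := (starAdj_iff _ _).1 hs
      rcases lt_trichotomy (δ (n+1)).1 (δ n).1 with h | h | h
      · refine step1 _ _ (n+1) n hn (by omega) rfl rfl (Ad_symm (s := true) hs) (by omega)
      · refine Finset.sum_congr rfl fun i hi => ?_
        have hi' := Finset.mem_range.1 hi
        exact (tc_vert hs h (hγ i hi') (hcon i (by omega) n (by omega)) (hcon i (by omega) (n+1) hn)
          (hcon (i+1) (by omega) n (by omega)) (hcon (i+1) (by omega) (n+1) hn)).symm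
      · exact (step1 _ _ n (n+1) (by omega) hn rfl rfl hs (by omega)).symm
  have hbot : c (δ 0) = 0 := by
    refine Finset.sum_eq_zero fun i hi => ?_
    have hi' := Finset.mem_range.1 hi
    have := (h2 i (by omega)).1
    unfold tc; rw [if_neg]; omega
  have htop : c (δ l) = 1 := by
    have e : c (δ l) = ∑ i ∈ Finset.range k, ((if (γ i).1 ≤ (δ l).1 then (1 : ZMod 2) else 0) +
        (if (γ (i + 1)).1 ≤ (δ l).1 then (1 : ZMod 2) else 0)) := by
      refine Finset.sum_congr rfl fun i hi => ?_
      have hi' := Finset.mem_range.1 hi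
      have a1 := (h2 i (by omega)).2
      have a2 := (h2 (i+1) (by omega)).2
      have a3 := (sqAdj_iff _ _).1 (hγ i hi')
      have two : (1 : ZMod 2) + 1 = 0 := by decide
      unfold tc
      split_ifs <;> first | omega | simp [two] | (exfalso; omega)
    rw [e, zmod2_tele (fun i => if (γ i).1 ≤ (δ l).1 then (1 : ZMod 2) else 0)]
    have := h1 l le_rfl
    rw [if_pos this.1, if_neg (by omega)]; rfl
  have := hconst l le_rfl
  rw [hbot, htop] at this
  exact absurd this (by decide)

/-- Non-strict version for connections. -/
theorem cross_sq_star {S T : Set V} {a b c d : V} (hγ : Cn SqAdj S a b) (hδ : Cn StarAdj T c d)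
    (hS : ∀ v ∈ S, c.2 ≤ v.2 ∧ v.2 ≤ d.2) (hT : ∀ v ∈ T, a.1 ≤ v.1 ∧ v.1 ≤ b.1) :
    ∃ w, Cn SqAdj S a w ∧ Cn StarAdj T c w := by
  obtain ⟨k, γ, g0, gk, gS, gadj⟩ := hγ.toFun
  obtain ⟨l, δ, d0, dl, dT, dadj⟩ := hδ.toFun
  have key := cross_fun (fun i => if i ≤ k then γ i else (b.1 + 1, b.2))
    (fun i => if i ≤ l then δ i else (d.1, d.2 + 1)) (k + 1) (l + 1) ?_ ?_ ?_ ?_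
  · obtain ⟨i, hi, j, hj, hij⟩ := key
    have hb := hS b hγ.right
    have hd := hT d hδ.right
    split_ifs at hij with h1 h2 h2
    · refine ⟨γ i, ?_, ?_⟩
      · rw [← g0]; exact Cn.ofFun (fun i' h => gS i' (by omega)) (fun i' h => gadj i' (by omega))
      · rw [hij, ← d0]; exact Cn.ofFun (fun i' h => dT i' (by omega)) (fun i' h => dadj i' (by omega))
    · have := hS _ (gS i h1)
      rw [hij] at this; simp at this
    · have := hT _ (dT j h2)
      rw [← hij] at this; simp at this
    · have h3 := congrArg Prod.snd hij
      simp only at h3; omega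
  · intro i hi
    by_cases h : i + 1 ≤ k
    · have : i ≤ k := by omega
      simpa [h, this] using gadj i (by omega)
    · have : i = k := by omega
      subst this
      simp only [le_refl, if_true, gk, h, if_false]
      rw [sqAdj_iff]; simp
  · intro i hi
    by_cases h : i + 1 ≤ l
    · have : i ≤ l := by omega
      simpa [h, this] using dadj i (by omega)
    · have : i = l := by omega
      subst this
      simp only [le_refl, if_true, dl, h, if_false]
      rw [starAdj_iff]; simp; omega
  · intro j hj
    have hd := hT d hδ.right
    simp only [Nat.zero_le, if_true, g0, show ¬ (k + 1 ≤ k) by omega, if_false]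
    by_cases h : j ≤ l
    · have := hT _ (dT j h)
      simp only [h, if_true]; omega
    · simp only [h, if_false]; omega
  · intro j hj
    have hd := hS b hγ.right
    simp only [Nat.zero_le, if_true, d0, show ¬ (l + 1 ≤ l) by omega, if_false]
    by_cases h : j ≤ k
    · have := hS _ (gS j h)
      simp only [h, if_true]; omega
    · simp only [h, if_false]; omega

theorem swap_sq {a b : V} (h : SqAdj a b) : SqAdj a.swap b.swap := by
  rw [sqAdj_iff] at *; simp; omega
theorem swap_star {a b : V} (h : StarAdj a b) : StarAdj a.swap b.swap := by
  rw [starAdj_iff] at *; simp; omega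
theorem swap_Ad {s : Bool} {a b : V} (h : Ad s a b) : Ad s a.swap b.swap := by
  cases s
  · exact swap_sq h
  · exact swap_star h

/-- An `Ad s` horizontal path and an `Ad (!s)` vertical path meet. -/
theorem cross_dual {s : Bool} {S T : Set V} {a b c d : V} (hγ : Cn (Ad s) S a b)
    (hδ : Cn (Ad (!s)) T c d)
    (hS : ∀ v ∈ S, c.2 ≤ v.2 ∧ v.2 ≤ d.2) (hT : ∀ v ∈ T, a.1 ≤ v.1 ∧ v.1 ≤ b.1) :
    (S ∩ T).Nonempty := by
  cases s
  · obtain ⟨w, h1, h2⟩ := cross_sq_star hγ hδ hS hT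
    exact ⟨w, h1.right, h2.right⟩
  · have h1 : Cn StarAdj (Prod.swap ⁻¹' S) a.swap b.swap :=
      hγ.map Prod.swap (fun a b => swap_star) (fun a ha => by simpa using ha)
    have h2 : Cn SqAdj (Prod.swap ⁻¹' T) c.swap d.swap :=
      hδ.map Prod.swap (fun a b => swap_sq) (fun a ha => by simpa using ha)
    obtain ⟨w, h3, h4⟩ := cross_sq_star h2 h1 (fun v hv => by have := hT _ hv; simpa using this)
      (fun v hv => by have := hS _ hv; simpa using this)
    exact ⟨w.swap, h4.right, h3.right⟩

/-- A horizontal path and a vertical path (same adjacency) are connected to each other. -/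
theorem cross_join {s : Bool} {S T : Set V} {a b c d : V} (hγ : Cn (Ad s) S a b)
    (hδ : Cn (Ad s) T c d)
    (hS : ∀ v ∈ S, c.2 ≤ v.2 ∧ v.2 ≤ d.2) (hT : ∀ v ∈ T, a.1 ≤ v.1 ∧ v.1 ≤ b.1) :
    Cn (Ad s) (S ∪ T) a c := by
  cases s
  · have hδ' : Cn StarAdj T c d := ⟨hδ.1, Relation.ReflTransGen.mono (fun _ _ h => ⟨Or.inl h.1, h.2⟩) _ _ hδ.2⟩
    -- restrict `T` to the cluster of `c`
    have hδ2 : Cn (Ad false) {w | Cn (Ad false) T c w} c d := hδ.restrict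
    have hδ3 : Cn StarAdj {w | Cn (Ad false) T c w} c d :=
      ⟨hδ2.1, Relation.ReflTransGen.mono (fun _ _ h => ⟨Or.inl h.1, h.2⟩) _ _ hδ2.2⟩
    obtain ⟨w, h1, h2⟩ := cross_sq_star hγ hδ3 hS (fun v hv => hT v (Cn.right hv))
    exact (Cn.mono h1 Set.subset_union_left).trans
      ((Cn.symm (Cn.mono h2.right Set.subset_union_right)))
  · set S' : Set V := {v | (c.2 ≤ v.2 ∧ v.2 ≤ d.2) ∧ ∃ t, Cn StarAdj S a t ∧ (v = t ∨ SqAdj t v)} with hS'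
    have h1 : Cn SqAdj S' a b := by
      refine Cn.induct (P := fun v => Cn SqAdj S' a v) hγ
        (Cn.refl ⟨hS _ hγ.1, a, Cn.refl hγ.1, Or.inl rfl⟩) ?_
      intro x y hx hxy hy ih
      have hyS' : y ∈ S' := ⟨hS _ hy, y, hx.step hxy hy, Or.inl rfl⟩
      have bx := hS _ hx.right
      have by' := hS _ hy
      by_cases hsq : SqAdj x y
      · exact ih.step hsq hyS'
      · have hst := (starAdj_iff _ _).1 hxy
        rw [sqAdj_iff] at hsq
        have e1 : SqAdj x (y.1, x.2) := by rw [sqAdj_iff]; simp; omega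
        have e2 : SqAdj (y.1, x.2) y := by rw [sqAdj_iff]; simp; omega
        exact (ih.step e1 ⟨bx, x, hx, Or.inr e1⟩).step e2 hyS'
    obtain ⟨w, h3, h4⟩ := cross_sq_star h1 hδ (fun v hv => hv.1) hT
    obtain ⟨_, t, ht, hw⟩ := h3.right
    have h5 : Cn (Ad true) (S ∪ T) a t := Cn.mono ht Set.subset_union_left
    have h6 : Cn (Ad true) (S ∪ T) c w := Cn.mono h4 Set.subset_union_right
    rcases hw with rfl | hw
    · exact h5.trans h6.symm
    · exact (h5.step (Ad_of_sq hw) h6.right).trans h6.symm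



/-- The box of radius `n`. -/
def Bx (n : ℤ) : Set V := {v | -n ≤ v.1 ∧ v.1 ≤ n ∧ -n ≤ v.2 ∧ v.2 ≤ n}
/-- Its boundary ring. -/
def Rg (n : ℤ) : Set V := {v | v ∈ Bx n ∧ (v.1 = n ∨ v.1 = -n ∨ v.2 = n ∨ v.2 = -n)}

theorem mem_Bx {n : ℤ} {v : V} : v ∈ Bx n ↔ -n ≤ v.1 ∧ v.1 ≤ n ∧ -n ≤ v.2 ∧ v.2 ≤ n := Iff.rfl
theorem mem_Rg {n : ℤ} {v : V} : v ∈ Rg n ↔ (-n ≤ v.1 ∧ v.1 ≤ n ∧ -n ≤ v.2 ∧ v.2 ≤ n) ∧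
  (v.1 = n ∨ v.1 = -n ∨ v.2 = n ∨ v.2 = -n) := Iff.rfl

/-- There is an `Ad s`-arm in `O ∩ Bx n` from `Bx k` to the ring `Rg n`. -/
def Arm (s : Bool) (O : Set V) (k n : ℤ) : Prop :=
  ∃ u x, u ∈ Bx k ∧ x ∈ Rg n ∧ Cn (Ad s) (O ∩ Bx n) u x

open Classical in
/-- indicator of an `A`–`Q` edge -/
noncomputable def gE (A Q : Set V) (z w : V) : ZMod 2 :=
  (if z ∈ A ∧ w ∈ Q then 1 else 0) + (if w ∈ A ∧ z ∈ Q then 1 else 0)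

theorem gE_comm (A Q : Set V) (z w : V) : gE A Q z w = gE A Q w z := by
  unfold gE; rw [add_comm]

theorem gE_left {A Q : Set V} {z w : V} (h1 : z ∉ Q) (h2 : w ∉ Q) : gE A Q z w = 0 := by
  unfold gE; simp [h1, h2]

open Classical in
/-- label of a vertex -/
noncomputable def lab (A Q O : Set V) (z : V) : Fin 4 :=
  if z ∈ A then 0 else if z ∈ Q then 1 else if z ∈ O then 2 else 3

/-- compatibility of labels -/
def okL (a b : Fin 4) : Bool := !((a == 0 && b == 2) || (a == 2 && b == 0) || (a == 1 && b == 3) || (a == 3 && b == 1))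
def okA (a b : Fin 4) : Bool := !((a == 0 && b == 2) || (a == 2 && b == 0))
def okQ (a b : Fin 4) : Bool := !((a == 1 && b == 3) || (a == 3 && b == 1))
def gL (a b : Fin 4) : ZMod 2 := (if a = 0 ∧ b = 1 then 1 else 0) + (if b = 0 ∧ a = 1 then 1 else 0)

theorem gL_square : ∀ a b c d : Fin 4, okL a b → okL b c → okL c d → okL d a →
    ((okA a c && okA b d) || (okQ a c && okQ b d)) → gL a b + gL b c + gL c d + gL d a = 0 := by
  decide

theorem lab_zero {A Q O : Set V} {z : V} : lab A Q O z = 0 ↔ z ∈ A := by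
  unfold lab; split_ifs <;> simp_all
theorem lab_one {A Q O : Set V} {z : V} (hAO : A ⊆ O) (hQO : ∀ z ∈ Q, z ∉ O) :
    lab A Q O z = 1 ↔ z ∈ Q := by
  unfold lab; split_ifs with h1 h2 h3
  · simp; exact fun h => hQO z h (hAO h1)
  all_goals simp_all
theorem lab_two {A Q O : Set V} {z : V} (hQO : ∀ z ∈ Q, z ∉ O) (h : lab A Q O z = 2) : z ∈ O ∧ z ∉ A := by
  unfold lab at h; split_ifs at h <;> simp_all
theorem lab_three {A Q O : Set V} {z : V} (h : lab A Q O z = 3) : z ∉ O ∧ z ∉ Q := by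
  unfold lab at h; split_ifs at h <;> simp_all

theorem gE_square {A Q O : Set V} {s : Bool} {z1 z2 z3 z4 : V}
    (hA : ∀ z w, z ∈ A → w ∈ O → (w = z1 ∨ w = z2 ∨ w = z3 ∨ w = z4) → Ad s z w → w ∈ A)
    (hQ : ∀ z w, z ∈ Q → w ∉ O → (w = z1 ∨ w = z2 ∨ w = z3 ∨ w = z4) → Ad (!s) z w → w ∈ Q)
    (hAO : A ⊆ O) (hQO : ∀ z ∈ Q, z ∉ O)
    (h12 : SqAdj z1 z2) (h23 : SqAdj z2 z3) (h34 : SqAdj z3 z4) (h41 : SqAdj z4 z1)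
    (h13 : StarAdj z1 z3) (h24 : StarAdj z2 z4) :
    gE A Q z1 z2 + gE A Q z2 z3 + gE A Q z3 z4 + gE A Q z4 z1 = 0 := by
  classical
  have hg : ∀ z w, gE A Q z w = gL (lab A Q O z) (lab A Q O w) := by
    intro z w
    unfold gE gL
    exact congrArg₂ (· + ·) (if_congr (and_congr lab_zero.symm (lab_one hAO hQO).symm) rfl rfl)
      (if_congr (and_congr lab_zero.symm (lab_one hAO hQO).symm) rfl rfl)
  have kA : ∀ z w, (z = z1 ∨ z = z2 ∨ z = z3 ∨ z = z4) → (w = z1 ∨ w = z2 ∨ w = z3 ∨ w = z4) →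
      Ad s z w → okA (lab A Q O z) (lab A Q O w) := by
    intro z w hz hw hzw
    by_contra hcon
    simp only [okA, Bool.not_eq_true', Bool.not_eq_false, Bool.or_eq_true, Bool.and_eq_true,
      beq_iff_eq] at hcon
    rcases hcon with ⟨h1, h2⟩ | ⟨h1, h2⟩
    · exact (lab_two hQO h2).2 (hA z w (lab_zero.1 h1) (lab_two hQO h2).1 hw hzw)
    · exact (lab_two hQO h1).2 (hA w z (lab_zero.1 h2) (lab_two hQO h1).1 hz (Ad_symm hzw))
  have kQ : ∀ z w, (z = z1 ∨ z = z2 ∨ z = z3 ∨ z = z4) → (w = z1 ∨ w = z2 ∨ w = z3 ∨ w = z4) →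
      Ad (!s) z w → okQ (lab A Q O z) (lab A Q O w) := by
    intro z w hz hw hzw
    by_contra hcon
    simp only [okQ, Bool.not_eq_true', Bool.not_eq_false, Bool.or_eq_true, Bool.and_eq_true,
      beq_iff_eq] at hcon
    rcases hcon with ⟨h1, h2⟩ | ⟨h1, h2⟩
    · exact (lab_three h2).2 (hQ z w ((lab_one hAO hQO).1 h1) (lab_three h2).1 hw hzw)
    · exact (lab_three h1).2 (hQ w z ((lab_one hAO hQO).1 h2) (lab_three h1).1 hz (Ad_symm hzw))
  have kL : ∀ z w, (z = z1 ∨ z = z2 ∨ z = z3 ∨ z = z4) → (w = z1 ∨ w = z2 ∨ w = z3 ∨ w = z4) →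
      SqAdj z w → okL (lab A Q O z) (lab A Q O w) := by
    intro z w hz hw hzw
    have h1 := kA z w hz hw (Ad_of_sq hzw)
    have h2 := kQ z w hz hw (Ad_of_sq hzw)
    revert h1 h2
    generalize lab A Q O z = a
    generalize lab A Q O w = b
    revert a b; decide
  simp only [hg]
  refine gL_square _ _ _ _ (kL _ _ (by simp) (by simp) h12) (kL _ _ (by simp) (by simp) h23)
    (kL _ _ (by simp) (by simp) h34) (kL _ _ (by simp) (by simp) h41) ?_
  cases s
  · rw [kQ z1 z3 (by simp) (by simp) h13, kQ z2 z4 (by simp) (by simp) h24]; simp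
  · rw [kA z1 z3 (by simp) (by simp) h13, kA z2 z4 (by simp) (by simp) h24]; simp

set_option maxHeartbeats 1000000 in
/-- Timar-type lemma: two distinct open clusters reaching the ring are separated by a closed
dual arm. -/
theorem timar {s : Bool} {O : Set V} {n k : ℤ} (hk : 0 ≤ k) (hkn : k ≤ n) {u v x y : V} (hu : u ∈ Bx k)
    (hv : v ∈ Bx k) (hx : x ∈ Rg n) (hy : y ∈ Rg n) (hux : Cn (Ad s) (O ∩ Bx n) u x)
    (hvy : Cn (Ad s) (O ∩ Bx n) v y) (huv : ¬ Cn (Ad s) (O ∩ Bx n) u v) :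
    Arm (!s) Oᶜ k n := by
  classical
  by_contra hcon
  set A : Set V := {w | Cn (Ad s) (O ∩ Bx n) u w} with hAdef
  set Q : Set V := {w | ∃ q, q ∈ Bx k ∧ Cn (Ad (!s)) (Oᶜ ∩ Bx n) q w} with hQdef
  have hAO : A ⊆ O := fun w hw => (Cn.right hw).1
  have hQO : ∀ w ∈ Q, w ∉ O := fun w ⟨q, _, hw⟩ => hw.right.1
  have hQring : ∀ w ∈ Rg n, w ∉ Q := fun w hw ⟨q, hq, hqw⟩ => hcon ⟨q, w, hq, hw, hqw⟩
  have hAcl : ∀ z w, z ∈ A → w ∈ O → w ∈ Bx n → Ad s z w → w ∈ A :=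
    fun z w hz hw hB h => Cn.step hz h ⟨hw, hB⟩
  have hQcl : ∀ z w, z ∈ Q → w ∉ O → w ∈ Bx n → Ad (!s) z w → w ∈ Q :=
    fun z w ⟨q, hq, hz⟩ hw hB h => ⟨q, hq, hz.step h ⟨hw, hB⟩⟩
  have hkBn : Bx k ⊆ Bx n := fun w hw => by rw [mem_Bx] at *; omega
  have hQk : ∀ w ∈ Bx k, w ∉ O → w ∈ Q := fun w hw hO => ⟨w, hw, Cn.refl ⟨hO, hkBn hw⟩⟩
  set h : ℤ → ℤ → ZMod 2 := fun a b => ∑ j ∈ Finset.Ico (-n) b, gE A Q (a, j) (a, j + 1) with hh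
  have hbot : ∀ a, h a (-n) = 0 := fun a => by simp [hh]
  have hup : ∀ a b, -n ≤ b → h a (b + 1) = h a b + gE A Q (a, b) (a, b + 1) := by
    intro a b hb
    simp only [hh]
    have : Finset.Ico (-n) (b + 1) = insert b (Finset.Ico (-n) b) := by ext; simp; omega
    rw [this, Finset.sum_insert (by simp), add_comm]
  have hright : ∀ a, -n ≤ a → a + 1 ≤ n → ∀ m : ℕ, -n + m ≤ n →
      h (a + 1) (-n + m) = h a (-n + m) + gE A Q (a, -n + m) (a + 1, -n + m) := by
    intro a ha ha' m
    induction m with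
    | zero =>
      intro hm
      simp only [Nat.cast_zero, add_zero, hbot]
      rw [gE_left, add_zero]
      · apply hQring; rw [mem_Rg]; simp; omega
      · apply hQring; rw [mem_Rg]; simp; omega
    | succ m ih =>
      intro hm
      push_cast at hm ⊢
      have ih' := ih (by omega)
      have e1 := hup a (-n + m) (by omega)
      have e2 := hup (a + 1) (-n + m) (by omega)
      have hsq := gE_square (A := A) (Q := Q) (O := O) (s := s)
        (z1 := (a, -n + m)) (z2 := (a + 1, -n + m)) (z3 := (a + 1, -n + m + 1)) (z4 := (a, -n + m + 1))
        (fun z w hz hw hw' hzw => hAcl z w hz hw (by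
          rcases hw' with rfl | rfl | rfl | rfl <;> rw [mem_Bx] <;> simp <;> omega) hzw)
        (fun z w hz hw hw' hzw => hQcl z w hz hw (by
          rcases hw' with rfl | rfl | rfl | rfl <;> rw [mem_Bx] <;> simp <;> omega) hzw)
        hAO hQO (by rw [sqAdj_iff]; simp) (by rw [sqAdj_iff]; simp)
        (by rw [sqAdj_iff]; simp) (by rw [sqAdj_iff]; simp)
        (by rw [starAdj_iff]; simp; omega) (by rw [starAdj_iff]; simp; omega)
      rw [← add_assoc, e1, e2, ih']
      rw [gE_comm A Q (a + 1, -n + m + 1) (a, -n + m + 1)] at hsq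
      rw [gE_comm A Q (a, -n + m + 1) (a, -n + m)] at hsq
      have t1 := zmod2_add_self (gE A Q (a, -n + m + 1) (a + 1, -n + m + 1))
      have t2 := zmod2_add_self (gE A Q (a, -n + ↑m) (a, -n + ↑m + 1))
      linear_combination hsq - t1 - t2
  -- sq step
  have hsqstep : ∀ z w : V, z ∈ Bx n → w ∈ Bx n → SqAdj z w →
      h w.1 w.2 = h z.1 z.2 + gE A Q z w := by
    have hor : ∀ a b, -n ≤ a → a + 1 ≤ n → -n ≤ b → b ≤ n →
        h (a + 1) b = h a b + gE A Q (a, b) (a + 1, b) := by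
      intro a b h1 h2 h3 h4
      have := hright a h1 h2 (b + n).toNat (by omega)
      have e : -n + ((b + n).toNat : ℤ) = b := by omega
      rwa [e] at this
    intro z w hz hw hzw
    obtain ⟨z1, z2⟩ := z
    obtain ⟨w1, w2⟩ := w
    rw [sqAdj_iff] at hzw
    rw [mem_Bx] at hz hw
    simp only at hzw hz hw ⊢
    rcases hzw with ⟨h1, h2 | h2⟩ | ⟨h1, h2 | h2⟩ <;> subst h1 <;> subst h2
    · rw [hup z1 w2 (by omega), gE_comm A Q (z1, w2 + 1)]
      linear_combination - zmod2_add_self (gE A Q (z1, w2) (z1, w2 + 1))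
    · rw [hup z1 z2 (by omega)]
    · rw [hor w1 z2 (by omega) (by omega) (by omega) (by omega), gE_comm A Q (w1 + 1, z2)]
      linear_combination - zmod2_add_self (gE A Q (w1, z2) (w1 + 1, z2))
    · rw [hor z1 z2 (by omega) (by omega) (by omega) (by omega)]
  have hn : 0 ≤ n := by omega
  -- ring
  have hcol : ∀ a, (a = n ∨ a = -n) → ∀ m : ℕ, -n + m ≤ n → h a (-n + m) = 0 := by
    intro a ha m
    induction m with
    | zero => intro _; simpa using hbot a
    | succ m ih =>
      intro hm
      push_cast at hm ⊢
      rw [← add_assoc, hup _ _ (by omega), ih (by omega), gE_left, add_zero]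
      · apply hQring; rw [mem_Rg]; simp; omega
      · apply hQring; rw [mem_Rg]; simp; omega
  have htop : ∀ m : ℕ, -n + m ≤ n → h (-n + m) n = 0 := by
    intro m
    induction m with
    | zero =>
      intro _
      have := hcol (-n) (Or.inr rfl) (2 * n).toNat (by omega)
      have e : -n + ((2 * n).toNat : ℤ) = n := by omega
      rw [e] at this
      simpa using this
    | succ m ih =>
      intro hm
      push_cast at hm ⊢
      have := hsqstep (-n + m, n) (-n + m + 1, n) (by rw [mem_Bx]; simp; omega)
        (by rw [mem_Bx]; simp; omega) (by rw [sqAdj_iff]; simp)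
      simp only at this
      rw [← add_assoc, this, ih (by omega), gE_left, add_zero]
      · apply hQring; rw [mem_Rg]; simp; omega
      · apply hQring; rw [mem_Rg]; simp; omega
  have hring : ∀ w ∈ Rg n, h w.1 w.2 = 0 := by
    rintro ⟨a, b⟩ hw
    rw [mem_Rg] at hw
    simp only at hw ⊢
    rcases hw.2 with h1 | h1 | h1 | h1
    · have := hcol a (Or.inl h1) (b + n).toNat (by omega)
      rwa [show -n + ((b + n).toNat : ℤ) = b by omega] at this
    · have := hcol a (Or.inr h1) (b + n).toNat (by omega)
      rwa [show -n + ((b + n).toNat : ℤ) = b by omega] at this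
    · have := htop (a + n).toNat (by omega)
      rwa [show -n + ((a + n).toNat : ℤ) = a by omega, ← h1] at this
    · rw [h1]; exact hbot a
  -- along open clusters
  have hclus : ∀ t t', Cn (Ad s) (O ∩ Bx n) t t' → h t'.1 t'.2 = h t.1 t.2 := by
    intro t t' htt
    refine htt.induct (P := fun w => h w.1 w.2 = h t.1 t.2) rfl ?_
    intro z w hz hzw hw ih
    rw [← ih]
    have hzB := hz.right.2
    have hzQ : z ∉ Q := fun hq => hQO _ hq hz.right.1
    have hwQ : w ∉ Q := fun hq => hQO _ hq hw.1
    have hAiff : z ∈ A ↔ w ∈ A :=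
      ⟨fun hA => hAcl z w hA hw.1 hw.2 hzw, fun hA => hAcl w z hA hz.right.1 hzB (Ad_symm hzw)⟩
    by_cases hsq : SqAdj z w
    · rw [hsqstep z w hzB hw.2 hsq, gE_left hzQ hwQ, add_zero]
    · have hst := (starAdj_iff _ _).1 (Ad_star hzw)
      rw [sqAdj_iff] at hsq
      have e1 : SqAdj z (w.1, z.2) := by rw [sqAdj_iff]; simp; omega
      have e2 : SqAdj (w.1, z.2) w := by rw [sqAdj_iff]; simp; omega
      have hcB : ((w.1, z.2) : V) ∈ Bx n := by
        have h2 := hw.2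
        rw [mem_Bx] at *; simp; omega
      rw [hsqstep _ w hcB hw.2 e2, hsqstep z _ hzB hcB e1, gE_comm A Q _ w]
      have : gE A Q z (w.1, z.2) = gE A Q w (w.1, z.2) := by
        unfold gE; simp [hzQ, hwQ, hAiff]
      rw [this]
      linear_combination zmod2_add_self (gE A Q w (w.1, z.2))
  have hu0 : h u.1 u.2 = 0 := by rw [← hclus u x hux]; exact hring x hx
  have hv0 : h v.1 v.2 = 0 := by rw [← hclus v y hvy]; exact hring y hy
  -- inside `Bx k`
  have hin : ∀ z w, z ∈ Bx k → w ∈ Bx k → SqAdj z w →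
      h w.1 w.2 + (if w ∈ A then 1 else 0) = h z.1 z.2 + (if z ∈ A then 1 else 0) := by
    intro z w hz hw hzw
    rw [hsqstep z w (hkBn hz) (hkBn hw) hzw]
    have a1 := fun a b => hAcl z w a b (hkBn hw) (Ad_of_sq hzw)
    have a2 := fun a b => hAcl w z a b (hkBn hz) (Ad_of_sq (sqAdj_symm hzw))
    have a3 := hQk z hz
    have a4 := hQk w hw
    have a5 := hQO z
    have a6 := hQO w
    have a7 := @hAO z
    have a8 := @hAO w
    have two' : ∀ a : ZMod 2, a + 1 + 1 = a := by decide
    unfold gE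
    by_cases A1 : z ∈ A
    · have q1 : z ∉ Q := fun hq => a5 hq (a7 A1)
      by_cases q2 : w ∈ Q
      · have A2 : w ∉ A := fun hA => a6 q2 (a8 hA)
        simp [A1, q1, q2, A2]
      · have A2 : w ∈ A := a1 A1 (by by_contra hO; exact q2 (a4 hO))
        simp [A1, q1, q2, A2]
    · by_cases A2 : w ∈ A
      · have q2 : w ∉ Q := fun hq => a6 hq (a8 A2)
        have q1 : z ∈ Q := a3 (fun hO => A1 (a2 A2 hO))
        simp [A1, q1, q2, A2, two']
      · simp [A1, A2]
  have hconn : Cn (Ad false) (Bx k) u v := by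
    rw [mem_Bx] at hu hv
    have h1 : Cn (Ad false) (Bx k) u (v.1, u.2) := by
      rcases le_total u.1 v.1 with hle | hle
      · exact Cn.hline u.1 v.1 u.2 hle (fun t _ _ => by rw [mem_Bx]; simp; omega)
      · exact (Cn.hline v.1 u.1 u.2 hle (fun t _ _ => by rw [mem_Bx]; simp; omega)).symm
    have h2 : Cn (Ad false) (Bx k) (v.1, u.2) v := by
      rcases le_total u.2 v.2 with hle | hle
      · exact Cn.vline v.1 u.2 v.2 hle (fun t _ _ => by rw [mem_Bx]; simp; omega)
      · exact (Cn.vline v.1 v.2 u.2 hle (fun t _ _ => by rw [mem_Bx]; simp; omega)).symm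
    exact h1.trans h2
  have hfin : h v.1 v.2 + (if v ∈ A then 1 else 0) = h u.1 u.2 + (if u ∈ A then 1 else 0) := by
    refine hconn.induct (P := fun w => h w.1 w.2 + (if w ∈ A then 1 else 0) =
      h u.1 u.2 + (if u ∈ A then 1 else 0)) rfl ?_
    intro z w hz hzw hw ih
    rw [hin z w hz.right hw hzw, ih]
  rw [hu0, hv0, if_pos (show u ∈ A from Cn.refl hux.1), if_neg (show v ∉ A from huv)] at hfin
  exact absurd hfin (by decide)



/-! ## Positive association of the colours on a finite graph -/

section FKG
variable {W E : Type} [Fintype W] [LinearOrder W] [Fintype E] [DecidableEq E]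

/-- one step along an open edge -/
def GS (s t : E → W) (η : E → Bool) (a b : W) : Prop :=
  ∃ e, η e = true ∧ ((a = s e ∧ b = t e) ∨ (a = t e ∧ b = s e))

def GC (s t : E → W) (η : E → Bool) (a b : W) : Prop := Relation.ReflTransGen (GS s t η) a b

theorem GC.symm {s t : E → W} {η : E → Bool} {a b : W} (h : GC s t η a b) : GC s t η b a := by
  induction h with
  | refl => exact Relation.ReflTransGen.refl
  | tail _ h ih =>
    obtain ⟨e, he, h⟩ := h
    exact Relation.ReflTransGen.head ⟨e, he, by tauto⟩ ih

open Classical in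
noncomputable def rt (s t : E → W) (η : E → Bool) (v : W) : W :=
  (Finset.univ.filter (fun w => GC s t η v w)).min' ⟨v, by simp only [Finset.mem_filter, Finset.mem_univ, true_and]; exact Relation.ReflTransGen.refl⟩

theorem rt_conn (s t : E → W) (η : E → Bool) (v : W) : GC s t η v (rt s t η v) := by
  classical
  have := Finset.min'_mem (Finset.univ.filter (fun w => GC s t η v w))
    ⟨v, by simp only [Finset.mem_filter, Finset.mem_univ, true_and]; exact Relation.ReflTransGen.refl⟩
  rw [Finset.mem_filter] at this
  exact this.2

theorem rt_le {s t : E → W} {η : E → Bool} {v w : W} (h : GC s t η v w) : rt s t η v ≤ w := by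
  classical
  exact Finset.min'_le _ _ (by simpa using h)

theorem rt_eq {s t : E → W} {η : E → Bool} {v w : W} (h : GC s t η v w) :
    rt s t η v = rt s t η w :=
  le_antisymm (rt_le (Relation.ReflTransGen.trans h (rt_conn s t η w)))
    (rt_le (Relation.ReflTransGen.trans h.symm (rt_conn s t η v)))

theorem rt_rt (s t : E → W) (η : E → Bool) (v : W) : rt s t η (rt s t η v) = rt s t η v :=
  (rt_eq (rt_conn s t η v)).symm

theorem GS.gc {s t : E → W} {η : E → Bool} {a b : W} (h : GS s t η a b) : GC s t η a b :=
  Relation.ReflTransGen.single h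

/-- target condition for one edge -/
def RC (c : Bool) (u : Fin 3) : Prop := if c = true then u = 2 else u = 0

instance (c : Bool) (u : Fin 3) : Decidable (RC c u) := by unfold RC; infer_instance

/-- `η` solves the exploration equation for `(b, U)` -/
def RR (s t : E → W) (b : W → Bool) (U : E → Fin 3) (η : E → Bool) : Prop :=
  ∀ e, η e = true ↔ RC (b (min (rt s t η (s e)) (rt s t η (t e)))) (U e)

theorem RR.step {s t : E → W} {b : W → Bool} {U : E → Fin 3} {η : E → Bool}
    (h : RR s t b U η) {x y : W} (hxy : GS s t η x y) :
    ∃ e, ((x = s e ∧ y = t e) ∨ (x = t e ∧ y = s e)) ∧ RC (b (rt s t η x)) (U e) := by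
  obtain ⟨e, he, hc⟩ := hxy
  refine ⟨e, hc, ?_⟩
  have h1 := (h e).1 he
  have h2 : rt s t η x = rt s t η y := rt_eq (GS.gc ⟨e, he, hc⟩)
  rcases hc with ⟨rfl, rfl⟩ | ⟨rfl, rfl⟩
  · rwa [← h2, min_self] at h1
  · rwa [← h2, min_self] at h1

theorem RR.glue {s t : E → W} {b : W → Bool} {U : E → Fin 3} {η : E → Bool}
    (h : RR s t b U η) {x y : W} {e : E} (hc : (x = s e ∧ y = t e) ∨ (x = t e ∧ y = s e))
    (hle : rt s t η x ≤ rt s t η y) (hr : RC (b (rt s t η x)) (U e)) :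
    rt s t η x = rt s t η y := by
  have he : η e = true := by
    rw [h e]
    rcases hc with ⟨rfl, rfl⟩ | ⟨rfl, rfl⟩
    · rwa [min_eq_left hle]
    · rwa [min_eq_right hle]
  exact rt_eq (GS.gc ⟨e, he, hc⟩)

theorem RR.mono {s t : E → W} {b b' : W → Bool} {U U' : E → Fin 3} {η η' : E → Bool}
    (h : RR s t b U η) (h' : RR s t b' U' η') (hb : ∀ v, b v = true → b' v = true)
    (hU : ∀ e, U e ≤ U' e) (v : W) (hv : b (rt s t η v) = true) : b' (rt s t η' v) = true := by
  classical
  by_contra hv'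
  set Bad : Finset W := Finset.univ.filter
    (fun w => b (rt s t η w) = true ∧ ¬ b' (rt s t η' w) = true) with hBad
  have mBad : ∀ w, w ∈ Bad ↔ b (rt s t η w) = true ∧ ¬ b' (rt s t η' w) = true := by
    intro w; simp [hBad]
  obtain ⟨y, hy, hmin⟩ := Finset.exists_min_image Bad (fun w => rt s t η' w) ⟨v, (mBad v).2 ⟨hv, hv'⟩⟩
  set m := rt s t η' y with hm
  have claim1 : ∀ y ∈ Bad, rt s t η' y = m → m ≤ rt s t η y := by
    intro y hy hym
    by_contra hlt
    rw [not_le] at hlt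
    have hyb := (mBad y).1 hy
    have key : ∀ z, GC s t η (rt s t η y) z → rt s t η' z < m ∧ b' (rt s t η' z) = true := by
      intro z hz
      induction hz with
      | refl =>
        have h1 : rt s t η' (rt s t η y) < m :=
          lt_of_le_of_lt (rt_le Relation.ReflTransGen.refl) hlt
        refine ⟨h1, ?_⟩
        by_contra hw
        have := hmin (rt s t η y) ((mBad _).2 ⟨by rw [rt_rt]; exact hyb.1, hw⟩)
        exact absurd h1 (not_lt.2 this)
      | @tail z z' hz hzz ih =>
        obtain ⟨e, hc, hr⟩ := h.step hzz
        have hzroot : rt s t η z = rt s t η y := by rw [← rt_eq hz, rt_rt]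
        have hz'root : rt s t η z' = rt s t η y := by rw [← hzroot, rt_eq hzz.gc]
        rw [hzroot, hyb.1] at hr
        have hU2 : U' e = 2 := by
          have h1 := hU e
          have : U e = 2 := hr
          rw [this] at h1
          exact le_antisymm (Fin.le_last _) h1
        by_cases hle : rt s t η' z ≤ rt s t η' z'
        · have := h'.glue hc hle (by rw [ih.2]; exact hU2)
          rw [← this]; exact ih
        · rw [not_le] at hle
          have h1 := hle.trans ih.1
          refine ⟨h1, ?_⟩
          by_contra hw
          have := hmin z' ((mBad _).2 ⟨by rw [hz'root]; exact hyb.1, hw⟩)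
          exact absurd h1 (not_lt.2 this)
    exact hyb.2 (key y (rt_conn s t η y).symm).2
  have hyb := (mBad y).1 hy
  have hmw : b' m = false := by simpa using hyb.2
  have claim2 : ∀ z, GC s t η' m z → rt s t η z ≤ m ∧ b (rt s t η z) = false := by
    intro z hz
    induction hz with
    | refl =>
      have h0 : rt s t η m ≤ m := rt_le Relation.ReflTransGen.refl
      refine ⟨h0, ?_⟩
      by_contra hw
      have hmm : rt s t η' m = m := rt_rt s t η' y
      have hmb : m ∈ Bad := (mBad m).2 ⟨by simpa using hw, by rw [hmm]; simp [hmw]⟩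
      have := claim1 m hmb hmm
      have e : rt s t η m = m := le_antisymm h0 this
      rw [e] at hw
      have := hb m (by simpa using hw)
      rw [hmw] at this; exact absurd this (by simp)
    | @tail z z' hz hzz ih =>
      obtain ⟨e, hc, hr⟩ := h'.step hzz
      have hzroot : rt s t η' z = m := by rw [← rt_eq hz, hm, rt_rt]
      have hz'root : rt s t η' z' = m := by rw [← hzroot, rt_eq hzz.gc]
      rw [hzroot, hmw] at hr
      have hU2 : U e = 0 := by
        have h1 := hU e
        have : U' e = 0 := hr
        rw [this] at h1
        exact le_antisymm h1 (Fin.zero_le _)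
      by_cases hle : rt s t η z ≤ rt s t η z'
      · have := h.glue hc hle (by rw [ih.2]; exact hU2)
        rw [← this]; exact ih
      · rw [not_le] at hle
        have h1 := lt_of_lt_of_le hle ih.1
        refine ⟨h1.le, ?_⟩
        by_contra hw
        have := claim1 z' ((mBad _).2 ⟨by simpa using hw, by rw [hz'root]; simp [hmw]⟩) hz'root
        exact absurd h1 (not_lt.2 this)
  have := (claim2 y (rt_conn s t η' y).symm).2
  rw [hyb.1] at this
  exact absurd this (by simp)

theorem RR.unique {s t : E → W} {b : W → Bool} {U : E → Fin 3} {η η' : E → Bool}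
    (h : RR s t b U η) (h' : RR s t b U η') : η = η' := by
  have hxi : ∀ v, b (rt s t η v) = b (rt s t η' v) := by
    intro v
    rw [Bool.eq_iff_iff]
    exact ⟨h.mono h' (fun _ h => h) (fun _ => le_rfl) v, h'.mono h (fun _ h => h) (fun _ => le_rfl) v⟩
  have key : ∀ η η' : E → Bool, RR s t b U η → RR s t b U η' →
      (∀ v, b (rt s t η v) = b (rt s t η' v)) → ∀ e, η e = true → η' e = true := by
    intro η η' h h' hxi e he
    have h1 := (h e).1 he
    have h2 : rt s t η (s e) = rt s t η (t e) := rt_eq (GS.gc ⟨e, he, Or.inl ⟨rfl, rfl⟩⟩)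
    rw [← h2, min_self] at h1
    rw [h' e]
    rcases le_total (rt s t η' (s e)) (rt s t η' (t e)) with hle | hle
    · rw [min_eq_left hle, ← hxi]; exact h1
    · rw [min_eq_right hle, ← hxi, ← h2]; exact h1
  funext e
  rw [Bool.eq_iff_iff]
  exact ⟨key η η' h h' hxi e, key η' η h' h (fun v => (hxi v).symm) e⟩

/-- weight of an edge label -/
noncomputable def wU (p : ℝ) (u : Fin 3) : ℝ := if u = 1 then 1 - 2 * p else p
/-- weight of a bit -/
noncomputable def wB (p : ℝ) (c : Bool) : ℝ := if c = true then p else 1 - p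

open Classical in
theorem RR.sum_U (s t : E → W) (b : W → Bool) (η : E → Bool) (w : Fin 3 → ℝ) (p q : ℝ)
    (h0 : w 0 = p) (h2 : w 2 = p) (h1 : w 0 + w 1 = q) (h1' : w 1 + w 2 = q) :
    ∑ U : E → Fin 3, (if RR s t b U η then ∏ e, w (U e) else 0) =
      ∏ e, (if η e = true then p else q) := by
  have : ∀ U : E → Fin 3, (if RR s t b U η then ∏ e, w (U e) else 0) =
      ∏ e, (if (η e = true ↔ RC (b (min (rt s t η (s e)) (rt s t η (t e)))) (U e)) then w (U e) else 0) := by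
    intro U
    by_cases h : RR s t b U η
    · rw [if_pos h]
      exact Finset.prod_congr rfl fun e _ => (if_pos (h e)).symm
    · rw [if_neg h]
      unfold RR at h
      push Not at h
      obtain ⟨e, he⟩ := h
      exact (Finset.prod_eq_zero (Finset.mem_univ e) (if_neg (by tauto))).symm
  simp only [this]
  rw [← Fintype.piFinset_univ, ← Finset.prod_univ_sum (fun _ => Finset.univ)
    (fun e u => if (η e = true ↔ RC (b (min (rt s t η (s e)) (rt s t η (t e)))) u) then w u else 0)]
  refine Finset.prod_congr rfl fun e _ => ?_
  rw [Fin.sum_univ_three]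
  generalize b (min (rt s t η (s e)) (rt s t η (t e))) = c
  cases hη : η e <;> cases c <;> simp [RC, h0, h2] <;> linarith

theorem RR.exists (s t : E → W) (b : W → Bool) (U : E → Fin 3) : ∃ η, RR s t b U η := by
  classical
  by_contra hcon
  push Not at hcon
  have h1 : ∀ U : E → Fin 3, ∑ η : E → Bool, (if RR s t b U η then (1 : ℝ) else 0) ≤ 1 := by
    intro U
    by_cases h : ∃ η, RR s t b U η
    · obtain ⟨η, hη⟩ := h
      rw [Finset.sum_eq_single η]
      · simp [hη]
      · intro η' _ hne
        exact if_neg fun h' => hne (h'.unique hη)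
      · simp
    · push Not at h
      rw [Finset.sum_eq_zero]
      · norm_num
      · intro η _; exact if_neg (h η)
  have h2 : ∑ U : E → Fin 3, ∑ η : E → Bool, (if RR s t b U η then (1 : ℝ) else 0) <
      ∑ U : E → Fin 3, (1 : ℝ) := by
    refine Finset.sum_lt_sum (fun U _ => h1 U) ⟨U, Finset.mem_univ _, ?_⟩
    rw [Finset.sum_eq_zero]
    · norm_num
    · intro η _; exact if_neg (hcon η)
  rw [Finset.sum_comm] at h2
  have h3 : ∀ η : E → Bool, ∑ U : E → Fin 3, (if RR s t b U η then (1 : ℝ) else 0) =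
      ∏ e, (if η e = true then (1 : ℝ) else 2) := by
    intro η
    have := RR.sum_U s t b η (fun _ => 1) 1 2 rfl rfl (by norm_num) (by norm_num)
    simpa using this
  simp only [h3] at h2
  rw [← Fintype.piFinset_univ, ← Finset.prod_univ_sum (fun _ => Finset.univ)
    (fun (e : E) (c : Bool) => if c = true then (1 : ℝ) else 2)] at h2
  simp at h2
  norm_num at h2

/-- The finite FKG inequality for colours. -/
theorem finite_fkg (s t : E → W) (p r : ℝ) (hp0 : 0 ≤ p) (hp : p ≤ 1 / 2) (hr0 : 0 ≤ r) (hr1 : r ≤ 1)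
    (f g : (W → Bool) → ℝ) (hf0 : 0 ≤ f) (hg0 : 0 ≤ g) (hf : Monotone f) (hg : Monotone g) :
    let ex : ((W → Bool) → ℝ) → ℝ := fun F => ∑ b : W → Bool, ∑ η : E → Bool,
      (∏ v, wB r (b v)) * (∏ e, wB p (η e)) * F (fun v => b (rt s t η v))
    ex f * ex g ≤ ex (fun ξ => f ξ * g ξ) := by
  classical
  intro ex
  choose sol hsol using fun b U => RR.exists s t b U
  set Ξ : (W → Bool) × (E → Fin 3) → (W → Bool) := fun x v => x.1 (rt s t (sol x.1 x.2) v) with hΞ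
  have hmono : Monotone Ξ := by
    intro x y hxy v
    have := (hsol x.1 x.2).mono (hsol y.1 y.2) (fun w hw => by
      have := hxy.1 w; rw [hw] at this; exact top_le_iff.1 this) (fun e => hxy.2 e) v
    rw [Bool.le_iff_imp]; exact this
  set wt : (W → Bool) × (E → Fin 3) → ℝ := fun x => (∏ v, wB r (x.1 v)) * (∏ e, wU p (x.2 e)) with hwt
  have hex : ∀ F, ex F = ∑ x, wt x * F (Ξ x) := by
    intro F
    rw [Fintype.sum_prod_type]
    refine Finset.sum_congr rfl fun b _ => ?_
    have e1 : ∀ η : E → Bool, ∏ e, wB p (η e) =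
        ∑ U : E → Fin 3, (if RR s t b U η then ∏ e, wU p (U e) else 0) := by
      intro η
      rw [RR.sum_U s t b η (wU p) p (1 - p) (by simp [wU]) (by simp [wU]) (by simp [wU]; ring)
        (by simp [wU]; ring)]
      rfl
    simp only [e1, Finset.mul_sum, Finset.sum_mul]
    rw [Finset.sum_comm]
    refine Finset.sum_congr rfl fun U _ => ?_
    rw [Finset.sum_eq_single (sol b U)]
    · rw [if_pos (hsol b U)]
    · intro η _ hne
      rw [if_neg fun h => hne (h.unique (hsol b U))]; simp
    · simp
  have hB0 : ∀ c, 0 ≤ wB r c := by intro c; unfold wB; split_ifs <;> linarith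
  have hU0 : ∀ c, 0 ≤ wU p c := by intro c; unfold wU; split_ifs <;> linarith
  have hwt0 : 0 ≤ wt := fun x => mul_nonneg (Finset.prod_nonneg fun _ _ => hB0 _)
    (Finset.prod_nonneg fun _ _ => hU0 _)
  have lat : ∀ {α : Type} [LinearOrder α] (w : α → ℝ) (a b : α), w a * w b = w (a ⊓ b) * w (a ⊔ b) := by
    intro α _ w a b
    rcases le_total a b with h | h
    · rw [inf_eq_left.2 h, sup_eq_right.2 h]
    · rw [inf_eq_right.2 h, sup_eq_left.2 h, mul_comm]
  have hlat : ∀ a b, wt a * wt b ≤ wt (a ⊓ b) * wt (a ⊔ b) := by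
    intro a b
    apply le_of_eq
    have e1 : (∏ v, wB r (a.1 v)) * (∏ v, wB r (b.1 v)) =
        (∏ v, wB r ((a ⊓ b).1 v)) * (∏ v, wB r ((a ⊔ b).1 v)) := by
      rw [← Finset.prod_mul_distrib, ← Finset.prod_mul_distrib]
      exact Finset.prod_congr rfl fun v _ => lat (wB r) _ _
    have e2 : (∏ v, wU p (a.2 v)) * (∏ v, wU p (b.2 v)) =
        (∏ v, wU p ((a ⊓ b).2 v)) * (∏ v, wU p ((a ⊔ b).2 v)) := by
      rw [← Finset.prod_mul_distrib, ← Finset.prod_mul_distrib]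
      exact Finset.prod_congr rfl fun v _ => lat (wU p) _ _
    calc wt a * wt b = ((∏ v, wB r (a.1 v)) * (∏ v, wB r (b.1 v))) *
          ((∏ v, wU p (a.2 v)) * (∏ v, wU p (b.2 v))) := by simp only [hwt]; ring
      _ = _ := by rw [e1, e2]; simp only [hwt]; ring
  have hfkg := fkg (fun x => f (Ξ x)) (fun x => g (Ξ x)) wt hwt0 (fun x => hf0 _) (fun x => hg0 _)
    (hf.comp hmono) (hg.comp hmono) hlat
  have hone : ∑ x, wt x = 1 := by
    have := hex (fun _ => 1)
    simp only [mul_one] at this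
    rw [← this]
    have e : ∀ {α : Type} [Fintype α] [DecidableEq α] (q : ℝ), ∑ b : α → Bool, ∏ v, wB q (b v) = 1 := by
      intro α _ _ q
      rw [← Fintype.piFinset_univ, ← Finset.prod_univ_sum (fun _ => Finset.univ) (fun (v : α) c => wB q c)]
      simp [wB]
    simp only [ex, mul_one]
    rw [← Finset.sum_mul_sum, e, e, one_mul]
  rw [hone, one_mul] at hfkg
  rw [hex f, hex g, hex (fun ξ => f ξ * g ξ)]
  exact hfkg

end FKG


/-! ### From binary digits to an i.i.d. family -/

theorem ext_cyl {ι : Type} (μ ν : Measure (ι → Bool)) [IsProbabilityMeasure μ] [IsProbabilityMeasure ν]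
    (h : ∀ s : Finset ι, ∃ s' : Finset ι, s ⊆ s' ∧ ∀ d : ι → Bool,
      μ {c | ∀ i ∈ s', c i = d i} = ν {c | ∀ i ∈ s', c i = d i}) : μ = ν := by
  classical
  have key : ∀ s : Finset ι, μ.map s.restrict = ν.map s.restrict := by
    intro s
    obtain ⟨s', hs, hd⟩ := h s
    have h2 : μ.map s'.restrict = ν.map s'.restrict := by
      refine Measure.ext_of_singleton fun a => ?_
      rw [Measure.map_apply (by fun_prop) (MeasurableSet.singleton _),
        Measure.map_apply (by fun_prop) (MeasurableSet.singleton _)]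
      have : (Finset.restrict (π := fun _ : ι => Bool) s') ⁻¹' {a} = {c : ι → Bool | ∀ i ∈ s', c i = (fun i => if hi : i ∈ s' then a ⟨i, hi⟩ else false) i} := by
        ext c
        simp only [Set.mem_preimage, Set.mem_singleton_iff, Set.mem_setOf_eq, funext_iff]
        constructor
        · intro H i hi
          simp [hi, ← H ⟨i, hi⟩]
        · rintro H ⟨i, hi⟩
          simpa [hi] using H i hi
      rw [this]; exact hd _
    have h3 : ∀ κ : Measure (ι → Bool), κ.map s.restrict
        = (κ.map s'.restrict).map (Finset.restrict₂ (π := fun _ : ι => Bool) hs) := by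
      intro κ
      rw [Measure.map_map (by fun_prop) (by fun_prop)]
      rfl
    rw [h3, h3, h2]
  refine IsProjectiveLimit.unique (P := fun s : Finset ι => μ.map s.restrict) (fun s => rfl) (fun s => (key s).symm)

theorem ext_cyl' {ι : Type} (μ ν : Measure (ι → Bool)) [IsProbabilityMeasure μ] [IsProbabilityMeasure ν]
    (h : ∀ s : Finset ι, ∀ d : ι → Bool,
      μ {c | ∀ i ∈ s, c i = d i} = ν {c | ∀ i ∈ s, c i = d i}) : μ = ν :=
  ext_cyl μ ν fun s => ⟨s, le_rfl, h s⟩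

/-- Bernoulli measure. -/
noncomputable def bern (q : ℝ) : Measure Bool :=
  ENNReal.ofReal q • Measure.dirac true + ENNReal.ofReal (1 - q) • Measure.dirac false

theorem bern_single (q : ℝ) (c : Bool) : bern q {c} = ENNReal.ofReal (wB q c) := by
  cases c <;> simp [bern, wB]

theorem bern_prob (q : ℝ) (h0 : 0 ≤ q) (h1 : q ≤ 1) : IsProbabilityMeasure (bern q) := by
  constructor
  simp only [bern, Measure.add_apply, Measure.smul_apply, measure_univ, smul_eq_mul, mul_one]
  rw [← ENNReal.ofReal_add h0 (by linarith)]
  simp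

noncomputable def clampI (q : ℝ) : ℝ := max 0 (min q 1)
theorem clampI_eq {q : ℝ} (h0 : 0 ≤ q) (h1 : q ≤ 1) : clampI q = q := by
  simp [clampI, h0, h1]

/-- Bernoulli measure, always a probability measure. -/
noncomputable def bernP (q : ℝ) : Measure Bool := bern (clampI q)
instance (q : ℝ) : IsProbabilityMeasure (bernP q) :=
  bern_prob _ (by simp [clampI]) (by simp [clampI])

theorem infPi_cyl {ι : Type} (q : ι → ℝ) (s : Finset ι) (d : ι → Bool) :
    Measure.infinitePi (fun i => bernP (q i)) {c | ∀ i ∈ s, c i = d i}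
      = ∏ i ∈ s, ENNReal.ofReal (wB (clampI (q i)) (d i)) := by
  have := Measure.infinitePi_pi (fun i => bernP (q i)) (s := s) (t := fun i => {d i}) (fun _ _ => MeasurableSet.singleton _)
  simp only [bernP, bern_single] at this
  rw [← this]; rfl

theorem reindex {ι κ X : Type} [MeasurableSpace X] (μ : κ → Measure X) [∀ i, IsProbabilityMeasure (μ i)]
    (f : ι → κ) (hf : Function.Injective f) :
    (Measure.infinitePi μ).map (fun x i => x (f i)) = Measure.infinitePi (fun i => μ (f i)) := by
  classical
  refine Measure.eq_infinitePi _ fun s t ht => ?_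
  rcases isEmpty_or_nonempty ι with hι | hι
  · have : s = ∅ := Finset.eq_empty_of_isEmpty s
    subst this
    simp
    rw [Measure.map_apply (by fun_prop) MeasurableSet.univ]
    simp
  rw [Measure.map_apply (by fun_prop) (.pi s.countable_toSet fun _ _ => ht _)]
  have : (fun (x : κ → X) i => x (f i)) ⁻¹' (Set.pi s t)
      = Set.pi (s.image f) (fun j => t (Function.invFun f j)) := by
    ext x
    simp [Set.mem_pi, Function.leftInverse_invFun hf _]
  rw [this, Measure.infinitePi_pi _ (fun _ _ => ht _), Finset.prod_image (fun a _ b _ h => hf h)]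
  simp [Function.leftInverse_invFun hf _]

instance : IsProbabilityMeasure base := ⟨by simp [base]⟩

/-- Integer with given binary digits. -/
def Kc (c : ℕ → Bool) : ℕ → ℤ
  | 0 => 0
  | n + 1 => 2 * Kc c n + (if c n then 1 else 0)

theorem Kc_nonneg (c n) : 0 ≤ Kc c n := by
  induction n with
  | zero => simp [Kc]
  | succ n ih => simp only [Kc]; split_ifs <;> omega

theorem Kc_lt (c n) : Kc c n < 2 ^ n := by
  induction n with
  | zero => simp [Kc]
  | succ n ih => simp only [Kc, pow_succ]; split_ifs <;> omega

theorem floor_step (x : ℝ) (n : ℕ) : ⌊x * 2 ^ (n + 1)⌋ = 2 * ⌊x * 2 ^ n⌋ + (if bit n x then 1 else 0) := by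
  have h1 := Int.floor_le (x * 2 ^ n)
  have h2 := Int.lt_floor_add_one (x * 2 ^ n)
  have h3 := Int.floor_le (x * 2 ^ (n+1))
  have h4 := Int.lt_floor_add_one (x * 2 ^ (n+1))
  set a := ⌊x * 2 ^ n⌋
  set b := ⌊x * 2 ^ (n+1)⌋ with hb
  have e : x * 2 ^ (n+1) = 2 * (x * 2 ^ n) := by ring
  rw [e] at h3 h4
  have l1 : 2 * a < b + 1 := by
    have : (2 * a : ℝ) < b + 1 := by linarith
    exact_mod_cast this
  have l2 : b < 2 * a + 2 := by
    have : (b : ℝ) < 2 * a + 2 := by linarith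
    exact_mod_cast this
  simp only [bit, boolOf, ← hb, decide_eq_true_eq]
  split_ifs <;> omega

theorem floor_Kc (x : ℝ) (h0 : 0 ≤ x) (h1 : x < 1) (n : ℕ) : ⌊x * 2 ^ n⌋ = Kc (fun i => bit i x) n := by
  induction n with
  | zero => simp [Kc, Int.floor_eq_iff, h0, h1]
  | succ n ih => rw [floor_step, ih]; simp [Kc]

theorem Kc_inj (c d : ℕ → Bool) (n : ℕ) : Kc c n = Kc d n ↔ ∀ i ∈ Finset.range n, c i = d i := by
  induction n with
  | zero => simp [Kc]
  | succ n ih =>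
    rw [Finset.range_add_one, Finset.forall_mem_insert, ← ih]
    simp only [Kc]
    cases c n <;> cases d n <;> simp <;> omega

theorem measurable_boolOf {α : Type} [MeasurableSpace α] {P : α → Prop} (h : MeasurableSet {a | P a}) :
    Measurable (fun a => boolOf (P a)) := by
  refine measurable_to_bool ?_
  convert h using 1
  ext a; simp [boolOf]

theorem measurable_bit (n : ℕ) : Measurable (bit n) := by
  unfold bit
  refine measurable_boolOf ?_
  have : Measurable (fun x : ℝ => ⌊x * 2 ^ (n+1)⌋) := by fun_prop
  exact this (MeasurableSet.of_discrete (s := {z : ℤ | z % 2 = 1}))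

theorem bits_law : base.map (fun x n => bit n x) = Measure.infinitePi (fun _ : ℕ => bernP (1/2)) := by
  have hm : Measurable (fun (x : ℝ) n => bit n x) := measurable_pi_lambda _ measurable_bit
  have : IsProbabilityMeasure (base.map (fun x n => bit n x)) :=
    Measure.isProbabilityMeasure_map hm.aemeasurable
  refine ext_cyl _ _ fun s => ?_
  obtain ⟨n, hn⟩ := s.exists_nat_subset_range
  refine ⟨Finset.range n, hn, fun d => ?_⟩
  rw [infPi_cyl, Measure.map_apply hm]
  swap
  · have : {c : ℕ → Bool | ∀ i ∈ Finset.range n, c i = d i} = Set.pi (Finset.range n) (fun i => {d i}) := rfl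
    rw [this]; exact .pi (Finset.range n).countable_toSet fun _ _ => MeasurableSet.singleton _
  have hb : base = volume.restrict (Set.Ico 0 1) := Measure.restrict_congr_set Ico_ae_eq_Ioc.symm
  rw [hb, Measure.restrict_apply' measurableSet_Ico]
  have hs : (fun (x : ℝ) n => bit n x) ⁻¹' {c | ∀ i ∈ Finset.range n, c i = d i} ∩ Set.Ico 0 1
      = Set.Ico ((Kc d n : ℝ) / 2 ^ n) ((Kc d n + 1 : ℝ) / 2 ^ n) := by
    have p2 : (0:ℝ) < 2 ^ n := by positivity
    have k0 : (0:ℝ) ≤ Kc d n := by exact_mod_cast Kc_nonneg d n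
    have k1 : (Kc d n + 1 : ℝ) ≤ 2 ^ n := by exact_mod_cast Kc_lt d n
    ext x
    simp only [Set.mem_inter_iff, Set.mem_preimage, Set.mem_setOf_eq, Set.mem_Ico]
    rw [← Kc_inj, div_le_iff₀ p2, lt_div_iff₀ p2]
    constructor
    · rintro ⟨h, h0, h1⟩
      rw [← floor_Kc x h0 h1, Int.floor_eq_iff] at h
      exact h
    · intro h
      have h0 : 0 ≤ x := by
        by_contra hx; push Not at hx
        nlinarith [h.1]
      have h1 : x < 1 := by
        by_contra hx; push Not at hx
        nlinarith [h.2]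
      refine ⟨?_, h0, h1⟩
      rw [← floor_Kc x h0 h1, Int.floor_eq_iff]
      exact h
  rw [hs, Real.volume_Ico]
  have hw : ∀ b, wB (clampI (1/2)) b = 1/2 := by
    intro b; rw [clampI_eq (by norm_num) (by norm_num)]; cases b <;> norm_num [wB]
  simp only [hw]
  rw [Finset.prod_const, Finset.card_range, ← ENNReal.ofReal_pow (by norm_num)]
  congr 1
  rw [add_div, add_sub_cancel_left, one_div, one_div, inv_pow]

/-- The number with the given binary digits. -/
noncomputable def Uc (c : ℕ → Bool) : ℝ := ∑' k : ℕ, if c k then ((2 : ℝ)⁻¹) ^ (k + 1) else 0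

theorem Uc_summable (c : ℕ → Bool) : Summable (fun k : ℕ => if c k then ((2 : ℝ)⁻¹) ^ (k + 1) else 0) := by
  refine Summable.of_nonneg_of_le (g := fun k => _) (f := fun k : ℕ => ((2:ℝ)⁻¹) ^ (k+1)) ?_ ?_ ?_
  · intro k; split_ifs <;> positivity
  · intro k; split_ifs <;> [exact le_rfl; positivity]
  · exact (summable_geometric_of_lt_one (by norm_num) (by norm_num : (2:ℝ)⁻¹ < 1)).comp_injective (add_left_injective 1)

theorem Uc_bits (x : ℝ) (h0 : 0 ≤ x) (h1 : x < 1) : Uc (fun k => bit k x) = x := by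
  have hs := (Uc_summable (fun k => bit k x)).hasSum.tendsto_sum_nat
  have hpart : ∀ n, ∑ k ∈ Finset.range n, (if bit k x then ((2 : ℝ)⁻¹) ^ (k + 1) else 0) = ⌊x * 2 ^ n⌋ / 2 ^ n := by
    intro n
    induction n with
    | zero =>
      have : ⌊x⌋ = 0 := by simp [Int.floor_eq_iff, h0, h1]
      simp [this]
    | succ n ih =>
      rw [Finset.sum_range_succ, ih, floor_step]
      rw [inv_pow]
      split_ifs <;> push_cast <;> field_simp <;> ring
  simp only [hpart] at hs
  refine tendsto_nhds_unique hs ?_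
  have hp : Filter.Tendsto (fun n : ℕ => ((2:ℝ)⁻¹) ^ n) Filter.atTop (nhds 0) :=
    tendsto_pow_atTop_nhds_zero_of_lt_one (by norm_num) (by norm_num)
  refine tendsto_of_tendsto_of_tendsto_of_le_of_le (g := fun n : ℕ => x - ((2:ℝ)⁻¹) ^ n) (h := fun _ => x)
    (by simpa using hp.const_sub x) tendsto_const_nhds ?_ ?_
  · intro n
    have p2 : (0:ℝ) < 2 ^ n := by positivity
    simp only
    rw [le_div_iff₀ p2, sub_mul, ← mul_pow]
    have := Int.lt_floor_add_one (x * 2 ^ n)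
    norm_num
    linarith
  · intro n
    have p2 : (0:ℝ) < 2 ^ n := by positivity
    simp only
    rw [div_le_iff₀ p2]
    exact Int.floor_le _

theorem measurable_Uc : Measurable Uc := by
  refine measurable_of_tendsto_metrizable (f := fun n (c : ℕ → Bool) => ∑ k ∈ Finset.range n, if c k then ((2 : ℝ)⁻¹) ^ (k + 1) else (0:ℝ)) ?_ ?_
  · intro n
    refine Finset.measurable_sum _ fun k _ => ?_
    refine Measurable.ite ?_ measurable_const measurable_const
    exact measurableSet_preimage (f := fun c : ℕ → Bool => c k) (by fun_prop) (MeasurableSet.singleton true)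
  · rw [tendsto_pi_nhds]
    intro c
    exact (Uc_summable c).hasSum.tendsto_sum_nat

theorem Uc_law (q : ℝ) (h0 : 0 ≤ q) (h1 : q ≤ 1) :
    (Measure.infinitePi (fun _ : ℕ => bernP (1/2))).map (fun c => boolOf (Uc c < q)) = bernP q := by
  have hm : Measurable (fun c => boolOf (Uc c < q)) := measurable_boolOf (measurable_Uc measurableSet_Iio)
  have hmb : Measurable (fun (x : ℝ) n => bit n x) := measurable_pi_lambda _ measurable_bit
  have hP : IsProbabilityMeasure ((Measure.infinitePi (fun _ : ℕ => bernP (1/2))).map (fun c => boolOf (Uc c < q))) :=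
    Measure.isProbabilityMeasure_map hm.aemeasurable
  have hb : base = volume.restrict (Set.Ico 0 1) := Measure.restrict_congr_set Ico_ae_eq_Ioc.symm
  have hv : ∀ b : Bool, ((Measure.infinitePi (fun _ : ℕ => bernP (1/2))).map (fun c => boolOf (Uc c < q))) {b} = bernP q {b} := by
    intro b
    have e : bernP q {b} = ENNReal.ofReal (wB q b) := by rw [bernP, bern_single, clampI_eq h0 h1]
    rw [e, ← bits_law, Measure.map_map hm hmb,
      Measure.map_apply (hm.comp hmb) (MeasurableSet.singleton _), hb, Measure.restrict_apply' measurableSet_Ico]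
    have : (((fun c => boolOf (Uc c < q)) ∘ fun (x:ℝ) n => bit n x) ⁻¹' {b} ∩ Set.Ico 0 1)
        = if b then Set.Ico 0 q else Set.Ico q 1 := by
      ext x
      constructor
      · rintro ⟨h, hx⟩
        simp only [Function.comp, Set.mem_preimage, Set.mem_singleton_iff, Uc_bits x hx.1 hx.2, boolOf] at h
        cases b <;> simp_all
      · intro h
        have hx : x ∈ Set.Ico (0:ℝ) 1 := by
          cases b
          · simp at h; exact ⟨h0.trans h.1, h.2⟩
          · simp at h; exact ⟨h.1, h.2.trans_le h1⟩
        refine ⟨?_, hx⟩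
        simp only [Function.comp, Set.mem_preimage, Set.mem_singleton_iff, Uc_bits x hx.1 hx.2, boolOf]
        cases b <;> simp_all
    rw [this]
    cases b <;> simp [wB]
  exact Measure.ext_of_singleton hv

theorem unif_law {ι : Type} (g : ι → ℕ) (hg : Function.Injective g) (q : ι → ℝ) (h0 : ∀ i, 0 ≤ q i) (h1 : ∀ i, q i ≤ 1) :
    base.map (fun x i => boolOf (unif (g i) x < q i)) = Measure.infinitePi (fun i => bernP (q i)) := by
  have hmb : Measurable (fun (x : ℝ) n => bit n x) := measurable_pi_lambda _ measurable_bit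
  -- pairing
  have s1 : base.map (fun x (j : ℕ × ℕ) => bit (Nat.pair j.1 j.2) x) = Measure.infinitePi (fun _ : ℕ × ℕ => bernP (1/2)) := by
    rw [← reindex (fun _ : ℕ => bernP (1/2)) (fun j : ℕ × ℕ => Nat.pair j.1 j.2) (Nat.pairEquiv.injective),
      ← bits_law, Measure.map_map (by fun_prop) hmb]
    rfl
  have hmb2 : Measurable (fun x (j : ℕ × ℕ) => bit (Nat.pair j.1 j.2) x) :=
    measurable_pi_lambda _ fun _ => measurable_bit _
  have s2 : base.map (fun x (i : ℕ) (k : ℕ) => bit (Nat.pair i k) x)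
      = Measure.infinitePi (fun _ : ℕ => Measure.infinitePi (fun _ : ℕ => bernP (1/2))) := by
    have := Measure.infinitePi_map_curry (ι := ℕ) (κ := ℕ) (X := Bool) (μ := fun _ _ => bernP (1/2))
    rw [← this]
    change _ = Measure.map _ (Measure.infinitePi fun _ : ℕ × ℕ => bernP (1/2))
    rw [← s1, Measure.map_map (by fun_prop) hmb2]
    rfl
  have hmb3 : Measurable (fun x (i : ℕ) (k : ℕ) => bit (Nat.pair i k) x) :=
    measurable_pi_lambda _ fun _ => measurable_pi_lambda _ fun _ => measurable_bit _
  have s3 : base.map (fun x (i : ι) (k : ℕ) => bit (Nat.pair (g i) k) x)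
      = Measure.infinitePi (fun _ : ι => Measure.infinitePi (fun _ : ℕ => bernP (1/2))) := by
    rw [← reindex (fun _ : ℕ => Measure.infinitePi (fun _ : ℕ => bernP (1/2))) g hg, ← s2, Measure.map_map (by fun_prop) hmb3]
    rfl
  have hmb4 : Measurable (fun x (i : ι) (k : ℕ) => bit (Nat.pair (g i) k) x) :=
    measurable_pi_lambda _ fun _ => measurable_pi_lambda _ fun _ => measurable_bit _
  have hm : ∀ q, Measurable (fun c => boolOf (Uc c < q)) := fun q => measurable_boolOf (measurable_Uc measurableSet_Iio)
  have s4 := Measure.infinitePi_map_pi (fun _ : ι => Measure.infinitePi (fun _ : ℕ => bernP (1/2)))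
    (f := fun i c => boolOf (Uc c < q i)) (fun i => hm (q i))
  simp only [fun i => Uc_law (q i) (h0 i) (h1 i)] at s4
  rw [← s4, ← s3, Measure.map_map _ hmb4]
  · rfl
  · exact measurable_pi_lambda _ fun i => (hm (q i)).comp (measurable_pi_apply i)



/-! ### The model on a product space -/

abbrev Om : Type := Bool × V → Bool

noncomputable def PP (p r : ℝ) : Measure Om :=
  Measure.infinitePi (fun i : Bool × V => bernP (if i.1 then p else r))

instance (p r : ℝ) : IsProbabilityMeasure (PP p r) := by unfold PP; infer_instance

noncomputable def eta (ω : Om) : EdgeCfg := fun u v => boolOf (SqAdj u v) && ω (true, u + v)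

noncomputable def col (ω : Om) : ColourCfg := fun v => ω (false, clusterRep (eta ω) v)

noncomputable def uW (w : V) : V := (w.1 / 2, w.2 / 2)

theorem eIdx_comm (u v : V) : eIdx u v = eIdx v u := min_comm _ _

theorem eIdx_sum {u v u' v' : V} (h : eIdx u v = eIdx u' v') : u + v = u' + v' := by
  unfold eIdx at h
  have inj := Encodable.encode_injective (α := V × V)
  rcases min_choice (Encodable.encode (u, v)) (Encodable.encode (v, u)) with h1 | h1 <;>
  rcases min_choice (Encodable.encode (u', v')) (Encodable.encode (v', u')) with h2 | h2 <;>
  rw [h1, h2] at h <;> have := inj h <;> simp only [Prod.mk.injEq] at this <;>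
  obtain ⟨a, b⟩ := this <;> subst a <;> subst b <;> first | rfl | exact add_comm _ _

theorem eIdx_adj {u v : V} (h : SqAdj u v) : eIdx u v = eIdx (uW (u + v)) ((u + v) - uW (u + v)) := by
  have : (u = uW (u + v) ∧ v = (u + v) - uW (u + v)) ∨ (v = uW (u + v) ∧ u = (u + v) - uW (u + v)) := by
    rw [sqAdj_iff] at h
    simp only [uW, Prod.ext_iff, Prod.fst_add, Prod.snd_add, Prod.fst_sub, Prod.snd_sub]
    omega
  rcases this with ⟨a, b⟩ | ⟨a, b⟩
  · rw [← b, ← a]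
  · rw [← b, ← a, eIdx_comm]

noncomputable def idx (i : Bool × V) : ℕ :=
  if i.1 then 2 * eIdx (uW i.2) (i.2 - uW i.2) else 2 * Encodable.encode i.2 + 1

theorem idx_inj : Function.Injective idx := by
  rintro ⟨c, w⟩ ⟨c', w'⟩ h
  cases c <;> cases c' <;> simp only [idx] at h <;> simp at h
  · simp [h]
  · omega
  · omega
  · have := eIdx_sum h
    simp at this; simp [this]

noncomputable def toOm (p r x : ℝ) : Om := fun i => boolOf (unif (idx i) x < (if i.1 then p else r))

theorem measurable_unif (i : ℕ) : Measurable (unif i) :=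
  measurable_Uc.comp (measurable_pi_lambda _ fun k => measurable_bit (Nat.pair i k))

theorem measurable_toOm (p r : ℝ) : Measurable (toOm p r) :=
  measurable_pi_lambda _ fun i => measurable_boolOf ((measurable_unif _) measurableSet_Iio)

theorem toOm_law (p r : ℝ) (hp0 : 0 ≤ p) (hp1 : p ≤ 1) (hr0 : 0 ≤ r) (hr1 : r ≤ 1) :
    base.map (toOm p r) = PP p r :=
  unif_law idx idx_inj (fun i => if i.1 then p else r)
    (fun i => by split_ifs <;> assumption) (fun i => by split_ifs <;> assumption)

theorem edgeCfg_toOm (p r x : ℝ) : edgeCfg SqAdj p x = eta (toOm p r x) := by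
  ext u v
  by_cases h : SqAdj u v
  · simp [edgeCfg, eta, toOm, idx, h, boolOf, edgeU, eIdx_adj h]
  · simp [edgeCfg, eta, h, boolOf]

theorem colourCfg_toOm (p r x : ℝ) : colourCfg SqAdj p r x = col (toOm p r x) := by
  ext v
  simp [colourCfg, col, edgeCfg_toOm p r x, vtxU, toOm, idx]

/-! ### Measurability -/

theorem measurableSet_rtg {α β : Type} [MeasurableSpace α] [Countable β] {R : α → β → β → Prop}
    (hR : ∀ u v, MeasurableSet {a | R a u v}) (u v : β) :
    MeasurableSet {a | Relation.ReflTransGen (R a) u v} := by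
  let S : ℕ → β → Set α := fun n => Nat.rec (fun v => {a | u = v}) (fun _ T v => ⋃ w, T w ∩ {a | R a w v}) n
  have hS : ∀ n v, MeasurableSet (S n v) := by
    intro n
    induction n with
    | zero => intro v; exact MeasurableSet.const _
    | succ n ih => intro v; exact MeasurableSet.iUnion fun w => (ih w).inter (hR w v)
  have : {a | Relation.ReflTransGen (R a) u v} = ⋃ n, S n v := by
    ext a
    simp only [Set.mem_setOf_eq, Set.mem_iUnion]
    constructor
    · intro h
      induction h with
      | refl => exact ⟨0, rfl⟩
      | tail _ h ih =>
        obtain ⟨n, hn⟩ := ih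
        exact ⟨n + 1, Set.mem_iUnion.2 ⟨_, hn, h⟩⟩
    · rintro ⟨n, hn⟩
      induction n generalizing v with
      | zero => have : u = v := hn
                rw [this]
      | succ n ih =>
        obtain ⟨w, hw, hr⟩ := Set.mem_iUnion.1 hn
        exact (ih w hw).tail hr
  rw [this]; exact MeasurableSet.iUnion fun n => hS n v

theorem measurableSet_coord {ι : Type} (i : ι) (c : Bool) : MeasurableSet {ω : ι → Bool | ω i = c} :=
  measurableSet_preimage (f := fun ω : ι → Bool => ω i) (by fun_prop) (MeasurableSet.singleton c)

theorem rep_mem (η : EdgeCfg) (v : V) : Conn η v (clusterRep η v) ∧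
    ∀ w, Conn η v w → Encodable.encode (clusterRep η v) ≤ Encodable.encode w := by
  have hne : (Encodable.encode '' pCluster η v).Nonempty := ⟨_, v, Relation.ReflTransGen.refl, rfl⟩
  obtain ⟨w, hw, he⟩ := Nat.sInf_mem hne
  have : clusterRep η v = w := by
    unfold clusterRep; rw [← he, Encodable.encodek]; rfl
  rw [this]
  refine ⟨hw, fun w' hw' => ?_⟩
  rw [he]
  exact Nat.sInf_le ⟨w', hw', rfl⟩

theorem rep_eq_iff (η : EdgeCfg) (v w : V) : clusterRep η v = w ↔ (Conn η v w ∧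
    ∀ w', Conn η v w' → Encodable.encode w ≤ Encodable.encode w') := by
  obtain ⟨h1, h2⟩ := rep_mem η v
  constructor
  · rintro rfl; exact ⟨h1, h2⟩
  · rintro ⟨h3, h4⟩
    exact Encodable.encode_injective (le_antisymm (h2 _ h3) (h4 _ h1))

theorem eta_symm (ω : Om) (u v : V) : eta ω u v = eta ω v u := by
  have : SqAdj u v ↔ SqAdj v u := ⟨sqAdj_symm, sqAdj_symm⟩
  simp [eta, this, add_comm]

theorem Conn.symm {η : EdgeCfg} (hη : ∀ u v, η u v = η v u) {u v : V} (h : Conn η u v) : Conn η v u := by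
  induction h with
  | refl => exact Relation.ReflTransGen.refl
  | tail _ h ih => exact Relation.ReflTransGen.head (by rw [hη]; exact h) ih

theorem rep_eq_rep {η : EdgeCfg} (hη : ∀ u v, η u v = η v u) (u v : V) :
    clusterRep η u = clusterRep η v ↔ Conn η u v := by
  constructor
  · intro h
    exact ((rep_mem η u).1).trans (by rw [h]; exact Conn.symm hη (rep_mem η v).1)
  · intro h
    rw [rep_eq_iff]
    refine ⟨h.trans (rep_mem η v).1, fun w hw => (rep_mem η v).2 w ((Conn.symm hη h).trans hw)⟩

theorem measurableSet_eta (u v : V) (c : Bool) : MeasurableSet {ω : Om | eta ω u v = c} := by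
  have h : Measurable (fun ω : Om => boolOf (SqAdj u v) && ω (true, u + v)) :=
    (measurable_of_countable (fun b => boolOf (SqAdj u v) && b)).comp (measurable_pi_apply (true, u+v))
  exact measurableSet_preimage h (MeasurableSet.singleton c)

/-- an edge configuration depending measurably on the sample -/
theorem measurableSet_conn {F : Om → EdgeCfg} (hF : ∀ u v, MeasurableSet {ω | F ω u v = true}) (u v : V) :
    MeasurableSet {ω | Conn (F ω) u v} := measurableSet_rtg (R := fun ω a b => F ω a b = true) hF u v

theorem measurable_colF {F : Om → EdgeCfg} (hF : ∀ u v, MeasurableSet {ω | F ω u v = true}) :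
    Measurable (fun (ω : Om) (v : V) => ω (false, clusterRep (F ω) v)) := by
  refine measurable_pi_lambda _ fun v => measurable_to_bool ?_
  have : (fun ω : Om => ω (false, clusterRep (F ω) v)) ⁻¹' {true} =
      ⋃ w, ({ω | Conn (F ω) v w} ∩ ⋂ w', ({ω | Conn (F ω) v w'}ᶜ ∪ {ω | Encodable.encode w ≤ Encodable.encode w'}))
        ∩ {ω | ω (false, w) = true} := by
    ext ω
    simp only [Set.mem_preimage, Set.mem_singleton_iff, Set.mem_iUnion, Set.mem_inter_iff, Set.mem_iInter,
      Set.mem_union, Set.mem_compl_iff, Set.mem_setOf_eq, ← imp_iff_not_or, ← rep_eq_iff]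
    constructor
    · intro h; exact ⟨_, rfl, h⟩
    · rintro ⟨w, h1, h2⟩; rw [h1]; exact h2
  rw [this]
  refine MeasurableSet.iUnion fun w => MeasurableSet.inter (MeasurableSet.inter (measurableSet_conn hF _ _) ?_) (measurableSet_coord _ _)
  exact MeasurableSet.iInter fun w' => (measurableSet_conn hF _ _).compl.union (MeasurableSet.const _)

theorem measurable_col : Measurable col := measurable_colF (F := eta) (fun u v => measurableSet_eta u v true)

/-- law of the colours -/
noncomputable def mu (p r : ℝ) : Measure ColourCfg := (PP p r).map col

instance (p r : ℝ) : IsProbabilityMeasure (mu p r) :=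
  Measure.isProbabilityMeasure_map measurable_col.aemeasurable

theorem measurable_eta : Measurable eta :=
  measurable_pi_lambda _ fun u => measurable_pi_lambda _ fun v =>
    measurable_to_bool (measurableSet_eta u v true)

theorem DaC_mu (p r : ℝ) (hp0 : 0 ≤ p) (hp1 : p ≤ 1) (hr0 : 0 ≤ r) (hr1 : r ≤ 1) (C : Set ColourCfg)
    (hC : MeasurableSet C) : DaCMeasure SqAdj p r (colourEvent C) = mu p r C := by
  have h1 : (fun x => (edgeCfg SqAdj p x, colourCfg SqAdj p r x)) = (fun ω => (eta ω, col ω)) ∘ toOm p r := by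
    ext x : 1
    simp only [Function.comp]
    rw [edgeCfg_toOm p r x, colourCfg_toOm]
  have hm : Measurable (fun ω : Om => (eta ω, col ω)) := measurable_eta.prodMk measurable_col
  have hC' : MeasurableSet (colourEvent C) := measurable_snd hC
  unfold DaCMeasure mu
  rw [h1, Measure.map_apply (hm.comp (measurable_toOm p r)) hC', ← toOm_law p r hp0 hp1 hr0 hr1,
    Measure.map_apply measurable_col hC, Measure.map_apply (measurable_toOm p r) (measurable_col hC)]
  rfl



/-! ### Local events -/

def DepOn {ι : Type} (A : Set (ι → Bool)) (S : Set ι) : Prop :=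
  ∀ ξ ξ' : ι → Bool, (∀ v ∈ S, ξ v = ξ' v) → ξ ∈ A → ξ' ∈ A

theorem DepOn.iff {ι : Type} {A : Set (ι → Bool)} {S : Set ι} (h : DepOn A S) {ξ ξ' : ι → Bool}
    (e : ∀ v ∈ S, ξ v = ξ' v) : ξ ∈ A ↔ ξ' ∈ A :=
  ⟨h _ _ e, h _ _ fun v hv => (e v hv).symm⟩

theorem DepOn.mono {ι : Type} {A : Set (ι → Bool)} {S T : Set ι} (h : DepOn A S) (hST : S ⊆ T) : DepOn A T :=
  fun ξ ξ' e => h ξ ξ' fun v hv => e v (hST hv)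

theorem DepOn.inter {ι : Type} {A B : Set (ι → Bool)} {S : Set ι} (h : DepOn A S) (h' : DepOn B S) : DepOn (A ∩ B) S :=
  fun ξ ξ' e hx => ⟨h ξ ξ' e hx.1, h' ξ ξ' e hx.2⟩

theorem DepOn.union {ι : Type} {A B : Set (ι → Bool)} {S : Set ι} (h : DepOn A S) (h' : DepOn B S) : DepOn (A ∪ B) S :=
  fun ξ ξ' e hx => hx.imp (h ξ ξ' e) (h' ξ ξ' e)

theorem DepOn.compl {ι : Type} {A : Set (ι → Bool)} {S : Set ι} (h : DepOn A S) : DepOn Aᶜ S :=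
  fun ξ ξ' e hx hx' => hx ((h.iff e).2 hx')

theorem DepOn.eq_preimage {ι : Type} {A : Set (ι → Bool)} {S : Set ι} (h : DepOn A S) :
    A = S.restrict ⁻¹' (S.restrict '' A) := by
  ext ξ
  constructor
  · intro hx; exact ⟨ξ, hx, rfl⟩
  · rintro ⟨ξ', hx', e⟩
    exact h ξ' ξ (fun v hv => congrFun e ⟨v, hv⟩) hx'

theorem DepOn.meas {ι : Type} {A : Set (ι → Bool)} {S : Set ι} (h : DepOn A S) (hS : S.Finite) : MeasurableSet A := by
  rw [h.eq_preimage]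
  have := hS.to_subtype
  have hm : Measurable (S.restrict : (ι → Bool) → (S → Bool)) :=
    measurable_pi_lambda _ fun i => measurable_pi_apply _
  exact hm (Set.toFinite _).measurableSet

open Classical in
theorem local_sum {ι I : Type} [Fintype I] (q : ι → ℝ) (φ : I → ι) (hφ : Function.Injective φ) (Q : (I → Bool) → Prop) :
    (Measure.infinitePi (fun i => bernP (q i))).real {ω | Q (fun i => ω (φ i))}
      = ∑ d : I → Bool, (∏ i, wB (clampI (q (φ i))) (d i)) * (if Q d then 1 else 0) := by
  have h := reindex (fun i => bernP (q i)) φ hφ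
  have hw : ∀ q b, 0 ≤ wB (clampI q) b := by
    intro q b
    have h0 : 0 ≤ clampI q := by simp [clampI]
    have h1 : clampI q ≤ 1 := by simp [clampI]
    cases b <;> simp [wB] <;> linarith
  have e1 : (Measure.infinitePi (fun i => bernP (q i))) {ω | Q (fun i => ω (φ i))}
      = (Measure.infinitePi (fun i => bernP (q (φ i)))) {d | Q d} := by
    rw [← h, Measure.map_apply (by fun_prop) (Set.toFinite _).measurableSet]; rfl
  rw [Measure.real, e1, ← Measure.real]
  have : {d : I → Bool | Q d} = ((Finset.univ.filter Q : Finset (I → Bool)) : Set (I → Bool)) := by ext; simp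
  rw [this, ← sum_measureReal_singleton, Finset.sum_filter]
  refine Finset.sum_congr rfl fun d _ => ?_
  split_ifs
  · rw [mul_one, Measure.real, Measure.infinitePi_singleton_of_fintype, ENNReal.toReal_prod]
    refine Finset.prod_congr rfl fun i _ => ?_
    rw [bernP, bern_single, ENNReal.toReal_ofReal (hw _ _)]
  · simp

/-! ### Finite volume -/

open Classical in
noncomputable def etaN (Λ : Set V) (ω : Om) : EdgeCfg := fun u v => eta ω u v && (decide (u ∈ Λ) && decide (v ∈ Λ))

theorem etaN_iff (Λ : Set V) (ω : Om) (u v : V) : etaN Λ ω u v = true ↔ eta ω u v = true ∧ u ∈ Λ ∧ v ∈ Λ := by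
  simp [etaN]

theorem eta_iff (ω : Om) (u v : V) : eta ω u v = true ↔ SqAdj u v ∧ ω (true, u + v) = true := by
  simp [eta, boolOf]

theorem etaN_symm (Λ : Set V) (ω : Om) (u v : V) : etaN Λ ω u v = etaN Λ ω v u := by
  rw [Bool.eq_iff_iff, etaN_iff, etaN_iff, eta_symm]; tauto

noncomputable def colN (Λ : Set V) (ω : Om) : ColourCfg := fun v => ω (false, clusterRep (etaN Λ ω) v)

theorem measurable_colN (Λ : Set V) : Measurable (colN Λ) := by
  refine measurable_colF (F := etaN Λ) (fun u v => ?_)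
  simp only [etaN_iff]
  exact (measurableSet_eta u v true).inter (MeasurableSet.const _)

abbrev EN (Λ : Finset V) : Type := {w : V // uW w ∈ Λ ∧ w - uW w ∈ Λ ∧ SqAdj (uW w) (w - uW w)}

instance (Λ : Finset V) : Finite (EN Λ) := by
  refine Finite.of_injective (β := Λ × Λ) (fun w => (⟨uW w.1, w.2.1⟩, ⟨w.1 - uW w.1, w.2.2.1⟩)) ?_
  rintro ⟨w, hw⟩ ⟨w', hw'⟩ h
  simp only [Prod.mk.injEq, Subtype.mk.injEq] at h
  have : w = w' := by
    have h2 := h.2; rw [h.1] at h2; simpa using h2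
  subst this; rfl

noncomputable instance (Λ : Finset V) : Fintype (EN Λ) := Fintype.ofFinite _

noncomputable instance ordN (Λ : Finset V) : LinearOrder Λ :=
  LinearOrder.lift' (fun v : Λ => Encodable.encode v.1) (fun a b h => Subtype.ext (Encodable.encode_injective h))

noncomputable def sN (Λ : Finset V) (e : EN Λ) : Λ := ⟨uW e.1, e.2.1⟩
noncomputable def tN (Λ : Finset V) (e : EN Λ) : Λ := ⟨e.1 - uW e.1, e.2.2.1⟩

theorem adj_uW {u v : V} (h : SqAdj u v) : (u = uW (u + v) ∧ v = (u + v) - uW (u + v)) ∨ (v = uW (u + v) ∧ u = (u + v) - uW (u + v)) := by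
  rw [sqAdj_iff] at h
  simp only [uW, Prod.ext_iff, Prod.fst_add, Prod.snd_add, Prod.fst_sub, Prod.snd_sub]
  omega

theorem GS_iff (Λ : Finset V) (ω : Om) (u v : Λ) :
    GS (sN Λ) (tN Λ) (fun e => ω (true, e.1)) u v ↔ etaN Λ ω u.1 v.1 = true := by
  rw [etaN_iff, eta_iff]
  constructor
  · rintro ⟨e, he, ⟨rfl, rfl⟩ | ⟨rfl, rfl⟩⟩
    · refine ⟨⟨e.2.2.2, ?_⟩, e.2.1, e.2.2.1⟩
      simpa [sN, tN] using he
    · refine ⟨⟨sqAdj_symm e.2.2.2, ?_⟩, e.2.2.1, e.2.1⟩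
      simpa [sN, tN] using he
  · rintro ⟨⟨h, ho⟩, hu, hv⟩
    rcases adj_uW h with ⟨a, b⟩ | ⟨a, b⟩
    · refine ⟨⟨u.1 + v.1, ?_, ?_, ?_⟩, ho, Or.inl ⟨Subtype.ext a, Subtype.ext b⟩⟩
      · rw [← a]; exact u.2
      · rw [← b]; exact v.2
      · rw [← b, ← a]; exact h
    · refine ⟨⟨u.1 + v.1, ?_, ?_, ?_⟩, ho, Or.inr ⟨Subtype.ext b, Subtype.ext a⟩⟩
      · rw [← a]; exact v.2
      · rw [← b]; exact u.2
      · rw [← b, ← a]; exact sqAdj_symm h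

theorem GC_iff (Λ : Finset V) (ω : Om) (u : Λ) (v : V) :
    Conn (etaN Λ ω) u.1 v ↔ ∃ h : v ∈ Λ, GC (sN Λ) (tN Λ) (fun e => ω (true, e.1)) u ⟨v, h⟩ := by
  constructor
  · intro h
    induction h with
    | refl => exact ⟨u.2, Relation.ReflTransGen.refl⟩
    | tail _ h ih =>
      obtain ⟨hb, hg⟩ := ih
      refine ⟨((etaN_iff _ _ _ _).1 h).2.2, hg.tail ?_⟩
      rw [GS_iff]; exact h
  · rintro ⟨h, hg⟩
    have : ∀ w : Λ, GC (sN Λ) (tN Λ) (fun e => ω (true, e.1)) u w → Conn (etaN Λ ω) u.1 w.1 := by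
      intro w hw
      induction hw with
      | refl => exact Relation.ReflTransGen.refl
      | tail _ h ih => exact Relation.ReflTransGen.tail ih ((GS_iff _ _ _ _).1 h)
    exact this _ hg

theorem rep_rt (Λ : Finset V) (ω : Om) (v : Λ) :
    clusterRep (etaN Λ ω) v.1 = (rt (sN Λ) (tN Λ) (fun e => ω (true, e.1)) v).1 := by
  rw [rep_eq_iff]
  constructor
  · rw [GC_iff]; exact ⟨Subtype.prop _, rt_conn _ _ _ _⟩
  · intro w hw
    rw [GC_iff] at hw
    obtain ⟨h, hg⟩ := hw
    exact rt_le hg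

open Classical in
/-- extension by `false` -/
noncomputable def extN (Λ : Finset V) (ξ : Λ → Bool) : ColourCfg := fun v => if h : v ∈ Λ then ξ ⟨v, h⟩ else false

def phiN (Λ : Finset V) : Λ ⊕ EN Λ → Bool × V := Sum.elim (fun v => (false, v.1)) (fun e => (true, e.1))

theorem phiN_inj (Λ : Finset V) : Function.Injective (phiN Λ) := by
  rintro (a | a) (b | b) h <;> simp [phiN] at h ⊢ <;> first | exact h | exact Subtype.ext h

noncomputable def exF {W E : Type} [Fintype W] [LinearOrder W] [Fintype E] [DecidableEq E] (s t : E → W) (p r : ℝ)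
    (F : (W → Bool) → ℝ) : ℝ := ∑ b : W → Bool, ∑ η : E → Bool,
      (∏ v, wB r (b v)) * (∏ e, wB p (η e)) * F (fun v => b (rt s t η v))

theorem exF_split {W E : Type} [Fintype W] [LinearOrder W] [Fintype E] [DecidableEq E] (s t : E → W) (p r : ℝ)
    (F : (W → Bool) → ℝ) (inst : Fintype (W ⊕ E → Bool)) (G : (W ⊕ E → Bool) → ℝ)
    (h : ∀ b η, G (Sum.elim b η) = (∏ v, wB r (b v)) * (∏ e, wB p (η e)) * F (fun v => b (rt s t η v))) :
    ∑ d, G d = exF s t p r F := by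
  unfold exF
  rw [← Fintype.sum_prod_type']
  refine (Fintype.sum_equiv (Equiv.sumArrowEquivProdArrow W E Bool).symm _ _ ?_).symm
  rintro ⟨b, η⟩
  exact (h b η).symm

open Classical in
noncomputable def indN (Λ : Finset V) (A : Set ColourCfg) (ξ : Λ → Bool) : ℝ := if extN Λ ξ ∈ A then 1 else 0

theorem indN_mul (Λ : Finset V) (A B : Set ColourCfg) (ξ : Λ → Bool) : indN Λ (A ∩ B) ξ = indN Λ A ξ * indN Λ B ξ := by
  unfold indN
  by_cases h1 : extN Λ ξ ∈ A <;> by_cases h2 : extN Λ ξ ∈ B <;> simp [h1, h2]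

theorem colN_sum (p r : ℝ) (hp0 : 0 ≤ p) (hp1 : p ≤ 1) (hr0 : 0 ≤ r) (hr1 : r ≤ 1) (Λ : Finset V) (A : Set ColourCfg) (hA : DepOn A Λ) :
    (PP p r).real {ω | colN Λ ω ∈ A} = exF (sN Λ) (tN Λ) p r (indN Λ A) := by
  classical
  have h1 : {ω | colN Λ ω ∈ A} = {ω : Om | (fun d : Λ ⊕ EN Λ → Bool => extN Λ (fun v => d (Sum.inl (rt (sN Λ) (tN Λ) (fun e => d (Sum.inr e)) v))) ∈ A) (fun i => ω (phiN Λ i))} := by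
    ext ω
    refine hA.iff fun v hv => ?_
    have hv : v ∈ Λ := hv
    have := rep_rt Λ ω ⟨v, hv⟩
    simp only at this
    simp only [colN, extN, hv, phiN, this, Sum.elim_inl, Sum.elim_inr, dite_true]
  have h2 := local_sum (fun i : Bool × V => if i.1 then p else r) (phiN Λ) (phiN_inj Λ)
    (fun d : Λ ⊕ EN Λ → Bool => extN Λ (fun v => d (Sum.inl (rt (sN Λ) (tN Λ) (fun e => d (Sum.inr e)) v))) ∈ A)
  rw [h1]
  refine h2.trans ?_
  refine exF_split (sN Λ) (tN Λ) p r _ _ _ fun b η => ?_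
  rw [Fintype.prod_sum_type]
  simp only [phiN, Sum.elim_inl, Sum.elim_inr, if_true, Bool.false_eq_true, if_false,
    clampI_eq hp0 hp1, clampI_eq hr0 hr1, indN]
  congr!

theorem colN_fkg (p r : ℝ) (hp0 : 0 ≤ p) (hp1 : p ≤ 1/2) (hr0 : 0 ≤ r) (hr1 : r ≤ 1) (Λ : Finset V) (A B : Set ColourCfg)
    (hA : DepOn A Λ) (hB : DepOn B Λ) (mA : IsUpperSet A) (mB : IsUpperSet B) :
    (PP p r).real {ω | colN Λ ω ∈ A} * (PP p r).real {ω | colN Λ ω ∈ B} ≤ (PP p r).real {ω | colN Λ ω ∈ A ∩ B} := by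
  have hp1' : p ≤ 1 := by linarith
  rw [colN_sum p r hp0 hp1' hr0 hr1 Λ A hA, colN_sum p r hp0 hp1' hr0 hr1 Λ B hB, colN_sum p r hp0 hp1' hr0 hr1 Λ _ (hA.inter hB)]
  have hmono : ∀ ξ ξ' : Λ → Bool, ξ ≤ ξ' → extN Λ ξ ≤ extN Λ ξ' := by
    intro ξ ξ' h v
    unfold extN
    split_ifs with hv
    · exact h ⟨v, hv⟩
    · exact le_rfl
  have hm : ∀ C : Set ColourCfg, IsUpperSet C → Monotone (indN Λ C) := by
    intro C hC ξ ξ' h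
    unfold indN
    by_cases h1 : extN Λ ξ ∈ C
    · rw [if_pos h1, if_pos (hC (hmono _ _ h) h1)]
    · rw [if_neg h1]; split_ifs <;> norm_num
  have h0 : ∀ C : Set ColourCfg, (0 : (Λ → Bool) → ℝ) ≤ indN Λ C := by
    intro C ξ; unfold indN; simp only [Pi.zero_apply]; split_ifs <;> norm_num
  have := finite_fkg (sN Λ) (tN Λ) p r hp0 hp1 hr0 hr1 _ _ (h0 A) (h0 B) (hm A mA) (hm B mB)
  have e : indN Λ (A ∩ B) = fun ξ => indN Λ A ξ * indN Λ B ξ := funext fun ξ => indN_mul Λ A B ξ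
  rw [e]
  exact this

/-! ### Infinite volume limit -/

theorem conn_etaN_mono {Λ Λ' : Set V} (h : Λ ⊆ Λ') {ω : Om} {u v : V} (hc : Conn (etaN Λ ω) u v) : Conn (etaN Λ' ω) u v :=
  Relation.ReflTransGen.mono (fun a b hab => by
    rw [etaN_iff] at *; exact ⟨hab.1, h hab.2.1, h hab.2.2⟩) _ _ hc

theorem conn_etaN_le {Λ : Set V} {ω : Om} {u v : V} (hc : Conn (etaN Λ ω) u v) : Conn (eta ω) u v :=
  Relation.ReflTransGen.mono (fun a b hab => ((etaN_iff _ _ _ _).1 hab).1) _ _ hc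

theorem exists_box (v : V) : ∃ N : ℕ, v ∈ Bx N := by
  refine ⟨v.1.natAbs + v.2.natAbs, ?_⟩
  rw [mem_Bx]
  omega

theorem Bx_mono {m n : ℤ} (h : m ≤ n) : Bx m ⊆ Bx n := by
  intro v; rw [mem_Bx, mem_Bx]; omega

theorem conn_etaN_exists {ω : Om} {u v : V} (hc : Conn (eta ω) u v) : ∃ N : ℕ, Conn (etaN (Bx N) ω) u v := by
  induction hc with
  | refl => exact ⟨0, Relation.ReflTransGen.refl⟩
  | @tail b c _ h ih =>
    obtain ⟨N, hN⟩ := ih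
    obtain ⟨N1, h1⟩ := exists_box b
    obtain ⟨N2, h2⟩ := exists_box c
    refine ⟨max N (max N1 N2), (conn_etaN_mono (Bx_mono (by simp)) hN).tail ?_⟩
    rw [etaN_iff]
    exact ⟨h, Bx_mono (by simp) h1, Bx_mono (by simp) h2⟩

theorem rep_eventually (ω : Om) (v : V) : ∃ N : ℕ, ∀ M : ℕ, N ≤ M → clusterRep (etaN (Bx M) ω) v = clusterRep (eta ω) v := by
  obtain ⟨N, hN⟩ := conn_etaN_exists (rep_mem (eta ω) v).1
  refine ⟨N, fun M hM => ?_⟩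
  rw [rep_eq_iff]
  exact ⟨conn_etaN_mono (Bx_mono (by exact_mod_cast hM)) hN, fun w hw => (rep_mem (eta ω) v).2 w (conn_etaN_le hw)⟩

theorem colN_tendsto (p r : ℝ) (A : Set ColourCfg) (S : Finset V) (hA : DepOn A S) :
    Filter.Tendsto (fun N : ℕ => (PP p r).real {ω | colN (Bx N) ω ∈ A}) Filter.atTop (nhds ((mu p r).real A)) := by
  have hAm : MeasurableSet A := hA.meas S.finite_toSet
  have e : (mu p r).real A = (PP p r).real {ω | col ω ∈ A} := by
    rw [Measure.real, mu, Measure.map_apply measurable_col hAm]; rfl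
  rw [e]
  have hm : ∀ N : ℕ, MeasurableSet {ω | colN (Bx N) ω ∈ A} := fun N => measurable_colN _ hAm
  have hm' : MeasurableSet {ω | col ω ∈ A} := measurable_col hAm
  have : Filter.Tendsto (fun N : ℕ => PP p r {ω | colN (Bx N) ω ∈ A}) Filter.atTop (nhds (PP p r {ω | col ω ∈ A})) := by
    refine tendsto_measure_of_ae_tendsto_indicator_of_isFiniteMeasure Filter.atTop hm' hm ?_
    filter_upwards with ω
    have hev : ∀ v, ∀ᶠ N : ℕ in Filter.atTop, colN (Bx N) ω v = col ω v := by
      intro v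
      obtain ⟨N, hN⟩ := rep_eventually ω v
      filter_upwards [Filter.eventually_ge_atTop N] with M hM
      simp [colN, col, hN M hM]
    have hall : ∀ᶠ N : ℕ in Filter.atTop, ∀ v ∈ S, colN (Bx N) ω v = col ω v :=
      (Filter.eventually_all_finset S).2 fun v _ => hev v
    filter_upwards [hall] with N hN
    exact hA.iff hN
  exact (ENNReal.tendsto_toReal (measure_ne_top _ _)).comp this

theorem Bx_finite (n : ℤ) : (Bx n).Finite := by
  refine (Set.finite_Icc ((-n, -n) : V) (n, n)).subset fun v hv => ?_
  rw [mem_Bx] at hv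
  exact ⟨⟨by simp; omega, by simp; omega⟩, ⟨by simp; omega, by simp; omega⟩⟩

theorem mu_fkg (p r : ℝ) (hp0 : 0 ≤ p) (hp1 : p ≤ 1/2) (hr0 : 0 ≤ r) (hr1 : r ≤ 1) (S : Finset V) (A B : Set ColourCfg)
    (hA : DepOn A S) (hB : DepOn B S) (mA : IsUpperSet A) (mB : IsUpperSet B) :
    (mu p r).real A * (mu p r).real B ≤ (mu p r).real (A ∩ B) := by
  refine le_of_tendsto_of_tendsto ((colN_tendsto p r A S hA).mul (colN_tendsto p r B S hB)) (colN_tendsto p r _ S (hA.inter hB)) ?_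
  have hS : ∃ N : ℕ, (S : Set V) ⊆ Bx N := by
    choose f hf using exists_box
    refine ⟨S.sup f, fun v hv => Bx_mono ?_ (hf v)⟩
    exact_mod_cast Finset.le_sup (f := f) hv
  obtain ⟨N, hN⟩ := hS
  filter_upwards [Filter.eventually_ge_atTop N] with M hM
  have hS : (S : Set V) ⊆ ((Bx_finite M).toFinset : Set V) := by
    rw [Set.Finite.coe_toFinset]; exact hN.trans (Bx_mono (by exact_mod_cast hM))
  have := colN_fkg p r hp0 hp1 hr0 hr1 (Bx_finite M).toFinset A B (hA.mono hS) (hB.mono hS) mA mB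
  rw [Set.Finite.coe_toFinset] at this
  exact this



/-! ### Symmetries of the colour law -/

noncomputable def Pq (q : ℝ) : Measure (V → Bool) := Measure.infinitePi (fun _ : V => bernP q)
instance (q : ℝ) : IsProbabilityMeasure (Pq q) := by unfold Pq; infer_instance

def comb (x : (V → Bool) × (V → Bool)) : Om := fun i => if i.1 then x.1 i.2 else x.2 i.2

theorem measurable_comb : Measurable comb := by
  refine measurable_pi_lambda _ fun i => ?_
  rcases i with ⟨c, v⟩
  cases c
  · exact (measurable_pi_apply v).comp measurable_snd
  · exact (measurable_pi_apply v).comp measurable_fst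

theorem measurableSet_cyl {ι : Type} (s : Finset ι) (d : ι → Bool) : MeasurableSet {c : ι → Bool | ∀ i ∈ s, c i = d i} :=
  DepOn.meas (S := s) (fun ξ ξ' e h i hi => by rw [← e i hi]; exact h i hi) s.finite_toSet

theorem PP_prod (p r : ℝ) : ((Pq p).prod (Pq r)).map comb = PP p r := by
  classical
  have : IsProbabilityMeasure (((Pq p).prod (Pq r)).map comb) :=
    Measure.isProbabilityMeasure_map measurable_comb.aemeasurable
  refine ext_cyl' _ _ fun s d => ?_
  rw [Measure.map_apply measurable_comb (measurableSet_cyl s d), PP, infPi_cyl]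
  let s1 : Finset V := (s.filter (fun i => i.1 = true)).image Prod.snd
  let s2 : Finset V := (s.filter (fun i => i.1 = false)).image Prod.snd
  have e : comb ⁻¹' {c | ∀ i ∈ s, c i = d i} = {c : V → Bool | ∀ v ∈ s1, c v = d (true, v)} ×ˢ {c : V → Bool | ∀ v ∈ s2, c v = d (false, v)} := by
    ext ⟨x, y⟩
    simp only [Set.mem_preimage, Set.mem_setOf_eq, Set.mem_prod, comb, s1, s2, Finset.mem_image, Finset.mem_filter]
    constructor
    · intro h
      constructor
      · rintro v ⟨⟨c, w⟩, ⟨h1, h2⟩, rfl⟩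
        simp only at h2; subst h2
        simpa using h _ h1
      · rintro v ⟨⟨c, w⟩, ⟨h1, h2⟩, rfl⟩
        simp only at h2; subst h2
        simpa using h _ h1
    · rintro ⟨h1, h2⟩ ⟨c, v⟩ hi
      cases c
      · simpa using h2 v ⟨_, ⟨hi, rfl⟩, rfl⟩
      · simpa using h1 v ⟨_, ⟨hi, rfl⟩, rfl⟩
  rw [e, Measure.prod_prod, Pq, Pq, infPi_cyl, infPi_cyl,
    ← Finset.prod_filter_mul_prod_filter_not s (fun i => i.1 = true)]
  congr 1
  · rw [Finset.prod_image]
    · refine Finset.prod_congr rfl fun i hi => ?_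
      obtain ⟨c, v⟩ := i
      have := (Finset.mem_filter.1 hi).2
      simp only at this; subst this; simp
    · rintro ⟨c, v⟩ h ⟨c', v'⟩ h' hh
      have h := (Finset.mem_filter.1 h).2; have h' := (Finset.mem_filter.1 h').2
      simp only at h h' hh; rw [h, h', hh]
  · have : s.filter (fun i => ¬ i.1 = true) = s.filter (fun i => i.1 = false) := by
      congr! 2; simp
    rw [this, Finset.prod_image]
    · refine Finset.prod_congr rfl fun i hi => ?_
      obtain ⟨c, v⟩ := i
      have := (Finset.mem_filter.1 hi).2
      simp only at this; subst this; simp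
    · rintro ⟨c, v⟩ h ⟨c', v'⟩ h' hh
      have h := (Finset.mem_filter.1 h).2; have h' := (Finset.mem_filter.1 h').2
      simp only at h h' hh; rw [h, h', hh]

noncomputable def etaE (e : V → Bool) : EdgeCfg := fun u v => boolOf (SqAdj u v) && e (u + v)

theorem eta_comb (x : (V → Bool) × (V → Bool)) : eta (comb x) = etaE x.1 := rfl

theorem etaE_symm (e : V → Bool) (u v : V) : etaE e u v = etaE e v u := eta_symm (comb (e, e)) u v

/-- Colouring of representatives only depends on the partition. -/
theorem kernel_law (q : ℝ) (S : Finset V) (d : V → Bool) (g g' : V → V)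
    (h : ∀ u ∈ S, ∀ v ∈ S, (g u = g v ↔ g' u = g' v)) :
    Pq q {b | ∀ v ∈ S, b (g v) = d v} = Pq q {b | ∀ v ∈ S, b (g' v) = d v} := by
  classical
  have ht : ∀ v, ∃ t, v ∈ S → (t ∈ S ∧ g t = g v) := fun v => ⟨v, fun hv => ⟨hv, rfl⟩⟩
  let t : V → V := fun v => Function.invFunOn g S (g v)
  have t1 : ∀ v ∈ S, t v ∈ S ∧ g (t v) = g v := fun v hv =>
    ⟨Function.invFunOn_mem ⟨v, hv, rfl⟩, Function.invFunOn_eq ⟨v, hv, rfl⟩⟩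
  have t2 : ∀ u v, g u = g v → t u = t v := fun u v h => by simp only [t, h]
  have key : ∀ k : V → V, (∀ u ∈ S, ∀ v ∈ S, (g u = g v ↔ k u = k v)) →
      Pq q {b | ∀ v ∈ S, b (k v) = d v} = if (∀ v ∈ S, d (t v) = d v) then ∏ v ∈ S.image t, ENNReal.ofReal (wB (clampI q) (d v)) else 0 := by
    intro k hk
    have kt : ∀ v ∈ S, k (t v) = k v := fun v hv => (hk _ (t1 v hv).1 _ hv).1 (t1 v hv).2
    have inj : ∀ x ∈ S.image t, ∀ y ∈ S.image t, k x = k y → x = y := by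
      intro x hx y hy hxy
      obtain ⟨u, hu, rfl⟩ := Finset.mem_image.1 hx
      obtain ⟨v, hv, rfl⟩ := Finset.mem_image.1 hy
      have := (hk _ (t1 u hu).1 _ (t1 v hv).1).2 hxy
      rw [(t1 u hu).2, (t1 v hv).2] at this
      exact t2 _ _ this
    split_ifs with hc
    · let d' : V → Bool := fun w => d (Function.invFunOn k (S.image t) w)
      have hd' : ∀ x ∈ S.image t, d' (k x) = d x := by
        intro x hx
        have h1 : Function.invFunOn k (S.image t) (k x) ∈ (S.image t : Set V) := Function.invFunOn_mem ⟨x, hx, rfl⟩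
        have h2 : k (Function.invFunOn k (S.image t) (k x)) = k x := Function.invFunOn_eq ⟨x, hx, rfl⟩
        simp only [d']; rw [inj _ h1 _ hx h2]
      have e : {b : V → Bool | ∀ v ∈ S, b (k v) = d v} = {b | ∀ w ∈ (S.image t).image k, b w = d' w} := by
        ext b
        simp only [Set.mem_setOf_eq, Finset.forall_mem_image]
        constructor
        · intro hb v hv
          rw [hd' _ (Finset.mem_image_of_mem t hv), hb _ (t1 v hv).1]
        · intro hb v hv
          have := hb hv
          rw [hd' _ (Finset.mem_image_of_mem t hv), kt v hv, hc v hv] at this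
          exact this
      rw [e, Pq, infPi_cyl, Finset.prod_image inj]
      exact Finset.prod_congr rfl fun x hx => by rw [hd' x hx]
    · push Not at hc
      obtain ⟨v, hv, hne⟩ := hc
      have : {b : V → Bool | ∀ v ∈ S, b (k v) = d v} = ∅ := by
        ext b
        simp only [Set.mem_setOf_eq, Set.mem_empty_iff_false, iff_false]
        intro hb
        apply hne
        rw [← hb _ (t1 v hv).1, ← hb v hv, kt v hv]
      rw [this, measure_empty]
  rw [key g (fun _ _ _ _ => Iff.rfl), key g' h]

theorem mu_cyl (p r : ℝ) (S : Finset V) (d : V → Bool) (τ : V → V) :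
    mu p r {ξ | ∀ v ∈ S, ξ (τ v) = d v} = ∫⁻ e, Pq r {b | ∀ v ∈ S, b (clusterRep (etaE e) (τ v)) = d v} ∂(Pq p) := by
  have hm : MeasurableSet {ξ : ColourCfg | ∀ v ∈ S, ξ (τ v) = d v} := by
    have h1 : Measurable (fun ξ : ColourCfg => fun v => ξ (τ v)) := by fun_prop
    exact h1 (measurableSet_cyl S d)
  rw [mu, Measure.map_apply measurable_col hm, ← PP_prod, Measure.map_apply measurable_comb (measurable_col hm),
    Measure.prod_apply (measurable_comb (measurable_col hm))]
  rfl

theorem mu_sym (p r : ℝ) (τ : V ≃ V) (τ2 : V → V) (h2 : Function.Injective τ2)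
    (ha : ∀ u v, SqAdj (τ u) (τ v) ↔ SqAdj u v) (hs : ∀ u v, SqAdj u v → τ u + τ v = τ2 (u + v)) :
    (mu p r).map (fun ξ v => ξ (τ v)) = mu p r := by
  have hmt : Measurable (fun (ξ : ColourCfg) v => ξ (τ v)) := by fun_prop
  have : IsProbabilityMeasure ((mu p r).map (fun ξ v => ξ (τ v))) :=
    Measure.isProbabilityMeasure_map hmt.aemeasurable
  refine ext_cyl' _ _ fun S d => ?_
  rw [Measure.map_apply hmt (measurableSet_cyl S d)]
  change mu p r {ξ | ∀ v ∈ S, ξ (τ v) = d v} = _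
  rw [mu_cyl p r S d τ]
  have hid := mu_cyl p r S d id
  simp only [id] at hid
  rw [hid]
  have hP : (Pq p).map (fun e w => e (τ2 w)) = Pq p := reindex (fun _ => bernP p) τ2 h2
  have hstep : ∀ e u v, etaE (fun w => e (τ2 w)) u v = etaE e (τ u) (τ v) := by
    intro e u v
    by_cases h : SqAdj u v
    · simp [etaE, ha, hs u v h]
    · simp [etaE, ha, h, boolOf]
  have hconn : ∀ e u v, Conn (etaE (fun w => e (τ2 w))) u v ↔ Conn (etaE e) (τ u) (τ v) := by
    intro e u v
    constructor
    · intro h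
      induction h with
      | refl => exact Relation.ReflTransGen.refl
      | tail _ h ih => exact Relation.ReflTransGen.tail ih (by rw [← hstep]; exact h)
    · intro h
      have : ∀ w, Conn (etaE e) (τ u) w → Conn (etaE (fun w => e (τ2 w))) u (τ.symm w) := by
        intro w hw
        induction hw with
        | refl => simp; exact Relation.ReflTransGen.refl
        | tail _ h ih => exact Relation.ReflTransGen.tail ih (by rw [hstep]; simpa using h)
      simpa using this _ h
  have hm : Measurable fun e => Pq r {b | ∀ v ∈ S, b (clusterRep (etaE e) v) = d v} := by
    have hmm : MeasurableSet {x : (V → Bool) × (V → Bool) | ∀ v ∈ S, col (comb x) v = d v} :=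
      (measurable_col.comp measurable_comb) (measurableSet_cyl S d)
    exact measurable_measure_prodMk_left hmm
  conv_rhs => rw [← hP]
  rw [lintegral_map hm (by fun_prop)]
  refine lintegral_congr fun e => ?_
  refine kernel_law r S d _ _ fun u _ v _ => ?_
  rw [rep_eq_rep (etaE_symm e), rep_eq_rep (etaE_symm _), hconn]

/-- swapping colours -/
theorem bernP_not (q : ℝ) (h0 : 0 ≤ q) (h1 : q ≤ 1) : (bernP q).map Bool.not = bernP (1 - q) := by
  refine Measure.ext_of_singleton fun b => ?_
  rw [Measure.map_apply (measurable_of_countable _) (MeasurableSet.singleton _)]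
  have : Bool.not ⁻¹' {b} = {!b} := by ext x; cases x <;> cases b <;> simp
  rw [this, bernP, bernP, bern_single, bern_single, clampI_eq h0 h1, clampI_eq (by linarith) (by linarith)]
  cases b <;> simp [wB]

theorem mu_flip (p r : ℝ) (h0 : 0 ≤ r) (h1 : r ≤ 1) :
    (mu p r).map (fun ξ v => !(ξ v)) = mu p (1 - r) := by
  let f : Bool × V → Bool → Bool := fun i c => if i.1 then c else !c
  have hf : ∀ i, Measurable (f i) := fun i => measurable_of_countable _
  have hP : (PP p r).map (fun ω i => f i (ω i)) = PP p (1 - r) := by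
    rw [PP, Measure.infinitePi_map_pi _ hf, PP]
    congr 1
    ext1 ⟨c, v⟩
    cases c
    · simp only [f, Bool.false_eq_true, if_false]; exact bernP_not r h0 h1
    · simp only [f, if_true]; exact Measure.map_id
  have hmn : Measurable (fun (ξ : ColourCfg) v => !(ξ v)) :=
    measurable_pi_lambda _ fun v => (measurable_of_countable Bool.not).comp (measurable_pi_apply v)
  have hmf : Measurable (fun (ω : Om) i => f i (ω i)) :=
    measurable_pi_lambda _ fun v => (hf v).comp (measurable_pi_apply v)
  rw [mu, mu, ← hP, Measure.map_map hmn measurable_col, Measure.map_map measurable_col hmf]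
  congr 1



/-! ### Independence and the zero-one law -/

open Classical in
noncomputable def resetTo {ι : Type} (S : Set ι) (ω : ι → Bool) : ι → Bool := fun i => if i ∈ S then ω i else false

theorem DepOn.meas_iSup {ι : Type} {A : Set (ι → Bool)} {S : Set ι} (h : DepOn A S) (hA : MeasurableSet A) :
    MeasurableSet[⨆ i ∈ S, MeasurableSpace.comap (fun ω : ι → Bool => ω i) inferInstance] A := by
  have e : A = resetTo S ⁻¹' A := by
    ext ω
    exact h.iff fun v hv => by simp [resetTo, hv]
  rw [e]
  have hm : Measurable[⨆ i ∈ S, MeasurableSpace.comap (fun ω : ι → Bool => ω i) inferInstance] (resetTo S) := by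
    refine @measurable_pi_lambda _ _ _ (_) _ _ fun i => ?_
    by_cases hi : i ∈ S
    · have h1 : Measurable[MeasurableSpace.comap (fun ω : ι → Bool => ω i) inferInstance] (fun ω : ι → Bool => ω i) :=
        comap_measurable _
      simp only [resetTo, hi, if_true]
      exact h1.mono (le_iSup₂ (f := fun i (_ : i ∈ S) => MeasurableSpace.comap (fun ω : ι → Bool => ω i) inferInstance) i hi) le_rfl
    · simp only [resetTo, hi, if_false]
      exact @measurable_const _ _ _ (_) _
  exact hm hA

theorem indep_dep {ι : Type} (q : ι → ℝ) {A B : Set (ι → Bool)} {S T : Set ι} (hA : DepOn A S) (hB : DepOn B T)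
    (hST : Disjoint S T) (mA : MeasurableSet A) (mB : MeasurableSet B) :
    (Measure.infinitePi (fun i => bernP (q i))) (A ∩ B) =
     (Measure.infinitePi (fun i => bernP (q i))) A * (Measure.infinitePi (fun i => bernP (q i))) B := by
  have h1 := ProbabilityTheory.iIndepFun_infinitePi (P := fun i => bernP (q i)) (X := fun i (x : Bool) => x) (fun i => measurable_id)
  have h2 := ProbabilityTheory.indep_iSup_of_disjoint (fun i => (measurable_pi_apply i).comap_le) h1 hST
  exact (ProbabilityTheory.Indep_iff _ _ _).1 h2 A B (hA.meas_iSup mA) (hB.meas_iSup mB)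

theorem zero_one {ι : Type} (q : ι → ℝ) (T : Set (ι → Bool)) (mT : MeasurableSet T)
    (hT : ∀ ω ω' : ι → Bool, {i | ω i ≠ ω' i}.Finite → ω ∈ T → ω' ∈ T) :
    (Measure.infinitePi (fun i => bernP (q i))) T = 0 ∨ (Measure.infinitePi (fun i => bernP (q i))) T = 1 := by
  classical
  set P := Measure.infinitePi (fun i => bernP (q i)) with hP
  by_cases h0 : P T = 0
  · exact Or.inl h0
  right
  have hprob := ProbabilityTheory.cond_isProbabilityMeasure (μ := P) h0
  have : ProbabilityTheory.cond P T = P := by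
    refine ext_cyl' _ _ fun s d => ?_
    rw [ProbabilityTheory.cond_apply mT, Set.inter_comm, hP, indep_dep q (S := (s : Set ι)) (T := (s : Set ι)ᶜ)]
    · rw [← hP, mul_comm, mul_assoc, ENNReal.mul_inv_cancel h0 (measure_ne_top _ _), mul_one]
    · intro ξ ξ' e hx i hi
      rw [← e i hi]; exact hx i hi
    · intro ξ ξ' e hx
      refine hT _ _ (s.finite_toSet.subset fun i hi => ?_) hx
      by_contra hc
      exact hi (e i hc)
    · exact disjoint_compl_right
    · exact measurableSet_cyl s d
    · exact mT
  rw [← this, ProbabilityTheory.cond_apply mT, Set.inter_self, ENNReal.inv_mul_cancel h0 (measure_ne_top _ _)]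



/-! ### Arm events -/

def Op (ξ : V → Bool) : Set V := {v | ξ v = true}

def ArmE (s : Bool) (k n : ℤ) : Set (V → Bool) := {ξ | Arm s (Op ξ) k n}

/-- closed dual arm -/
def DArmE (s : Bool) (k n : ℤ) : Set (V → Bool) := {ξ | Arm (!s) (Op ξ)ᶜ k n}

theorem Op_congr {ξ ξ' : V → Bool} {S : Set V} (h : ∀ v ∈ S, ξ v = ξ' v) : Op ξ ∩ S = Op ξ' ∩ S := by
  ext v
  constructor
  · rintro ⟨h1, h2⟩; exact ⟨(h v h2).symm.trans h1, h2⟩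
  · rintro ⟨h1, h2⟩; exact ⟨(h v h2).trans h1, h2⟩

theorem Opc_congr {ξ ξ' : V → Bool} {S : Set V} (h : ∀ v ∈ S, ξ v = ξ' v) : (Op ξ)ᶜ ∩ S = (Op ξ')ᶜ ∩ S := by
  ext v
  constructor
  · rintro ⟨h1, h2⟩; exact ⟨fun h3 => h1 ((h v h2).trans h3), h2⟩
  · rintro ⟨h1, h2⟩; exact ⟨fun h3 => h1 ((h v h2).symm.trans h3), h2⟩

theorem Op_mono {ξ ξ' : V → Bool} (h : ξ ≤ ξ') : Op ξ ⊆ Op ξ' := fun v hv => by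
  have := h v
  simp only [Op, Set.mem_setOf_eq] at *
  rw [hv] at this
  exact top_le_iff.1 this

theorem ArmE_dep (s : Bool) (k n : ℤ) : DepOn (ArmE s k n) (Bx n) := by
  rintro ξ ξ' e ⟨u, x, hu, hx, h⟩
  rw [Op_congr e] at h
  exact ⟨u, x, hu, hx, h⟩

theorem DArmE_dep (s : Bool) (k n : ℤ) : DepOn (DArmE s k n) (Bx n) := by
  rintro ξ ξ' e ⟨u, x, hu, hx, h⟩
  rw [Opc_congr e] at h
  exact ⟨u, x, hu, hx, h⟩

theorem ArmE_up (s : Bool) (k n : ℤ) : IsUpperSet (ArmE s k n) := by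
  rintro ξ ξ' e ⟨u, x, hu, hx, h⟩
  exact ⟨u, x, hu, hx, h.mono (Set.inter_subset_inter_left _ (Op_mono e))⟩

theorem ArmE_meas (s : Bool) (k n : ℤ) : MeasurableSet (ArmE s k n) := (ArmE_dep s k n).meas (Bx_finite n)
theorem DArmE_meas (s : Bool) (k n : ℤ) : MeasurableSet (DArmE s k n) := (DArmE_dep s k n).meas (Bx_finite n)

theorem Arm_mono_k {s : Bool} {O : Set V} {k k' n : ℤ} (hk : k ≤ k') (h : Arm s O k n) : Arm s O k' n := by
  obtain ⟨u, x, hu, hx, h⟩ := h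
  exact ⟨u, x, Bx_mono hk hu, hx, h⟩

theorem exit_ring {s : Bool} {m : ℤ} {a b : V} (ha : a ∈ Bx m) (hb : b ∉ Bx m) (h : Ad s a b) : a ∈ Rg m := by
  have := Ad_le h
  rw [mem_Bx] at ha hb
  rw [mem_Rg]
  omega

theorem Arm_anti {s : Bool} {O : Set V} {k m n : ℤ} (hk : k ≤ m) (hm : m ≤ n) (h : Arm s O k n) : Arm s O k m := by
  obtain ⟨u, x, hu, hx, h⟩ := h
  have hum := Bx_mono hk hu
  by_cases hxm : x ∈ Bx m
  · have : m = n := by rw [mem_Bx] at hxm; rw [mem_Rg] at hx; omega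
    subst this
    exact ⟨u, x, hu, hx, h⟩
  · obtain ⟨a, b, h1, h2, h3, h4⟩ := h.first_exit hum hxm
    exact ⟨u, a, hu, exit_ring h1.right.2 h4 h2, h1.mono fun v hv => ⟨hv.1.1, hv.2⟩⟩

def PercE (s : Bool) : Set (V → Bool) := {ξ | ∃ k : ℕ, ∀ n : ℕ, k ≤ n → ξ ∈ ArmE s k n}

theorem PercE_meas (s : Bool) : MeasurableSet (PercE s) := by
  have : PercE s = ⋃ k : ℕ, ⋂ n : ℕ, ⋂ (_ : k ≤ n), ArmE s k n := by
    ext ξ; simp [PercE]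
  rw [this]
  exact MeasurableSet.iUnion fun k => MeasurableSet.iInter fun n => MeasurableSet.iInter fun _ => ArmE_meas s k n

def HypP (μ : Measure (V → Bool)) (s : Bool) : Prop :=
  ∀ ε : ℝ, 0 < ε → ∃ k : ℕ, ∀ n : ℕ, k ≤ n → μ.real (ArmE s k n)ᶜ ≤ ε

theorem dichotomy (μ : Measure (V → Bool)) [IsProbabilityMeasure μ] (s : Bool) (h : μ (PercE s) = 0 ∨ μ (PercE s) = 1) :
    (μ (PercE s) = 1 ∧ HypP μ s) ∨
      (μ (PercE s) = 0 ∧ ∀ k : ℕ, Filter.Tendsto (fun n : ℕ => μ.real (ArmE s k n)) Filter.atTop (nhds 0)) := by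
  set F : ℕ → Set (V → Bool) := fun k => ⋂ n : ℕ, ⋂ (_ : k ≤ n), ArmE s k n with hF
  have e : PercE s = ⋃ k : ℕ, F k := by
    ext ξ; simp [PercE, hF]
  have hmF : ∀ k, MeasurableSet (F k) := fun k => MeasurableSet.iInter fun n => MeasurableSet.iInter fun _ => ArmE_meas s k n
  rcases h with h | h
  · refine Or.inr ⟨h, ?_⟩
    intro k
    have h1 : μ (F k) = 0 := measure_mono_null (by rw [e]; exact Set.subset_iUnion F k) h
    have h2 : Filter.Tendsto (fun n : ℕ => μ (ArmE s k ((k + n : ℕ) : ℤ))) Filter.atTop (nhds (μ (⋂ n : ℕ, ArmE s k ((k + n : ℕ) : ℤ)))) := by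
      refine tendsto_measure_iInter_atTop (fun n => (ArmE_meas s k _).nullMeasurableSet) ?_ ⟨0, measure_ne_top _ _⟩
      intro m n hmn ξ hξ
      exact Arm_anti (by push_cast; omega) (by push_cast; omega) hξ
    have h3 : (⋂ n : ℕ, ArmE s k ((k + n : ℕ) : ℤ)) = F k := by
      ext ξ
      simp only [hF, Set.mem_iInter]
      constructor
      · intro h n hn
        have := h (n - k)
        rwa [show k + (n - k) = n by omega] at this
      · intro h n
        exact h _ (by omega)
    rw [h3, h1] at h2
    have h4 : Filter.Tendsto (fun n : ℕ => μ (ArmE s k (n : ℤ))) Filter.atTop (nhds 0) := by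
      refine (Filter.tendsto_add_atTop_iff_nat k).1 ?_
      refine h2.congr fun n => ?_
      rw [add_comm]
    have := (ENNReal.tendsto_toReal (by simp)).comp h4
    simpa using! this
  · refine Or.inl ⟨h, ?_⟩
    intro ε hε
    have h1 : Filter.Tendsto (fun k => μ (F k)) Filter.atTop (nhds (μ (⋃ k, F k))) := by
      refine tendsto_measure_iUnion_atTop ?_
      intro k k' hk ξ hξ
      simp only [hF, Set.mem_iInter] at hξ ⊢
      intro n hn
      exact Arm_mono_k (by exact_mod_cast hk) (hξ n (hk.trans hn))
    rw [← e, h] at h1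
    have h2 : Filter.Tendsto (fun k => μ.real (F k)) Filter.atTop (nhds 1) := by
      have := (ENNReal.tendsto_toReal (by simp)).comp h1
      simpa using! this
    obtain ⟨k, hk⟩ := (h2.eventually (lt_mem_nhds (show 1 - ε < 1 by linarith))).exists
    refine ⟨k, fun n hn => ?_⟩
    have h3 : μ.real (ArmE s k n)ᶜ ≤ μ.real (F k)ᶜ := by
      refine measureReal_mono (Set.compl_subset_compl.2 ?_)
      intro ξ hξ
      simp only [hF, Set.mem_iInter] at hξ
      exact hξ n hn
    rw [probReal_compl_eq_one_sub (hmF k)] at h3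
    linarith

/-- Percolation is insensitive to finite changes. -/
theorem perc_finite {s : Bool} {ξ ξ' : V → Bool} (hf : {v | ξ v ≠ ξ' v}.Finite) (h : ξ ∈ PercE s) : ξ' ∈ PercE s := by
  obtain ⟨m, hm⟩ : ∃ m : ℕ, {v | ξ v ≠ ξ' v} ⊆ Bx m := by
    refine Set.Finite.induction_on _ hf ⟨0, by simp⟩ ?_
    rintro a S - - ⟨m, hm⟩
    obtain ⟨N, hN⟩ := exists_box a
    refine ⟨max m N, Set.insert_subset (Bx_mono (by simp) hN) (hm.trans (Bx_mono (by simp)))⟩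
  obtain ⟨k, hk⟩ := h
  refine ⟨max k m + 1, fun n hn => ?_⟩
  obtain ⟨u, x, hu, hx, h⟩ := hk n (by omega)
  have hu' : u ∈ Bx ((max k m : ℕ) : ℤ) := Bx_mono (by simp) hu
  have hx' : x ∉ Bx ((max k m : ℕ) : ℤ) := by
    rw [mem_Bx]; rw [mem_Rg] at hx
    push_cast at *; omega
  obtain ⟨a, b, h1, h2, h3, h4⟩ := h.last_exit hu' hx'
  refine ⟨b, x, ?_, hx, h4.mono ?_⟩
  · have := Ad_le h3
    rw [mem_Bx] at h1 ⊢; push_cast at *; omega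
  · rintro v ⟨⟨hv1, hv2⟩, hv3⟩
    refine ⟨?_, hv2⟩
    by_contra hc
    refine hv3 (Bx_mono (by simp) (hm ?_))
    simp only [Op, Set.mem_setOf_eq] at hv1 hc ⊢
    intro h; exact hc (h ▸ hv1)

def infC (s : Bool) (ξ : V → Bool) (u : V) : Prop := {w | Cn (Ad s) (Op ξ) u w}.Infinite

theorem perc_of_infC {s : Bool} {ξ : V → Bool} {u : V} (h : infC s ξ u) : ξ ∈ PercE s := by
  obtain ⟨k, hk⟩ := exists_box u
  refine ⟨k, fun n hn => ?_⟩
  have hun : u ∈ Bx n := Bx_mono (by exact_mod_cast hn) hk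
  obtain ⟨w, hw, hwn⟩ := h.exists_notMem_finite (Bx_finite n)
  obtain ⟨a, b, h1, h2, h3, h4⟩ := Cn.first_exit hw hun hwn
  exact ⟨u, a, hk, exit_ring h1.right.2 h4 h2, h1⟩

theorem infC_of_perc {s : Bool} {ξ : V → Bool} (h : ξ ∈ PercE s) : ∃ u, infC s ξ u := by
  obtain ⟨k, hk⟩ := h
  by_contra hc
  push Not at hc
  simp only [infC, Set.not_infinite] at hc
  have : (⋃ u ∈ Bx k, {w | Cn (Ad s) (Op ξ) u w}).Finite := (Bx_finite k).biUnion fun u _ => hc u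
  obtain ⟨m, hm⟩ : ∃ m : ℕ, (⋃ u ∈ Bx k, {w | Cn (Ad s) (Op ξ) u w}) ⊆ Bx m := by
    refine Set.Finite.induction_on _ this ⟨0, by simp⟩ ?_
    rintro a S - - ⟨m, hm⟩
    obtain ⟨N, hN⟩ := exists_box a
    refine ⟨max m N, Set.insert_subset (Bx_mono (by simp) hN) (hm.trans (Bx_mono (by simp)))⟩
  obtain ⟨u, x, hu, hx, h⟩ := hk (max k m + 1) (by omega)
  have h1 := hm (Set.mem_biUnion hu (h.mono Set.inter_subset_left))
  rw [mem_Bx] at h1; rw [mem_Rg] at hx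
  push_cast at *; omega

theorem infC_meas (s : Bool) (u : V) : MeasurableSet {ξ : V → Bool | infC s ξ u} := by
  have e : {ξ : V → Bool | infC s ξ u} = ⋂ n : ℕ, ⋃ w ∈ (Bx n)ᶜ, {ξ | Cn (Ad s) (Op ξ) u w} := by
    ext ξ
    simp only [Set.mem_setOf_eq, Set.mem_iInter, Set.mem_iUnion]
    constructor
    · intro h n
      obtain ⟨w, hw, hwn⟩ := h.exists_notMem_finite (Bx_finite n)
      exact ⟨w, hwn, hw⟩
    · intro h hfin
      obtain ⟨m, hm⟩ : ∃ m : ℕ, {w | Cn (Ad s) (Op ξ) u w} ⊆ Bx m := by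
        refine Set.Finite.induction_on _ hfin ⟨0, by simp⟩ ?_
        rintro a S - - ⟨m, hm⟩
        obtain ⟨N, hN⟩ := exists_box a
        refine ⟨max m N, Set.insert_subset (Bx_mono (by simp) hN) (hm.trans (Bx_mono (by simp)))⟩
      obtain ⟨w, hw1, hw2⟩ := h m
      exact hw1 (hm hw2)
  rw [e]
  refine MeasurableSet.iInter fun n => MeasurableSet.iUnion fun w => MeasurableSet.iUnion fun _ => ?_
  have : {ξ : V → Bool | Cn (Ad s) (Op ξ) u w} = {ξ | ξ u = true} ∩ {ξ | Relation.ReflTransGen (fun a b => Ad s a b ∧ b ∈ Op ξ) u w} := rfl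
  rw [this]
  refine (measurableSet_coord u true).inter (measurableSet_rtg ?_ u w)
  intro a b
  by_cases h : Ad s a b
  · simpa [h, Op] using measurableSet_coord b true
  · simp [h]



/-! ### Topology: trimming and hooks -/

theorem trim_left {s : Bool} {S : Set V} {u v : V} (f : V → ℤ) (hf : ∀ a b, Ad s a b → f b ≤ f a + 1) {l : ℤ}
    (h : Cn (Ad s) S u v) (hu : f u ≤ l) (hv : l ≤ f v) :
    ∃ u', f u' = l ∧ Cn (Ad s) (S ∩ {w | l ≤ f w}) u' v := by
  rcases hv.eq_or_lt with hv | hv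
  · exact ⟨v, hv.symm, Cn.refl ⟨h.right, hv.le⟩⟩
  · obtain ⟨a, b, h1, h2, h3, h4⟩ := h.last_exit (P := {w | f w ≤ l}) hu (by simpa using hv)
    have h5 := h4.left.2
    have h6 := hf a b h3
    simp only [Set.mem_setOf_eq, not_le] at h1 h5
    have ha : a ∈ S ∩ {w | l ≤ f w} := ⟨h2.right, by simp only [Set.mem_setOf_eq]; omega⟩
    have h7 : Cn (Ad s) (S ∩ {w | l ≤ f w}) b v := h4.mono fun w hw => ⟨hw.1, by
      have := hw.2; simp only [Set.mem_setOf_eq, not_le] at this ⊢; omega⟩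
    exact ⟨a, by omega, (Cn.one ha h3 h7.left).trans h7⟩

theorem trim {s : Bool} {S : Set V} {u v : V} (f : V → ℤ) (hf : ∀ a b, Ad s a b → f b ≤ f a + 1) {l r : ℤ} (hlr : l ≤ r)
    (h : Cn (Ad s) S u v) (hu : f u ≤ l) (hv : r ≤ f v) :
    ∃ u' v', f u' = l ∧ f v' = r ∧ Cn (Ad s) (S ∩ {w | l ≤ f w ∧ f w ≤ r}) u' v' := by
  obtain ⟨u', hu', h1⟩ := trim_left f hf h hu (hlr.trans hv)
  obtain ⟨v', hv', h2⟩ := trim_left (fun w => - f w) (fun a b hab => by have := hf b a (Ad_symm hab); omega)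
    (l := -r) h1.symm (by omega) (by omega)
  refine ⟨u', v', hu', by omega, h2.symm.mono ?_⟩
  rintro w ⟨⟨h3, h4⟩, h5⟩
  simp only [Set.mem_setOf_eq] at h4 h5
  exact ⟨h3, h4, by omega⟩

theorem lip_fst {s : Bool} (a b : V) (h : Ad s a b) : b.1 ≤ a.1 + 1 := by have := Ad_le h; omega
theorem lip_snd {s : Bool} (a b : V) (h : Ad s a b) : b.2 ≤ a.2 + 1 := by have := Ad_le h; omega

theorem fatten {s : Bool} {S : Set V} {a b : V} {l r : ℤ} (h : Cn (Ad s) S a b) (hS : ∀ v ∈ S, l ≤ v.1 ∧ v.1 ≤ r) :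
    Cn (Ad (!s)) {v | (l ≤ v.1 ∧ v.1 ≤ r) ∧ ∃ t, Cn (Ad s) S a t ∧ (v = t ∨ SqAdj t v)} a b := by
  set S' : Set V := {v | (l ≤ v.1 ∧ v.1 ≤ r) ∧ ∃ t, Cn (Ad s) S a t ∧ (v = t ∨ SqAdj t v)} with hS'
  refine Cn.induct (P := fun v => Cn (Ad (!s)) S' a v) h
        (Cn.refl ⟨hS _ h.1, a, Cn.refl h.1, Or.inl rfl⟩) ?_
  intro x y hx hxy hy ih
  have hyS' : y ∈ S' := ⟨hS _ hy, y, hx.step hxy hy, Or.inl rfl⟩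
  have bx := hS _ hx.right
  have by' := hS _ hy
  by_cases hsq : SqAdj x y
  · exact ih.step (Ad_of_sq hsq) hyS'
  · have hst := (starAdj_iff _ _).1 (Ad_star hxy)
    rw [sqAdj_iff] at hsq
    have e1 : SqAdj x (x.1, y.2) := by rw [sqAdj_iff]; simp; omega
    have e2 : SqAdj (x.1, y.2) y := by rw [sqAdj_iff]; simp; omega
    exact (ih.step (Ad_of_sq e1) ⟨bx, x, hx, Or.inr e1⟩).step (Ad_of_sq e2) hyS'

theorem hook {s : Bool} {S1 S2 : Set V} {u : V} {x1 i a b : ℤ} {Y0 Y1 : ℤ} (h1 : Cn (Ad s) S1 u (x1, i))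
    (h2 : Cn (Ad s) S2 (x1, a) (x1, b)) (hai : a ≤ i) (hib : i ≤ b)
    (hS1 : ∀ v ∈ S1, v.1 ≤ x1 ∧ Y0 ≤ v.2 ∧ v.2 ≤ Y1) (hS2 : ∀ v ∈ S2, u.1 ≤ v.1 ∧ v.1 ≤ x1)
    (ha : Y0 ≤ a) (hb : b ≤ Y1) :
    Cn (Ad s) (S1 ∪ S2) u (x1, a) := by
  by_contra hcon
  have fin : ∀ p q, Cn (Ad s) S1 u p → Cn (Ad s) S2 (x1, a) q → (p = q ∨ Ad s p q) → False := by
    intro p q hp hq hpq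
    have e1 : Cn (Ad s) (S1 ∪ S2) u p := hp.mono Set.subset_union_left
    have e2 : Cn (Ad s) (S1 ∪ S2) (x1, a) q := hq.mono Set.subset_union_right
    rcases hpq with rfl | hpq
    · exact hcon (e1.trans e2.symm)
    · exact hcon ((e1.step hpq e2.right).trans e2.symm)
  have hia : i ≠ a := by
    rintro rfl; exact fin _ _ h1 (Cn.refl h2.left) (Or.inl rfl)
  have hib' : i ≠ b := by
    rintro rfl; exact fin _ _ h1 h2 (Or.inl rfl)
  set N : Set V := {v | (u.1 ≤ v.1 ∧ v.1 ≤ x1) ∧ ∃ t, Cn (Ad s) S2 (x1, a) t ∧ (v = t ∨ SqAdj t v)} with hN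
  have h3 : Cn (Ad (!s)) N (x1, a) (x1, b) := fatten h2 hS2
  set T : Set V := N ∪ ({v | v.1 = x1 + 1 ∧ Y0 ≤ v.2 ∧ v.2 ≤ a} ∪ {v | v.1 = x1 + 1 ∧ b ≤ v.2 ∧ v.2 ≤ Y1}) with hT
  have h4 : Cn (Ad (!s)) T (x1 + 1, Y0) (x1 + 1, Y1) := by
    have c1 : Cn (Ad (!s)) T (x1 + 1, Y0) (x1 + 1, a) := Cn.vline _ _ _ ha fun t h h' => Or.inr (Or.inl ⟨rfl, h, h'⟩)
    have c2 : Cn (Ad (!s)) T (x1 + 1, b) (x1 + 1, Y1) := Cn.vline _ _ _ hb fun t h h' => Or.inr (Or.inr ⟨rfl, h, h'⟩)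
    have c3 : Cn (Ad (!s)) T (x1, a) (x1, b) := h3.mono Set.subset_union_left
    have e1 : SqAdj (x1 + 1, a) (x1, a) := by rw [sqAdj_iff]; simp
    have e2 : SqAdj (x1, b) (x1 + 1, b) := by rw [sqAdj_iff]; simp
    exact ((c1.step (Ad_of_sq e1) c3.left).trans c3).step (Ad_of_sq e2) c2.left |>.trans c2
  set S : Set V := {w | Cn (Ad s) S1 u w} ∪ {(x1 + 1, i)} with hS
  have h5 : Cn (Ad s) S u (x1 + 1, i) := by
    have c1 : Cn (Ad s) S u (x1, i) := h1.restrict.mono Set.subset_union_left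
    have e1 : SqAdj (x1, i) (x1 + 1, i) := by rw [sqAdj_iff]; simp
    exact c1.step (Ad_of_sq e1) (Or.inr rfl)
  obtain ⟨w, hw1, hw2⟩ := cross_dual h5 h4 (by
      rintro v (hv | rfl)
      · have := hS1 _ (Cn.right hv); simp only; omega
      · simp only; omega) (by
      rintro v (hv | hv | hv)
      · have := hv.1; simp only; omega
      · have e1 := (hS1 _ h1.left).1; have := hv.1; simp only; omega
      · have e1 := (hS1 _ h1.left).1; have := hv.1; simp only; omega)
  rcases hw1 with hw1 | rfl
  · have b1 := hS1 _ (Cn.right hw1)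
    rcases hw2 with ⟨_, t, ht, hw⟩ | hw2 | hw2
    · refine fin w t hw1 ht ?_
      rcases hw with rfl | hw
      · exact Or.inl rfl
      · exact Or.inr (Ad_symm (Ad_of_sq hw))
    · have := hw2.1; omega
    · have := hw2.1; omega
  · rcases hw2 with hw2 | hw2 | hw2
    · have := hw2.1.2; simp only at this; omega
    · have := hw2.2; simp only at this; omega
    · have := hw2.2; simp only at this; omega

def rfl1 (v : V) : V := (-v.1, v.2)
theorem rfl1_Ad {s : Bool} {a b : V} (h : Ad s a b) : Ad s (rfl1 a) (rfl1 b) := by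
  cases s
  · change SqAdj _ _ at h ⊢
    rw [sqAdj_iff] at *; simp only [rfl1]; omega
  · change StarAdj _ _ at h ⊢
    rw [starAdj_iff] at *; simp only [rfl1]; omega

theorem rfl1_Cn {s : Bool} {S : Set V} {a b : V} (h : Cn (Ad s) S a b) : Cn (Ad s) (rfl1 ⁻¹' S) (rfl1 a) (rfl1 b) :=
  h.map rfl1 (fun a b => rfl1_Ad) (fun a ha => by simpa [rfl1] using ha)

/-- mirror image of `hook` -/
theorem hook' {s : Bool} {S1 S2 : Set V} {u : V} {x1 i a b : ℤ} {Y0 Y1 : ℤ} (h1 : Cn (Ad s) S1 u (x1, i))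
    (h2 : Cn (Ad s) S2 (x1, a) (x1, b)) (hai : a ≤ i) (hib : i ≤ b)
    (hS1 : ∀ v ∈ S1, x1 ≤ v.1 ∧ Y0 ≤ v.2 ∧ v.2 ≤ Y1) (hS2 : ∀ v ∈ S2, v.1 ≤ u.1 ∧ x1 ≤ v.1)
    (ha : Y0 ≤ a) (hb : b ≤ Y1) :
    Cn (Ad s) (S1 ∪ S2) u (x1, a) := by
  have h := hook (x1 := -x1) (i := i) (a := a) (b := b) (rfl1_Cn h1) (rfl1_Cn h2) hai hib (Y0 := Y0) (Y1 := Y1) (by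
    intro v hv; have := hS1 _ hv; simp only [rfl1] at this; omega) (by
    intro v hv; have := hS2 _ hv; simp only [rfl1] at this ⊢; omega) ha hb
  have h' := rfl1_Cn h
  have e : ∀ S : Set V, rfl1 ⁻¹' (rfl1 ⁻¹' S) = S := fun S => by ext v; simp [rfl1]
  rw [Set.preimage_union, e, e] at h'
  simpa [rfl1] using h'


def Sb (z : V) (n : ℤ) : Set V := {v | z.1 - n ≤ v.1 ∧ v.1 ≤ z.1 + n ∧ z.2 - n ≤ v.2 ∧ v.2 ≤ z.2 + n}

def Tch (s : Bool) (R : Set V) (c : V) (x lo hi : ℤ) : Prop := ∃ y, lo ≤ y ∧ y ≤ hi ∧ Cn (Ad s) R c (x, y)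

theorem Tch.mono {s : Bool} {R R' : Set V} {c : V} {x lo hi : ℤ} (h : Tch s R c x lo hi) (hR : R ⊆ R') : Tch s R' c x lo hi := by
  obtain ⟨y, h1, h2, h3⟩ := h
  exact ⟨y, h1, h2, h3.mono hR⟩

/-- `c` is the centre of a full cluster in the box of radius `n` centred at `z`. -/
def FullC (s : Bool) (O : Set V) (z : V) (n a : ℤ) (c : V) : Prop :=
  (Tch s (O ∩ Sb z n) c (z.1 + n) (z.2 + 4 * a) (z.2 + n) ∧ Tch s (O ∩ Sb z n) c (z.1 + n) (z.2 - n) (z.2 - 4 * a) ∧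
    Tch s (O ∩ Sb z n) c (z.1 + n) z.2 (z.2 + (4 * a + 4))) ∧
  (Tch s (O ∩ Sb z n) c (z.1 - n) (z.2 + 4 * a) (z.2 + n) ∧ Tch s (O ∩ Sb z n) c (z.1 - n) (z.2 - n) (z.2 - 4 * a) ∧
    Tch s (O ∩ Sb z n) c (z.1 - n) z.2 (z.2 + (4 * a + 4)))

theorem join_right {s : Bool} {O : Set V} {z z' : V} {n m a a' : ℤ} {c c' : V} (ha : 0 ≤ a) (hmn : m ≤ n)
    (h : FullC s O z n a c) (h' : FullC s O z' m a' c') (hz1 : z'.1 + m = z.1 + n) (hz2 : z'.2 = z.2 + 2 * (a + 1))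
    (haa : a + 1 ≤ 2 * a') (ha' : 4 * a' ≤ m) :
    Cn (Ad s) ((O ∩ Sb z n) ∪ (O ∩ Sb z' m)) c c' := by
  obtain ⟨⟨-, -, y1, l1, l2, h1⟩, -, -, y2, l3, l4, h2⟩ := h
  obtain ⟨⟨⟨y3, l5, l6, h3⟩, ⟨y4, l7, l8, h4⟩, -⟩, -⟩ := h'
  rw [hz1] at h3 h4
  have hk := hook (h2.symm.trans h1) (h4.symm.trans h3) (Y0 := min (z.2 - n) (z'.2 - m)) (Y1 := max (z.2 + n) (z'.2 + m))
    (by omega) (by omega) (by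
      rintro v ⟨-, hv⟩
      have hv : z.1 - n ≤ v.1 ∧ v.1 ≤ z.1 + n ∧ z.2 - n ≤ v.2 ∧ v.2 ≤ z.2 + n := hv
      omega) (by
      rintro v ⟨-, hv⟩
      have hv : z'.1 - m ≤ v.1 ∧ v.1 ≤ z'.1 + m ∧ z'.2 - m ≤ v.2 ∧ v.2 ≤ z'.2 + m := hv
      simp only
      omega) (by omega) (by omega)
  exact ((h2.mono Set.subset_union_left).trans hk).trans (h4.symm.mono Set.subset_union_right)

theorem join_left {s : Bool} {O : Set V} {z z' : V} {n m a a' : ℤ} {c c' : V} (ha : 0 ≤ a) (hmn : m ≤ n)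
    (h : FullC s O z n a c) (h' : FullC s O z' m a' c') (hz1 : z'.1 - m = z.1 - n) (hz2 : z'.2 = z.2 + 2 * (a + 1))
    (haa : a + 1 ≤ 2 * a') (ha' : 4 * a' ≤ m) :
    Cn (Ad s) ((O ∩ Sb z n) ∪ (O ∩ Sb z' m)) c c' := by
  obtain ⟨⟨-, -, y1, l1, l2, h1⟩, -, -, y2, l3, l4, h2⟩ := h
  obtain ⟨-, ⟨y3, l5, l6, h3⟩, ⟨y4, l7, l8, h4⟩, -⟩ := h'
  rw [hz1] at h3 h4
  have hk := hook' (h1.symm.trans h2) (h4.symm.trans h3) (Y0 := min (z.2 - n) (z'.2 - m)) (Y1 := max (z.2 + n) (z'.2 + m))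
    (by omega) (by omega) (by
      rintro v ⟨-, hv⟩
      have hv : z.1 - n ≤ v.1 ∧ v.1 ≤ z.1 + n ∧ z.2 - n ≤ v.2 ∧ v.2 ≤ z.2 + n := hv
      omega) (by
      rintro v ⟨-, hv⟩
      have hv : z'.1 - m ≤ v.1 ∧ v.1 ≤ z'.1 + m ∧ z'.2 - m ≤ v.2 ∧ v.2 ≤ z'.2 + m := hv
      simp only
      omega) (by omega) (by omega)
  exact ((h1.mono Set.subset_union_left).trans hk).trans (h4.symm.mono Set.subset_union_right)

def Rc (x0 x1 y0 y1 : ℤ) : Set V := {v | (x0 ≤ v.1 ∧ v.1 ≤ x1) ∧ y0 ≤ v.2 ∧ v.2 ≤ y1}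

/-- the chain: `J + 1` boxes and `J` hooks give a long horizontal crossing -/
theorem chain {s : Bool} {O : Set V} {n m a a' : ℤ} (J : ℕ) (ha : 0 ≤ a) (hmn : m ≤ n) (ha' : 4 * a' ≤ m) (han : 2 * (a + 1) ≤ n)
    (haa : a + 1 ≤ 2 * a')
    (hz : ∀ j : ℕ, j ≤ J → ∃ c, FullC s O (2 * j * (n - m), - (2 * (a + 1))) n a c)
    (hy : ∀ j : ℕ, j < J → ∃ c, FullC s O ((2 * j + 1) * (n - m), 0) m a' c) :
    ∃ y y', Cn (Ad s) (O ∩ {v | -2 * n ≤ v.2 ∧ v.2 ≤ n}) (-n, y) (2 * J * (n - m) + n, y') := by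
  have key : ∀ i : ℕ, i ≤ J → ∃ c y, FullC s O (2 * i * (n - m), - (2 * (a + 1))) n a c ∧
      Cn (Ad s) (O ∩ {v | -2 * n ≤ v.2 ∧ v.2 ≤ n}) (-n, y) c := by
    intro i
    induction i with
    | zero =>
      intro hi
      obtain ⟨c, hc⟩ := hz 0 hi
      have hc' := hc
      obtain ⟨-, -, -, y, -, -, h⟩ := hc'
      refine ⟨c, y, hc, ?_⟩
      have := h.symm
      simp only [CharP.cast_eq_zero, mul_zero, zero_mul, zero_sub] at this
      refine this.mono ?_
      rintro v ⟨h1, h2, h3, h4, h5⟩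
      refine ⟨h1, ?_⟩
      simp only [Set.mem_setOf_eq] at *
      omega
    | succ i ih =>
      intro hi
      obtain ⟨c, y, hc, hcy⟩ := ih (by omega)
      obtain ⟨d, hd⟩ := hy i (by omega)
      obtain ⟨c', hc'⟩ := hz (i + 1) hi
      refine ⟨c', y, hc', ?_⟩
      have e1 := join_right ha hmn hc hd (by simp only; ring) (by simp only; ring) haa ha'
      have e2 := join_left ha hmn hc' hd (by simp only; push_cast; ring) (by simp only; ring) haa ha'
      refine (hcy.trans (e1.mono ?_)).trans (e2.symm.mono ?_)
      all_goals
        rintro v (⟨h1, h2, h3, h4, h5⟩ | ⟨h1, h2, h3, h4, h5⟩)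
        · refine ⟨h1, ?_⟩
          simp only [Set.mem_setOf_eq] at *
          omega
        · refine ⟨h1, ?_⟩
          simp only [Set.mem_setOf_eq] at *
          omega
  obtain ⟨c, y, hc, hcy⟩ := key J le_rfl
  obtain ⟨⟨-, -, y', -, -, h⟩, -⟩ := hc
  refine ⟨y, y', hcy.trans (h.mono ?_)⟩
  rintro v ⟨h1, h2, h3, h4, h5⟩
  refine ⟨h1, ?_⟩
  simp only [Set.mem_setOf_eq] at *
  omega



/-! ### Nice measures -/

/-- local increasing events -/
def LU (A : Set (V → Bool)) : Prop := (∃ S : Finset V, DepOn A S) ∧ IsUpperSet A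

theorem LU.meas {A : Set (V → Bool)} (h : LU A) : MeasurableSet A := by
  obtain ⟨⟨S, hS⟩, -⟩ := h
  exact hS.meas S.finite_toSet

theorem LU.inter {A B : Set (V → Bool)} (hA : LU A) (hB : LU B) : LU (A ∩ B) := by
  classical
  obtain ⟨⟨S, hS⟩, uA⟩ := hA
  obtain ⟨⟨T, hT⟩, uB⟩ := hB
  exact ⟨⟨S ∪ T, (hS.mono (by simp)).inter (hT.mono (by simp))⟩, uA.inter uB⟩

theorem LU.union {A B : Set (V → Bool)} (hA : LU A) (hB : LU B) : LU (A ∪ B) := by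
  classical
  obtain ⟨⟨S, hS⟩, uA⟩ := hA
  obtain ⟨⟨T, hT⟩, uB⟩ := hB
  exact ⟨⟨S ∪ T, (hS.mono (by simp)).union (hT.mono (by simp))⟩, uA.union uB⟩

theorem LU.comap {A : Set (V → Bool)} (hA : LU A) (τ : V → V) : LU {ξ | (fun v => ξ (τ v)) ∈ A} := by
  classical
  obtain ⟨⟨S, hS⟩, uA⟩ := hA
  refine ⟨⟨S.image τ, ?_⟩, ?_⟩
  · intro ξ ξ' e h
    exact hS _ _ (fun v hv => e _ (by simpa using ⟨v.1, v.2, hv, rfl⟩)) h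
  · intro ξ ξ' e h
    exact uA (fun v => e _) h

theorem LU.univ : LU Set.univ := ⟨⟨∅, fun _ _ _ _ => trivial⟩, isUpperSet_univ⟩
theorem LU.empty : LU ∅ := ⟨⟨∅, fun _ _ _ h => h⟩, isUpperSet_empty⟩

theorem LU.iInter {κ : Type} (I : Finset κ) (A : κ → Set (V → Bool)) (h : ∀ i ∈ I, LU (A i)) : LU (⋂ i ∈ I, A i) := by
  classical
  induction I using Finset.induction_on with
  | empty => simpa using LU.univ
  | insert a I ha ih =>
    rw [Finset.set_biInter_insert]
    exact (h a (by simp)).inter (ih fun i hi => h i (by simp [hi]))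

theorem LU.iUnion {κ : Type} (I : Finset κ) (A : κ → Set (V → Bool)) (h : ∀ i ∈ I, LU (A i)) : LU (⋃ i ∈ I, A i) := by
  classical
  induction I using Finset.induction_on with
  | empty => simpa using LU.empty
  | insert a I ha ih =>
    rw [Finset.set_biUnion_insert]
    exact (h a (by simp)).union (ih fun i hi => h i (by simp [hi]))

def InvB (μ : Measure (V → Bool)) (τ : V → V) : Prop := μ.map (fun ξ v => ξ (τ v)) = μ

theorem InvB.comp {μ : Measure (V → Bool)} {τ τ' : V → V} (h : InvB μ τ) (h' : InvB μ τ') : InvB μ (fun v => τ (τ' v)) := by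
  unfold InvB at *
  have m1 : Measurable (fun (ξ : V → Bool) v => ξ (τ v)) := by fun_prop
  have m2 : Measurable (fun (ξ : V → Bool) v => ξ (τ' v)) := by fun_prop
  conv_rhs => rw [← h', ← h]
  rw [Measure.map_map m2 m1]; rfl

theorem InvB.real {μ : Measure (V → Bool)} {τ : V → V} (h : InvB μ τ) {A : Set (V → Bool)} (hA : MeasurableSet A) :
    μ.real {ξ | (fun v => ξ (τ v)) ∈ A} = μ.real A := by
  have m1 : Measurable (fun (ξ : V → Bool) v => ξ (τ v)) := by fun_prop
  have := congrArg (fun ν : Measure (V → Bool) => ν.real A) h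
  simp only [measureReal_def, Measure.map_apply m1 hA] at this
  exact this

structure Nice (μ : Measure (V → Bool)) : Prop where
  prob : IsProbabilityMeasure μ
  fkg : ∀ (S : Finset V) (A B : Set (V → Bool)), DepOn A S → DepOn B S → IsUpperSet A → IsUpperSet B →
    μ.real A * μ.real B ≤ μ.real (A ∩ B)
  tr : ∀ a : V, InvB μ (fun v => v + (a + a))
  rf : InvB μ rfl1
  sw : InvB μ Prod.swap

theorem Nice.fkg2 {μ : Measure (V → Bool)} (h : Nice μ) {A B : Set (V → Bool)} (hA : LU A) (hB : LU B) :
    μ.real A * μ.real B ≤ μ.real (A ∩ B) := by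
  classical
  obtain ⟨⟨S, hS⟩, uA⟩ := hA
  obtain ⟨⟨T, hT⟩, uB⟩ := hB
  exact h.fkg (S ∪ T) A B (hS.mono (by simp)) (hT.mono (by simp)) uA uB

theorem Nice.fkgc {μ : Measure (V → Bool)} (h : Nice μ) {A B : Set (V → Bool)} (hA : LU A) (hB : LU B) :
    μ.real Aᶜ * μ.real Bᶜ ≤ μ.real (Aᶜ ∩ Bᶜ) := by
  have := h.prob
  have h1 := h.fkg2 hA hB
  rw [← Set.compl_union, probReal_compl_eq_one_sub hA.meas, probReal_compl_eq_one_sub hB.meas,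
    probReal_compl_eq_one_sub (hA.meas.union hB.meas)]
  have h2 := measureReal_union_add_inter (μ := μ) (s := A) hB.meas
  nlinarith

theorem Nice.fkg_prod {μ : Measure (V → Bool)} (h : Nice μ) {κ : Type} (I : Finset κ) (A : κ → Set (V → Bool))
    (hA : ∀ i ∈ I, LU (A i)) : ∏ i ∈ I, μ.real (A i) ≤ μ.real (⋂ i ∈ I, A i) := by
  classical
  have := h.prob
  induction I using Finset.induction_on with
  | empty => simp
  | insert a I ha ih =>
    rw [Finset.prod_insert ha, Finset.set_biInter_insert]
    have h1 := ih fun i hi => hA i (by simp [hi])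
    refine le_trans ?_ (h.fkg2 (hA a (by simp)) (LU.iInter I A fun i hi => hA i (by simp [hi])))
    exact mul_le_mul_of_nonneg_left h1 measureReal_nonneg

theorem Nice.fkgc_prod {μ : Measure (V → Bool)} (h : Nice μ) {κ : Type} (I : Finset κ) (A : κ → Set (V → Bool))
    (hA : ∀ i ∈ I, LU (A i)) : ∏ i ∈ I, μ.real (A i)ᶜ ≤ μ.real (⋃ i ∈ I, A i)ᶜ := by
  classical
  have := h.prob
  induction I using Finset.induction_on with
  | empty => simp
  | insert a I ha ih =>
    rw [Finset.prod_insert ha, Finset.set_biUnion_insert, Set.compl_union]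
    have h1 := ih fun i hi => hA i (by simp [hi])
    refine le_trans ?_ (h.fkgc (hA a (by simp)) (LU.iUnion I A fun i hi => hA i (by simp [hi])))
    exact mul_le_mul_of_nonneg_left h1 measureReal_nonneg

/-! ### The eight symmetries -/

def dS (i : Bool × Bool × Bool) (v : V) : V :=
  (if i.1 then -(if i.2.2 then v.2 else v.1) else (if i.2.2 then v.2 else v.1),
   if i.2.1 then -(if i.2.2 then v.1 else v.2) else (if i.2.2 then v.1 else v.2))

def eS (i : Bool × Bool × Bool) (v : V) : V :=
  if i.2.2 then (if i.2.1 then -v.2 else v.2, if i.1 then -v.1 else v.1)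
  else (if i.1 then -v.1 else v.1, if i.2.1 then -v.2 else v.2)

theorem dS_eS (i : Bool × Bool × Bool) (v : V) : dS i (eS i v) = v := by
  obtain ⟨_ | _, _ | _, _ | _⟩ := i <;> simp [dS, eS]
theorem eS_dS (i : Bool × Bool × Bool) (v : V) : eS i (dS i v) = v := by
  obtain ⟨_ | _, _ | _, _ | _⟩ := i <;> simp [dS, eS]

theorem dS_Bx (i : Bool × Bool × Bool) (n : ℤ) (v : V) : dS i v ∈ Bx n ↔ v ∈ Bx n := by
  obtain ⟨_ | _, _ | _, _ | _⟩ := i <;> simp only [dS, mem_Bx, if_true, if_false, Bool.false_eq_true] <;> omega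
theorem eS_Bx (i : Bool × Bool × Bool) (n : ℤ) (v : V) : eS i v ∈ Bx n ↔ v ∈ Bx n := by
  rw [← dS_Bx i, dS_eS]

theorem eS_Ad {s : Bool} (i : Bool × Bool × Bool) {a b : V} (h : Ad s a b) : Ad s (eS i a) (eS i b) := by
  cases s
  · change SqAdj _ _ at h ⊢
    rw [sqAdj_iff] at *
    obtain ⟨_ | _, _ | _, _ | _⟩ := i <;> simp only [eS, if_true, if_false, Bool.false_eq_true] <;> omega
  · change StarAdj _ _ at h ⊢
    rw [starAdj_iff] at *
    obtain ⟨_ | _, _ | _, _ | _⟩ := i <;> simp only [eS, if_true, if_false, Bool.false_eq_true] <;> omega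

theorem dS_Ad {s : Bool} (i : Bool × Bool × Bool) {a b : V} (h : Ad s a b) : Ad s (dS i a) (dS i b) := by
  cases s
  · change SqAdj _ _ at h ⊢
    rw [sqAdj_iff] at *
    obtain ⟨_ | _, _ | _, _ | _⟩ := i <;> simp only [dS, if_true, if_false, Bool.false_eq_true] <;> omega
  · change StarAdj _ _ at h ⊢
    rw [starAdj_iff] at *
    obtain ⟨_ | _, _ | _, _ | _⟩ := i <;> simp only [dS, if_true, if_false, Bool.false_eq_true] <;> omega

theorem Nice.inv {μ : Measure (V → Bool)} (h : Nice μ) (i : Bool × Bool × Bool) : InvB μ (dS i) := by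
  have h0 : InvB μ (fun v => v) := by
    have := h.tr 0
    simpa using this
  have hx : InvB μ (fun v : V => rfl1 v) := h.rf
  have hs : InvB μ (fun v : V => v.swap) := h.sw
  have hy : InvB μ (fun v : V => (v.1, -v.2)) := (hs.comp (hx.comp hs))
  obtain ⟨_ | _, _ | _, _ | _⟩ := i
  · exact h0
  · exact hs
  · exact hy
  · exact hy.comp hs
  · exact hx
  · exact hx.comp hs
  · exact hx.comp hy
  · exact (hx.comp hy).comp hs

/-- transport of connections -/
theorem Cn.transp {s : Bool} {ξ : V → Bool} {R : Set V} {a b : V} (τ τ' : V → V) (h : Cn (Ad s) (Op ξ ∩ R) a b)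
    (hτ : ∀ v, τ (τ' v) = v) (hA : ∀ a b, Ad s a b → Ad s (τ' a) (τ' b)) :
    Cn (Ad s) (Op (fun v => ξ (τ v)) ∩ τ ⁻¹' R) (τ' a) (τ' b) := by
  refine h.map τ' hA ?_
  rintro v ⟨h1, h2⟩
  refine ⟨?_, ?_⟩
  · simp only [Op, Set.mem_setOf_eq, hτ]; exact h1
  · simp only [Set.mem_preimage, hτ]; exact h2

theorem Cn.transp' {s : Bool} {ξ : V → Bool} {R : Set V} {a b : V} (τ : V → V)
    (h : Cn (Ad s) (Op (fun v => ξ (τ v)) ∩ R) a b) (hA : ∀ a b, Ad s a b → Ad s (τ a) (τ b)) :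
    Cn (Ad s) (Op ξ ∩ τ '' R) (τ a) (τ b) := by
  refine h.map τ hA ?_
  rintro v ⟨h1, h2⟩
  exact ⟨h1, Set.mem_image_of_mem _ h2⟩

/-! ### Arms to a segment -/

def AT (s : Bool) (k n lo hi : ℤ) : Set (V → Bool) := {ξ | ∃ u ∈ Bx k, Tch s (Op ξ ∩ Bx n) u n lo hi}

theorem AT_LU (s : Bool) (k n lo hi : ℤ) : LU (AT s k n lo hi) := by
  refine ⟨⟨(Bx_finite n).toFinset, ?_⟩, ?_⟩
  · rintro ξ ξ' e ⟨u, hu, y, h1, h2, h⟩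
    rw [Op_congr (by simpa using e)] at h
    exact ⟨u, hu, y, h1, h2, h⟩
  · rintro ξ ξ' e ⟨u, hu, y, h1, h2, h⟩
    exact ⟨u, hu, y, h1, h2, h.mono (Set.inter_subset_inter_left _ (Op_mono e))⟩

theorem arm_AT {s : Bool} {k n : ℤ} {ξ : V → Bool} (h : ξ ∈ ArmE s k n) :
    ∃ i : Bool × Bool × Bool, (fun v => ξ (dS i v)) ∈ AT s k n 0 n := by
  obtain ⟨u, x, hu, hx, h⟩ := h
  have key : ∀ i : Bool × Bool × Bool, (eS i x).1 = n → 0 ≤ (eS i x).2 → (fun v => ξ (dS i v)) ∈ AT s k n 0 n := by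
    intro i h1 h2
    have h3 := h.transp (dS i) (eS i) (dS_eS i) (fun a b => eS_Ad i)
    refine ⟨eS i u, (eS_Bx i k u).2 hu, (eS i x).2, h2, ?_, ?_⟩
    · have := (eS_Bx i n x).2 hx.1
      rw [mem_Bx] at this; omega
    · rw [← h1]
      exact h3.mono (Set.inter_subset_inter_right _ fun v hv => by rw [h1]; exact (dS_Bx i n v).1 hv)
  rw [mem_Rg] at hx
  have e1 := key (false, false, false)
  have e2 := key (false, false, true)
  have e3 := key (false, true, false)
  have e4 := key (false, true, true)
  have e5 := key (true, false, false)
  have e6 := key (true, false, true)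
  have e7 := key (true, true, false)
  have e8 := key (true, true, true)
  simp only [eS, if_true, if_false, Bool.false_eq_true] at e1 e2 e3 e4 e5 e6 e7 e8
  by_contra hc
  push Not at hc
  rcases hx.2 with h1 | h1 | h1 | h1 <;> rcases le_total 0 x.1 with h2 | h2 <;> rcases le_total 0 x.2 with h3 | h3 <;>
  first
  | exact hc _ (e1 (by omega) (by omega))
  | exact hc _ (e2 (by omega) (by omega))
  | exact hc _ (e3 (by omega) (by omega))
  | exact hc _ (e4 (by omega) (by omega))
  | exact hc _ (e5 (by omega) (by omega))
  | exact hc _ (e6 (by omega) (by omega))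
  | exact hc _ (e7 (by omega) (by omega))
  | exact hc _ (e8 (by omega) (by omega))

theorem Nice.inv_compl {μ : Measure (V → Bool)} (h : Nice μ) (i : Bool × Bool × Bool) {A : Set (V → Bool)} (hA : LU A) :
    μ.real {ξ | (fun v => ξ (dS i v)) ∈ A}ᶜ = μ.real Aᶜ := by
  have := (h.inv i).real hA.meas.compl
  exact this

theorem AT_pow {μ : Measure (V → Bool)} (h : Nice μ) (s : Bool) (k n : ℤ) :
    μ.real (AT s k n 0 n)ᶜ ^ 8 ≤ μ.real (ArmE s k n)ᶜ := by
  have := h.prob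
  have h1 := h.fkgc_prod Finset.univ (fun i : Bool × Bool × Bool => {ξ | (fun v => ξ (dS i v)) ∈ AT s k n 0 n})
    (fun i _ => (AT_LU s k n 0 n).comap (dS i))
  simp only [h.inv_compl _ (AT_LU s k n 0 n), Finset.prod_const] at h1
  have h2 : (Finset.univ : Finset (Bool × Bool × Bool)).card = 8 := by decide
  rw [h2] at h1
  refine h1.trans (measureReal_mono (Set.compl_subset_compl.2 ?_))
  intro ξ hξ
  obtain ⟨i, hi⟩ := arm_AT hξ
  simp only [Set.mem_iUnion, Finset.mem_univ, exists_const, true_and]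
  exact ⟨i, hi⟩



theorem LU_site (v : V) : LU {ξ : V → Bool | ξ v = true} := by
  refine ⟨⟨{v}, ?_⟩, ?_⟩
  · intro ξ ξ' e h
    have := e v (by simp)
    simp only [Set.mem_setOf_eq] at *
    rw [← h, this]
  · intro ξ ξ' e h
    have := e v
    simp only [Set.mem_setOf_eq] at *
    rw [h] at this
    exact top_le_iff.1 this

/-- lower bound for closed sites -/
def Clo (μ : Measure (V → Bool)) (c : ℝ) : Prop :=
  0 < c ∧ c ≤ μ.real {ξ : V → Bool | ξ (1, 0) = true}ᶜ ∧ c ≤ μ.real {ξ : V → Bool | ξ (1, 1) = true}ᶜ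

theorem Clo.site {μ : Measure (V → Bool)} (h : Nice μ) {c : ℝ} (hc : Clo μ c) (n y : ℤ) (hn : n % 2 = 1) :
    c ≤ μ.real {ξ : V → Bool | ξ (n, y) = true}ᶜ := by
  rcases Int.emod_two_eq_zero_or_one y with hy | hy
  · have := (h.tr ((n - 1) / 2, y / 2)).real (LU_site (1, 0)).meas.compl
    have e : ((1, 0) : V) + (((n - 1) / 2, y / 2) + ((n - 1) / 2, y / 2)) = (n, y) := by
      ext <;> simp <;> omega
    simp only [Set.mem_compl_iff, Set.mem_setOf_eq, e] at this
    have h2 := hc.2.1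
    rw [← this] at h2
    exact h2
  · have := (h.tr ((n - 1) / 2, (y - 1) / 2)).real (LU_site (1, 1)).meas.compl
    have e : ((1, 1) : V) + (((n - 1) / 2, (y - 1) / 2) + ((n - 1) / 2, (y - 1) / 2)) = (n, y) := by
      ext <;> simp <;> omega
    simp only [Set.mem_compl_iff, Set.mem_setOf_eq, e] at this
    have h2 := hc.2.2
    rw [← this] at h2
    exact h2

theorem seg_bound {μ : Measure (V → Bool)} (h : Nice μ) {c : ℝ} (hc : Clo μ c) (n : ℤ) (hn : n % 2 = 1) :
    c ^ 4 ≤ μ.real (⋃ y ∈ Finset.range 4, {ξ : V → Bool | ξ (n, (y : ℤ)) = true})ᶜ := by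
  refine le_trans ?_ (h.fkgc_prod (Finset.range 4) _ (fun y _ => LU_site (n, (y : ℤ))))
  have : c ^ 4 = ∏ y ∈ Finset.range 4, c := by simp
  rw [this]
  exact Finset.prod_le_prod (fun _ _ => hc.1.le) (fun y _ => hc.site h n y hn)

theorem AT_split {s : Bool} {k n lo mid hi : ℤ} : AT s k n lo hi ⊆ AT s k n lo mid ∪ AT s k n mid hi := by
  rintro ξ ⟨u, hu, y, h1, h2, h3⟩
  rcases le_total y mid with h | h
  · exact Or.inl ⟨u, hu, y, h1, h, h3⟩
  · exact Or.inr ⟨u, hu, y, h, h2, h3⟩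

theorem choose_a {μ : Measure (V → Bool)} (h : Nice μ) {c : ℝ} (hc : Clo μ c) {s : Bool} {k n : ℤ} {ε : ℝ} (hn : n % 2 = 1)
    (h0 : 0 < ε) (h1 : ε < 1) (hx : μ.real (AT s k n 0 n)ᶜ ≤ ε * ε) (hx' : μ.real (AT s k n 0 n)ᶜ ≤ c ^ 4 * ε) :
    ∃ a : ℕ, 1 ≤ a ∧ 4 * (a : ℤ) ≤ n ∧ μ.real (AT s k n (4 * a) n)ᶜ ≤ ε ∧ μ.real (AT s k n 0 (4 * a + 4))ᶜ ≤ ε := by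
  classical
  have := h.prob
  let G : ℕ → Prop := fun a => μ.real (AT s k n (4 * a) n)ᶜ ≤ ε
  have hbig : ∀ a : ℕ, n < 4 * (a : ℤ) → ¬ G a := by
    intro a ha hG
    have : AT s k n (4 * a) n = ∅ := by
      ext ξ; simp only [Set.mem_empty_iff_false, iff_false]
      rintro ⟨u, hu, y, h1, h2, h3⟩; omega
    simp only [G, this, Set.compl_empty, probReal_univ] at hG
    linarith
  have hG1 : G 1 := by
    have hs := seg_bound h hc n hn
    have hf := h.fkgc (AT_LU s k n 4 n) (LU.iUnion (Finset.range 4) _ (fun y _ => LU_site (n, (y : ℤ))))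
    have hsub : (AT s k n 4 n)ᶜ ∩ (⋃ y ∈ Finset.range 4, {ξ : V → Bool | ξ (n, (y : ℤ)) = true})ᶜ ⊆ (AT s k n 0 n)ᶜ := by
      rintro ξ ⟨h1, h2⟩ ⟨u, hu, y, l1, l2, h3⟩
      rcases lt_or_ge y 4 with hy | hy
      · apply h2
        simp only [Set.mem_iUnion, Finset.mem_range]
        refine ⟨y.toNat, by omega, ?_⟩
        have : ((y.toNat : ℕ) : ℤ) = y := by omega
        simp only [Set.mem_setOf_eq, this]
        exact h3.right.1
      · exact h1 ⟨u, hu, y, hy, l2, h3⟩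
    have hm := measureReal_mono (μ := μ) hsub
    have hc4 : 0 < c ^ 4 := pow_pos hc.1 4
    have hnn : 0 ≤ μ.real (AT s k n 4 n)ᶜ := measureReal_nonneg
    change μ.real (AT s k n (4 * (1 : ℕ)) n)ᶜ ≤ ε
    norm_num
    have : μ.real (AT s k n 4 n)ᶜ * c ^ 4 ≤ ε * c ^ 4 := by nlinarith
    exact le_of_mul_le_mul_right this hc4
  have hex : ∃ b : ℕ, ¬ G (b + 1) := ⟨n.toNat + 1, hbig _ (by push_cast; omega)⟩
  have hb := Nat.find_spec hex
  have hGb : ∀ b, b < Nat.find hex → G (b + 1) := fun b hb => not_not.1 (Nat.find_min hex hb)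
  set b := Nat.find hex with hbdef
  have hb1 : 1 ≤ b := by
    by_contra hlt
    have : b = 0 := by omega
    rw [this] at hb
    exact hb hG1
  have hGG : G b := by
    have := hGb (b - 1) (by omega)
    rwa [Nat.sub_add_cancel hb1] at this
  refine ⟨b, hb1, ?_, hGG, ?_⟩
  · by_contra hlt
    exact hbig b (by omega) hGG
  · have hf := h.fkgc (AT_LU s k n 0 (4 * b + 4)) (AT_LU s k n (4 * ((b + 1 : ℕ) : ℤ)) n)
    have hsub : (AT s k n 0 (4 * b + 4))ᶜ ∩ (AT s k n (4 * ((b + 1 : ℕ) : ℤ)) n)ᶜ ⊆ (AT s k n 0 n)ᶜ := by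
      rw [← Set.compl_union, Set.compl_subset_compl]
      have e : 4 * ((b + 1 : ℕ) : ℤ) = 4 * b + 4 := by push_cast; ring
      rw [e]; exact AT_split
    have hm := measureReal_mono (μ := μ) hsub
    have hb' : ε < μ.real (AT s k n (4 * ((b + 1 : ℕ) : ℤ)) n)ᶜ := not_le.1 hb
    have hnn : 0 ≤ μ.real (AT s k n 0 (4 * b + 4))ᶜ := measureReal_nonneg
    have : μ.real (AT s k n 0 (4 * b + 4))ᶜ * ε ≤ ε * ε := by nlinarith
    exact le_of_mul_le_mul_right this h0

/-- choose `k`, then `a` for all odd large `n` -/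
theorem choose_ka {μ : Measure (V → Bool)} (h : Nice μ) {c : ℝ} (hc : Clo μ c) {s : Bool} {ε : ℝ} (h0 : 0 < ε) (h1 : ε < 1)
    (hP : HypP μ s) : ∃ k : ℕ, ∀ n : ℕ, k ≤ n → n % 2 = 1 →
    ∃ a : ℕ, 1 ≤ a ∧ 4 * a ≤ n ∧ μ.real (AT s k n (4 * a) n)ᶜ ≤ ε ∧ μ.real (AT s k n 0 (4 * a + 4))ᶜ ≤ ε := by
  have hδ : 0 < min (ε * ε) (c ^ 4 * ε) := lt_min (mul_pos h0 h0) (mul_pos (pow_pos hc.1 4) h0)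
  obtain ⟨k, hk⟩ := hP _ (pow_pos hδ 8)
  refine ⟨k, fun n hn ho => ?_⟩
  have hx := (AT_pow h s k n).trans (hk n hn)
  have hx2 : μ.real (AT s k n 0 n)ᶜ ≤ min (ε * ε) (c ^ 4 * ε) :=
    le_of_pow_le_pow_left₀ (by norm_num) hδ.le hx
  obtain ⟨a, ha, ha2, ha3, ha4⟩ := choose_a h hc (s := s) (k := k) (n := n) (by omega) h0 h1 (hx2.trans (min_le_left _ _)) (hx2.trans (min_le_right _ _))
  exact ⟨a, ha, by omega, ha3, ha4⟩


def FullE (s : Bool) (n a : ℤ) : Set (V → Bool) := {ξ | ∃ c, FullC s (Op ξ) 0 n a c}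

theorem Sb_zero (n : ℤ) : Sb 0 n = Bx n := by
  ext v; simp only [Sb, mem_Bx, Set.mem_setOf_eq, Prod.fst_zero, Prod.snd_zero]; omega

theorem FullE_LU (s : Bool) (n a : ℤ) : LU (FullE s n a) := by
  refine ⟨⟨(Bx_finite n).toFinset, ?_⟩, ?_⟩
  · rintro ξ ξ' e ⟨c, h⟩
    refine ⟨c, ?_⟩
    unfold FullC at *
    rw [Sb_zero] at *
    rwa [← Op_congr (by simpa using e)]
  · rintro ξ ξ' e ⟨c, h⟩
    refine ⟨c, ?_⟩
    have hs : Op ξ ∩ Sb 0 n ⊆ Op ξ' ∩ Sb 0 n := Set.inter_subset_inter_left _ (Op_mono e)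
    obtain ⟨⟨h1, h2, h3⟩, h4, h5, h6⟩ := h
    exact ⟨⟨h1.mono hs, h2.mono hs, h3.mono hs⟩, h4.mono hs, h5.mono hs, h6.mono hs⟩

theorem Ad_add {s : Bool} {a b : V} (z : V) (h : Ad s a b) : Ad s (a + z) (b + z) := by
  cases s
  · change SqAdj _ _ at h ⊢
    rw [sqAdj_iff] at *
    simp only [Prod.fst_add, Prod.snd_add]; omega
  · change StarAdj _ _ at h ⊢
    rw [starAdj_iff] at *
    simp only [Prod.fst_add, Prod.snd_add]; omega

theorem FullC_shift {s : Bool} {ξ : V → Bool} {n a : ℤ} {z : V} (h : (fun v => ξ (v + z)) ∈ FullE s n a) :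
    ∃ c, FullC s (Op ξ) z n a c := by
  obtain ⟨c, h⟩ := h
  refine ⟨c + z, ?_⟩
  have key : ∀ {x lo hi x' lo' hi' : ℤ}, Tch s (Op (fun v => ξ (v + z)) ∩ Sb 0 n) c x lo hi → x + z.1 = x' → lo + z.2 = lo' → hi + z.2 = hi' →
      Tch s (Op ξ ∩ Sb z n) (c + z) x' lo' hi' := by
    rintro x lo hi _ _ _ ⟨y, l1, l2, h⟩ rfl rfl rfl
    refine ⟨y + z.2, by omega, by omega, ?_⟩
    have := Cn.transp' (fun v => v + z) h (fun a b => Ad_add z)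
    refine this.mono (Set.inter_subset_inter_right _ ?_)
    rintro _ ⟨v, hv, rfl⟩
    simp only [Sb, Set.mem_setOf_eq, Prod.fst_zero, Prod.snd_zero, Prod.fst_add, Prod.snd_add] at *
    omega
  obtain ⟨⟨h1, h2, h3⟩, h4, h5, h6⟩ := h
  simp only [Prod.fst_zero, Prod.snd_zero] at *
  refine ⟨⟨key h1 ?_ ?_ ?_, key h2 ?_ ?_ ?_, key h3 ?_ ?_ ?_⟩, key h4 ?_ ?_ ?_, key h5 ?_ ?_ ?_, key h6 ?_ ?_ ?_⟩ <;> ring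

/-- six arms -/
def Six (s : Bool) (k n a : ℤ) : Finset ((Bool × Bool × Bool) × Bool) :=
  {((false, false, false), false), ((false, true, false), false), ((false, false, false), true),
   ((true, false, false), false), ((true, true, false), false), ((true, false, false), true)}

def SixA (s : Bool) (k n a : ℤ) (i : (Bool × Bool × Bool) × Bool) : Set (V → Bool) :=
  {ξ | (fun v => ξ (dS i.1 v)) ∈ (if i.2 then AT s k n 0 (4 * a + 4) else AT s k n (4 * a) n)}

theorem SixA_LU (s : Bool) (k n a : ℤ) (i) : LU (SixA s k n a i) := by
  unfold SixA
  split_ifs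
  · exact (AT_LU s k n _ _).comap _
  · exact (AT_LU s k n _ _).comap _

theorem SixA_bound {μ : Measure (V → Bool)} (h : Nice μ) {s : Bool} {k n a : ℤ} {ε : ℝ} (h1 : μ.real (AT s k n (4 * a) n)ᶜ ≤ ε)
    (h2 : μ.real (AT s k n 0 (4 * a + 4))ᶜ ≤ ε) (i) : μ.real (SixA s k n a i)ᶜ ≤ ε := by
  unfold SixA
  split_ifs
  · rw [h.inv_compl _ (AT_LU s k n _ _)]; exact h2
  · rw [h.inv_compl _ (AT_LU s k n _ _)]; exact h1

theorem six_full {s : Bool} {k n a : ℤ} {ξ : V → Bool} (h6 : ∀ i ∈ Six s k n a, ξ ∈ SixA s k n a i) (hn : 0 ≤ n)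
    (hJ : ∀ u v x y, u ∈ Bx k → v ∈ Bx k → x ∈ Rg n → y ∈ Rg n → Cn (Ad s) (Op ξ ∩ Bx n) u x → Cn (Ad s) (Op ξ ∩ Bx n) v y →
      Cn (Ad s) (Op ξ ∩ Bx n) u v) : ξ ∈ FullE s n a := by
  have key : ∀ (i : Bool × Bool × Bool) (lo hi : ℤ), (fun v => ξ (dS i v)) ∈ AT s k n lo hi → ∃ u ∈ Bx k, ∃ x ∈ Rg n, ∃ y,
      lo ≤ y ∧ y ≤ hi ∧ x = dS i (n, y) ∧ Cn (Ad s) (Op ξ ∩ Bx n) u x := by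
    rintro i lo hi ⟨u, hu, y, l1, l2, h⟩
    refine ⟨dS i u, (dS_Bx i k u).2 hu, dS i (n, y), ?_, y, l1, l2, rfl, ?_⟩
    · have := h.right.2
      rw [mem_Bx] at this
      rw [mem_Rg]
      obtain ⟨_ | _, _ | _, _ | _⟩ := i <;> simp only [dS, mem_Bx, if_true, if_false, Bool.false_eq_true] at * <;> refine ⟨by omega, ?_⟩ <;> simp
    · have := Cn.transp' (dS i) h (fun a b => dS_Ad i)
      refine this.mono (Set.inter_subset_inter_right _ ?_)
      rintro _ ⟨v, hv, rfl⟩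
      exact (dS_Bx i n v).2 hv
  obtain ⟨u1, k1, x1, r1, y1, a1, b1, e1, c1⟩ := key (false, false, false) (4 * a) n (h6 ((false, false, false), false) (by simp [Six]))
  obtain ⟨u2, k2, x2, r2, y2, a2, b2, e2, c2⟩ := key (false, true, false) (4 * a) n (h6 ((false, true, false), false) (by simp [Six]))
  obtain ⟨u3, k3, x3, r3, y3, a3, b3, e3, c3⟩ := key (false, false, false) 0 (4 * a + 4) (h6 ((false, false, false), true) (by simp [Six]))
  obtain ⟨u4, k4, x4, r4, y4, a4, b4, e4, c4⟩ := key (true, false, false) (4 * a) n (h6 ((true, false, false), false) (by simp [Six]))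
  obtain ⟨u5, k5, x5, r5, y5, a5, b5, e5, c5⟩ := key (true, true, false) (4 * a) n (h6 ((true, true, false), false) (by simp [Six]))
  obtain ⟨u6, k6, x6, r6, y6, a6, b6, e6, c6⟩ := key (true, false, false) 0 (4 * a + 4) (h6 ((true, false, false), true) (by simp [Six]))
  have g2 := (hJ u1 u2 x1 x2 k1 k2 r1 r2 c1 c2).trans c2
  have g3 := (hJ u1 u3 x1 x3 k1 k3 r1 r3 c1 c3).trans c3
  have g4 := (hJ u1 u4 x1 x4 k1 k4 r1 r4 c1 c4).trans c4
  have g5 := (hJ u1 u5 x1 x5 k1 k5 r1 r5 c1 c5).trans c5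
  have g6 := (hJ u1 u6 x1 x6 k1 k6 r1 r6 c1 c6).trans c6
  simp only [dS, if_true, if_false, Bool.false_eq_true] at e1 e2 e3 e4 e5 e6
  subst e1 e2 e3 e4 e5 e6
  refine ⟨u1, ?_⟩
  unfold FullC
  rw [Sb_zero]
  simp only [Prod.fst_zero, Prod.snd_zero, zero_add, zero_sub]
  exact ⟨⟨⟨y1, a1, b1, c1⟩, ⟨-y2, by omega, by omega, g2⟩, ⟨y3, a3, b3, g3⟩⟩, ⟨y4, a4, b4, g4⟩, ⟨-y5, by omega, by omega, g5⟩, ⟨y6, a6, b6, g6⟩⟩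

theorem full_M1 {μ : Measure (V → Bool)} (h : Nice μ) {s : Bool} {k n a : ℤ} {ε : ℝ} (hn : 0 ≤ n) (hε : ε < 1)
    (h1 : μ.real (AT s k n (4 * a) n)ᶜ ≤ ε)
    (h2 : μ.real (AT s k n 0 (4 * a + 4))ᶜ ≤ ε) (J : Set (V → Bool)) (hJ : LU J)
    (hJJ : ∀ᵐ ξ ∂μ, ξ ∈ J → ∀ u v x y, u ∈ Bx k → v ∈ Bx k → x ∈ Rg n → y ∈ Rg n → Cn (Ad s) (Op ξ ∩ Bx n) u x → Cn (Ad s) (Op ξ ∩ Bx n) v y →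
      Cn (Ad s) (Op ξ ∩ Bx n) u v) : (1 - ε) ^ 6 * μ.real J ≤ μ.real (FullE s n a) := by
  have := h.prob
  have hA := h.fkg_prod (Six s k n a) (SixA s k n a) (fun i _ => SixA_LU s k n a i)
  have hB := h.fkg2 (LU.iInter (Six s k n a) (SixA s k n a) (fun i _ => SixA_LU s k n a i)) hJ
  have hC : μ.real ((⋂ i ∈ Six s k n a, SixA s k n a i) ∩ J) ≤ μ.real (FullE s n a) := by
    apply ENNReal.toReal_mono (measure_ne_top _ _)
    apply measure_mono_ae
    filter_upwards [hJJ] with ξ hξ hm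
    exact six_full (fun i hi => by have := hm.1; simp only [Set.mem_iInter] at this; exact this i hi) hn (hξ hm.2)
  have hD : (1 - ε) ^ 6 ≤ ∏ i ∈ Six s k n a, μ.real (SixA s k n a i) := by
    have e : (1 - ε) ^ 6 = ∏ i ∈ Six s k n a, (1 - ε) := by
      rw [Finset.prod_const]; rfl
    rw [e]
    refine Finset.prod_le_prod (fun _ _ => by linarith) (fun i _ => ?_)
    have := SixA_bound h h1 h2 i
    rw [probReal_compl_eq_one_sub (SixA_LU s k n a i).meas] at this
    linarith
  have hJ0 : 0 ≤ μ.real J := measureReal_nonneg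
  nlinarith

theorem full_M2 {μ : Measure (V → Bool)} (h : Nice μ) {s : Bool} {k n a : ℤ} {ε : ℝ} (hk : 0 ≤ k) (hn : k ≤ n)
    (h1 : μ.real (AT s k n (4 * a) n)ᶜ ≤ ε)
    (h2 : μ.real (AT s k n 0 (4 * a + 4))ᶜ ≤ ε) : 1 - 6 * ε - μ.real (DArmE s k n) ≤ μ.real (FullE s n a) := by
  have := h.prob
  have hsub : (FullE s n a)ᶜ ⊆ (⋃ i ∈ Six s k n a, (SixA s k n a i)ᶜ) ∪ DArmE s k n := by
    intro ξ hξ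
    by_contra hc
    simp only [Set.mem_union, Set.mem_iUnion, not_or, not_exists] at hc
    refine hξ (six_full (fun i hi => by simpa using hc.1 i hi) (by omega) ?_)
    intro u v x y hu hv hx hy hux hvy
    by_contra huv
    exact hc.2 (timar hk hn hu hv hx hy hux hvy huv)
  have h3 := measureReal_mono (μ := μ) hsub
  have h4 := measureReal_union_le (μ := μ) (⋃ i ∈ Six s k n a, (SixA s k n a i)ᶜ) (DArmE s k n)
  have h5 : μ.real (⋃ i ∈ Six s k n a, (SixA s k n a i)ᶜ) ≤ 6 * ε := by
    refine (measureReal_biUnion_finset_le _ _).trans ?_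
    have e : 6 * ε = ∑ i ∈ Six s k n a, ε := by
      rw [Finset.sum_const, nsmul_eq_mul]; norm_num; left; rfl
    rw [e]
    exact Finset.sum_le_sum fun i _ => SixA_bound h h1 h2 i
  rw [probReal_compl_eq_one_sub (FullE_LU s n a).meas] at h3
  linarith



theorem Rc_finite (x0 x1 y0 y1 : ℤ) : (Rc x0 x1 y0 y1).Finite := by
  have : Rc x0 x1 y0 y1 = Set.Icc x0 x1 ×ˢ Set.Icc y0 y1 := by
    ext v; simp only [Rc, Set.mem_prod, Set.mem_Icc, Set.mem_setOf_eq]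
  rw [this]
  exact (Set.finite_Icc _ _).prod (Set.finite_Icc _ _)

/-- vertical crossing event -/
def VX (s : Bool) (x0 x1 y0 y1 : ℤ) : Set (V → Bool) :=
  {ξ | ∃ a b : V, a.2 = y0 ∧ b.2 = y1 ∧ Cn (Ad s) (Op ξ ∩ Rc x0 x1 y0 y1) a b}
/-- horizontal crossing event -/
def HX (s : Bool) (x0 x1 y0 y1 : ℤ) : Set (V → Bool) :=
  {ξ | ∃ a b : V, a.1 = x0 ∧ b.1 = x1 ∧ Cn (Ad s) (Op ξ ∩ Rc x0 x1 y0 y1) a b}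

theorem VX_dep (s : Bool) (x0 x1 y0 y1 : ℤ) : DepOn (VX s x0 x1 y0 y1) (Rc x0 x1 y0 y1) := by
  rintro ξ ξ' e ⟨a, b, ha, hb, h⟩
  rw [Op_congr e] at h
  exact ⟨a, b, ha, hb, h⟩
theorem HX_dep (s : Bool) (x0 x1 y0 y1 : ℤ) : DepOn (HX s x0 x1 y0 y1) (Rc x0 x1 y0 y1) := by
  rintro ξ ξ' e ⟨a, b, ha, hb, h⟩
  rw [Op_congr e] at h
  exact ⟨a, b, ha, hb, h⟩

theorem VX_LU (s : Bool) (x0 x1 y0 y1 : ℤ) : LU (VX s x0 x1 y0 y1) := by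
  refine ⟨⟨(Rc_finite x0 x1 y0 y1).toFinset, by simpa using VX_dep s x0 x1 y0 y1⟩, ?_⟩
  rintro ξ ξ' e ⟨a, b, ha, hb, h⟩
  exact ⟨a, b, ha, hb, h.mono (Set.inter_subset_inter_left _ (Op_mono e))⟩
theorem HX_LU (s : Bool) (x0 x1 y0 y1 : ℤ) : LU (HX s x0 x1 y0 y1) := by
  refine ⟨⟨(Rc_finite x0 x1 y0 y1).toFinset, by simpa using HX_dep s x0 x1 y0 y1⟩, ?_⟩
  rintro ξ ξ' e ⟨a, b, ha, hb, h⟩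
  exact ⟨a, b, ha, hb, h.mono (Set.inter_subset_inter_left _ (Op_mono e))⟩

theorem VX_shift_eq (s : Bool) (x0 x1 y0 y1 : ℤ) (z : V) :
    {ξ : V → Bool | (fun v => ξ (v + z)) ∈ VX s x0 x1 y0 y1} = VX s (x0 + z.1) (x1 + z.1) (y0 + z.2) (y1 + z.2) := by
  ext ξ
  constructor
  · rintro ⟨a, b, ha, hb, h⟩
    have := Cn.transp' (fun v => v + z) h (fun a b => Ad_add z)
    refine ⟨a + z, b + z, by simp [ha], by simp [hb], this.mono (Set.inter_subset_inter_right _ ?_)⟩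
    rintro _ ⟨v, hv, rfl⟩
    simp only [Rc, Set.mem_setOf_eq, Prod.fst_add, Prod.snd_add] at *
    omega
  · rintro ⟨a, b, ha, hb, h⟩
    have := Cn.transp (fun v => v + z) (fun v => v + -z) h (by simp) (fun a b => Ad_add (-z))
    refine ⟨a + -z, b + -z, by simp [ha], by simp [hb], this.mono (Set.inter_subset_inter_right _ ?_)⟩
    rintro v hv
    simp only [Rc, Set.mem_setOf_eq, Set.mem_preimage, Prod.fst_add, Prod.snd_add] at *
    omega

theorem swap_HX_eq (s : Bool) (x0 x1 y0 y1 : ℤ) :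
    {ξ : V → Bool | (fun v => ξ (Prod.swap v)) ∈ VX s y0 y1 x0 x1} = HX s x0 x1 y0 y1 := by
  ext ξ
  constructor
  · rintro ⟨a, b, ha, hb, h⟩
    have := Cn.transp' Prod.swap h (fun a b h => swap_Ad h)
    refine ⟨a.swap, b.swap, ha, hb, this.mono (Set.inter_subset_inter_right _ ?_)⟩
    rintro _ ⟨v, hv, rfl⟩
    exact ⟨hv.2, hv.1⟩
  · rintro ⟨a, b, ha, hb, h⟩
    have := Cn.transp Prod.swap Prod.swap h (fun v => v.swap_swap) (fun a b h => swap_Ad h)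
    refine ⟨a.swap, b.swap, ha, hb, this.mono (Set.inter_subset_inter_right _ ?_)⟩
    rintro v hv
    exact ⟨hv.2, hv.1⟩

theorem Nice.VX_shift {μ : Measure (V → Bool)} (h : Nice μ) (s : Bool) (x0 x1 y0 y1 : ℤ) (z : V) :
    μ.real (VX s (x0 + (z.1 + z.1)) (x1 + (z.1 + z.1)) (y0 + (z.2 + z.2)) (y1 + (z.2 + z.2))) = μ.real (VX s x0 x1 y0 y1) := by
  rw [← (h.tr z).real (VX_LU s x0 x1 y0 y1).meas, VX_shift_eq]; rfl

theorem Nice.HX_eq {μ : Measure (V → Bool)} (h : Nice μ) (s : Bool) (x0 x1 y0 y1 : ℤ) :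
    μ.real (HX s x0 x1 y0 y1) = μ.real (VX s y0 y1 x0 x1) := by
  rw [← swap_HX_eq]
  exact h.sw.real (VX_LU s y0 y1 x0 x1).meas

/-- if the scales are good then we get a long crossing -/
theorem good_scale {μ : Measure (V → Bool)} (h : Nice μ) {s : Bool} {p0 : ℝ} (hp0 : 0 ≤ p0) {n n' a a' : ℕ} (hn : n % 2 = 1)
    (h4 : 4 ≤ n) (hn' : n' = n + 2 * (n / 4)) (ha : 4 * a ≤ n) (haa : a' + 1 ≤ 2 * a) (h1 : p0 ≤ μ.real (FullE s n a))
    (h2 : p0 ≤ μ.real (FullE s n' a')) : p0 ^ 33 ≤ μ.real (VX s 0 (3 * n' : ℕ) 0 (3 * (3 * n' : ℕ))) := by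
  have := h.prob
  let q : ℤ := (n / 4 : ℕ)
  have hq : (n' : ℤ) - n = q + q := by simp only [q]; omega
  let A : ℕ → Set (V → Bool) := fun j => {ξ | (fun v => ξ (v + ((2 * j * q, - (a' + 1 : ℤ)) + (2 * j * q, - (a' + 1 : ℤ))))) ∈ FullE s n' a'}
  let B : ℕ → Set (V → Bool) := fun j => {ξ | (fun v => ξ (v + (((2 * j + 1) * q, (0 : ℤ)) + ((2 * j + 1) * q, (0 : ℤ))))) ∈ FullE s n a}
  have hA : ∀ j, LU (A j) := fun j => (FullE_LU s n' a').comap _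
  have hB : ∀ j, LU (B j) := fun j => (FullE_LU s n a).comap _
  have pA : ∀ j, p0 ≤ μ.real (A j) := fun j => by
    have := (h.tr (2 * j * q, - (a' + 1 : ℤ))).real (FullE_LU s n' a').meas
    exact this ▸ h2
  have pB : ∀ j, p0 ≤ μ.real (B j) := fun j => by
    have := (h.tr ((2 * j + 1) * q, (0 : ℤ))).real (FullE_LU s n a).meas
    exact this ▸ h1
  have fA := h.fkg_prod (Finset.range 17) A (fun j _ => hA j)
  have fB := h.fkg_prod (Finset.range 16) B (fun j _ => hB j)
  have fAB := h.fkg2 (LU.iInter (Finset.range 17) A (fun j _ => hA j)) (LU.iInter (Finset.range 16) B (fun j _ => hB j))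
  have gA : p0 ^ 17 ≤ ∏ i ∈ Finset.range 17, μ.real (A i) := by
    have e : p0 ^ 17 = ∏ i ∈ Finset.range 17, p0 := by simp
    rw [e]; exact Finset.prod_le_prod (fun _ _ => hp0) (fun i _ => pA i)
  have gB : p0 ^ 16 ≤ ∏ i ∈ Finset.range 16, μ.real (B i) := by
    have e : p0 ^ 16 = ∏ i ∈ Finset.range 16, p0 := by simp
    rw [e]; exact Finset.prod_le_prod (fun _ _ => hp0) (fun i _ => pB i)
  have hlow : p0 ^ 33 ≤ μ.real ((⋂ i ∈ Finset.range 17, A i) ∩ ⋂ i ∈ Finset.range 16, B i) := by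
    refine le_trans ?_ fAB
    rw [show (33 : ℕ) = 17 + 16 from rfl, pow_add]
    exact mul_le_mul (gA.trans fA) (gB.trans fB) (pow_nonneg hp0 _) measureReal_nonneg
  have hinc : ((⋂ i ∈ Finset.range 17, A i) ∩ ⋂ i ∈ Finset.range 16, B i) ⊆ HX s (-(n' - 1)) (-(n' - 1) + 9 * n') (-2 * n') n' := by
    rintro ξ ⟨m1, m2⟩
    simp only [Set.mem_iInter] at m1 m2
    obtain ⟨y, y', hc⟩ := chain (s := s) (O := Op ξ) (n := n') (m := n) (a := a') (a' := a) 16 (by omega) (by omega) (by omega) (by omega) (by omega)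
      (fun j hj => by
        have := FullC_shift (m1 j (by simp; omega))
        have e : ((2 * j * q, - (a' + 1 : ℤ)) + (2 * j * q, - (a' + 1 : ℤ)) : V) = (2 * j * ((n' : ℤ) - n), - (2 * ((a' : ℤ) + 1))) := by
          rw [hq]; ext <;> simp <;> ring
        rwa [e] at this)
      (fun j hj => by
        have := FullC_shift (m2 j (by simp; omega))
        have e : (((2 * j + 1) * q, (0 : ℤ)) + ((2 * j + 1) * q, (0 : ℤ)) : V) = ((2 * j + 1) * ((n' : ℤ) - n), 0) := by
          rw [hq]; ext <;> simp <;> ring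
        rwa [e] at this)
    obtain ⟨u, v, hu, hv, huv⟩ := trim (fun v : V => v.1) lip_fst (l := -(n' - 1)) (r := -(n' - 1) + 9 * n') (by omega) hc (by simp)
      (by simp only; push_cast; omega)
    refine ⟨u, v, hu, hv, huv.mono ?_⟩
    rintro w ⟨⟨w1, w2⟩, w3⟩
    exact ⟨w1, w3, w2⟩
  refine (hlow.trans (measureReal_mono hinc)).trans (le_of_eq ?_)
  rw [h.HX_eq, ← h.VX_shift _ _ _ _ _ ((n' : ℤ), (((n' - 1) / 2 : ℕ) : ℤ))]
  congr 2 <;> push_cast <;> omega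

/-- infinitely many good scales -/
theorem core {μ : Measure (V → Bool)} (h : Nice μ) {s : Bool} {p0 : ℝ} (hp0 : 0 ≤ p0) (n0 : ℕ)
    (hF : ∀ n : ℕ, n0 ≤ n → n % 2 = 1 → ∃ a : ℕ, 1 ≤ a ∧ 4 * a ≤ n ∧ p0 ≤ μ.real (FullE s n a)) (N : ℕ) :
    ∃ m : ℕ, N ≤ m ∧ p0 ^ 33 ≤ μ.real (VX s 0 m 0 (3 * m)) := by
  by_contra hcon
  push Not at hcon
  choose! a ha1 ha4 haF using hF
  let f : ℕ → ℕ := fun i => Nat.rec (2 * (n0 + N + 4) + 1) (fun _ n => n + 2 * (n / 4)) i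
  have f0 : f 0 = 2 * (n0 + N + 4) + 1 := rfl
  have fs : ∀ i, f (i + 1) = f i + 2 * (f i / 4) := fun i => rfl
  have fo : ∀ i, f i % 2 = 1 ∧ n0 + N + 4 ≤ f i := by
    intro i
    induction i with
    | zero => rw [f0]; omega
    | succ i ih => rw [fs]; omega
  have hbad : ∀ i, 2 * a (f i) ≤ a (f (i + 1)) := by
    intro i
    by_contra hlt
    have o1 := fo i
    have o2 := fo (i + 1)
    have := good_scale h hp0 (n := f i) (n' := f (i + 1)) (a := a (f i)) (a' := a (f (i + 1))) o1.1 (by omega) (fs i) (ha4 _ (by omega) o1.1)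
      (by omega) (haF _ (by omega) o1.1) (haF _ (by omega) o2.1)
    have h2 := hcon (3 * f (i + 1)) (by omega)
    linarith
  have hpow : ∀ i, 2 ^ i ≤ a (f i) := by
    intro i
    induction i with
    | zero => exact ha1 _ (by have := fo 0; omega) (fo 0).1
    | succ i ih => have := hbad i; rw [pow_succ]; omega
  have hf : ∀ i, f i * 2 ^ i ≤ 3 ^ i * f 0 := by
    intro i
    induction i with
    | zero => simp
    | succ i ih =>
      have : 2 * f (i + 1) ≤ 3 * f i := by rw [fs]; omega
      calc f (i + 1) * 2 ^ (i + 1) = (2 * f (i + 1)) * 2 ^ i := by ring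
        _ ≤ (3 * f i) * 2 ^ i := Nat.mul_le_mul_right _ this
        _ = 3 * (f i * 2 ^ i) := by ring
        _ ≤ 3 * (3 ^ i * f 0) := Nat.mul_le_mul_left _ ih
        _ = 3 ^ (i + 1) * f 0 := by ring
  have hfin : ∀ i : ℕ, (4 / 3 : ℝ) ^ i ≤ (Nat.cast (f 0) : ℝ) := by
    intro i
    have h1 : 4 * a (f i) ≤ f i := ha4 _ (by have := fo i; omega) (fo i).1
    have h2 := hpow i
    have h3 := hf i
    have h4 : 2 ^ i * 2 ^ i ≤ 3 ^ i * f 0 := by nlinarith [Nat.pos_of_ne_zero (pow_ne_zero i (two_ne_zero (α := ℕ)))]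
    have h5 : (4 : ℝ) ^ i ≤ 3 ^ i * (Nat.cast (f 0) : ℝ) := by
      have : (4 : ℝ) ^ i = 2 ^ i * 2 ^ i := by rw [← mul_pow]; norm_num
      rw [this]; exact_mod_cast h4
    rw [div_pow, div_le_iff₀ (by positivity)]
    linarith
  obtain ⟨i, hi⟩ := pow_unbounded_of_one_lt (Nat.cast (f 0) : ℝ) (by norm_num : (1 : ℝ) < 4 / 3)
  exact absurd (hfin i) (not_le.2 hi)

/-- Machine A -/
theorem machineA {μ : Measure (V → Bool)} (h : Nice μ) {c : ℝ} (hc : Clo μ c) {s : Bool} (hP : HypP μ s)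
    (hJ : ∀ k : ℕ, ∃ J : Set (V → Bool), LU J ∧ 0 < μ.real J ∧ ∀ᵐ ξ ∂μ, ξ ∈ J → ∀ u v, u ∈ Bx k → v ∈ Bx k → ξ u = true → ξ v = true →
      Cn (Ad s) (Op ξ ∩ Bx k) u v) : ∃ δ > 0, ∀ N : ℕ, ∃ m : ℕ, N ≤ m ∧ δ ≤ μ.real (VX s 0 m 0 (3 * m)) := by
  obtain ⟨k, hk⟩ := choose_ka h hc (ε := 1 / 2) (by norm_num) (by norm_num) hP
  obtain ⟨J, hJ1, hJ2, hJ3⟩ := hJ k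
  have hp : 0 < (1 - 1 / 2 : ℝ) ^ 6 * μ.real J := by positivity
  refine ⟨((1 - 1 / 2 : ℝ) ^ 6 * μ.real J) ^ 33, by positivity, ?_⟩
  refine core h hp.le k ?_
  intro n hn ho
  obtain ⟨a, h1, h2, h3, h4⟩ := hk n hn ho
  refine ⟨a, h1, h2, full_M1 h (by omega) (by norm_num) h3 h4 J hJ1 ?_⟩
  filter_upwards [hJ3] with ξ hξ hm u v x y hu hv hx hy c1 c2
  exact (hξ hm u v hu hv c1.left.1 c2.left.1).mono (Set.inter_subset_inter_right _ (Bx_mono (by omega)))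

/-- Machine B -/
theorem machineB {μ : Measure (V → Bool)} (h : Nice μ) {c : ℝ} (hc : Clo μ c) {s : Bool} (hP : HypP μ s)
    (hD : ∀ k : ℕ, Filter.Tendsto (fun n : ℕ => μ.real (DArmE s k n)) Filter.atTop (nhds 0)) (δ : ℝ) (hδ : 0 < δ) (N : ℕ) :
    ∃ m : ℕ, N ≤ m ∧ 1 - δ ≤ μ.real (VX s 0 m 0 (3 * m)) := by
  let ε : ℝ := min δ 1 / 300
  have e0 : 0 < ε := by have : 0 < min δ 1 := lt_min hδ one_pos; positivity
  have e1 : ε ≤ 1 / 300 := by have := min_le_right δ 1; simp only [ε]; linarith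
  have e2 : ε ≤ δ / 300 := by have := min_le_left δ 1; simp only [ε]; linarith
  obtain ⟨k, hk⟩ := choose_ka h hc (ε := ε) e0 (by linarith) hP
  have := ((hD k).eventually (gt_mem_nhds e0)).exists_forall_of_atTop
  obtain ⟨n1, hn1⟩ := this
  obtain ⟨m, hm, hV⟩ := core h (p0 := 1 - 7 * ε) (s := s) (by linarith) (k + n1) (fun n hn ho => by
    obtain ⟨a, h1, h2, h3, h4⟩ := hk n (by omega) ho
    refine ⟨a, h1, h2, le_trans ?_ (full_M2 h (by omega) (by omega) h3 h4)⟩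
    have := hn1 n (by omega)
    linarith) N
  refine ⟨m, hm, le_trans ?_ hV⟩
  have := one_add_mul_le_pow (a := -(7 * ε)) (by linarith) 33
  rw [← sub_eq_add_neg] at this
  push_cast at this
  linarith

def notM (ξ : V → Bool) : V → Bool := fun v => !(ξ v)

theorem notM_meas : Measurable notM := by
  unfold notM
  exact measurable_pi_lambda _ fun v => (measurable_of_countable not).comp (measurable_pi_apply v)

theorem Op_notM (ξ : V → Bool) : Op (notM ξ) = (Op ξ)ᶜ := by
  ext v; simp [Op, notM]

theorem notM_Arm {s : Bool} {k n : ℤ} {ξ : V → Bool} : notM ξ ∈ ArmE (!s) k n ↔ ξ ∈ DArmE s k n := by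
  unfold ArmE DArmE
  simp only [Set.mem_setOf_eq, Op_notM]

theorem four_rect {μ : Measure (V → Bool)} (h : Nice μ) {s : Bool} {δ : ℝ} (hδ : 0 ≤ δ) (m : ℕ) (hm : 1 ≤ m) (hV : δ ≤ μ.real (VX s 0 m 0 (3 * m))) :
    μ.real (DArmE s ((2 * (m / 8) : ℕ) : ℤ) ((2 * (m / 8) + m : ℕ) : ℤ)) ≤ 1 - δ ^ 8 := by
  have := h.prob
  set a : ℕ := 2 * (m / 8) with ha
  let z : V := (((m / 8 : ℕ) : ℤ), -(((m / 8 : ℕ) : ℤ) + (((m + 1) / 2 : ℕ) : ℤ)))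
  let R := VX s (0 + (z.1 + z.1)) (m + (z.1 + z.1)) (0 + (z.2 + z.2)) (3 * m + (z.2 + z.2))
  have hR : LU R := VX_LU _ _ _ _ _
  have hRp : δ ≤ μ.real R := by rw [h.VX_shift]; exact hV
  have h1 := h.fkg_prod Finset.univ (fun i : Bool × Bool × Bool => {ξ | (fun v => ξ (dS i v)) ∈ R}) (fun i _ => hR.comap (dS i))
  simp only [fun i => (h.inv i).real hR.meas, Finset.prod_const] at h1
  have h2 : (Finset.univ : Finset (Bool × Bool × Bool)).card = 8 := by decide
  rw [h2] at h1
  have hsub : DArmE s (a : ℤ) ((a + m : ℕ) : ℤ) ⊆ (⋂ i ∈ (Finset.univ : Finset (Bool × Bool × Bool)), {ξ | (fun v => ξ (dS i v)) ∈ R})ᶜ := by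
    intro ξ hξ hR'
    simp only [Finset.mem_univ, Set.iInter_true, Set.mem_iInter] at hR'
    obtain ⟨i, u, hu, y, -, -, hy⟩ := arm_AT (notM_Arm.2 hξ)
    obtain ⟨b, d, hb, hd, hbd⟩ := hR' i
    rw [mem_Bx] at hu
    obtain ⟨u', v', hu', hv', huv⟩ := trim (fun v : V => v.1) lip_fst (l := a) (r := ((a + m : ℕ) : ℤ)) (by omega) hy (by omega) (by simp)
    have hbd' : Cn (Ad (!!s)) (Op (fun v => ξ (dS i v)) ∩ Rc (0 + (z.1 + z.1)) (m + (z.1 + z.1)) (0 + (z.2 + z.2)) (3 * m + (z.2 + z.2))) b d := by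
      simpa using hbd
    obtain ⟨w, hw1, hw2⟩ := cross_dual huv hbd' (by
      rintro v ⟨⟨-, hv⟩, -⟩
      rw [mem_Bx] at hv
      rw [hb, hd]
      simp only [z]
      omega) (by
      rintro v ⟨-, hv⟩
      rw [hu', hv']
      have := hv.1
      simp only [z] at this
      omega)
    have e1 := hw1.1.1
    have e2 := hw2.1
    simp only [Op, Set.mem_setOf_eq, notM] at e1 e2
    rw [e2] at e1
    exact absurd e1 (by simp)
  have h3 := measureReal_mono (μ := μ) hsub
  rw [probReal_compl_eq_one_sub (LU.iInter Finset.univ _ (fun i _ => hR.comap (dS i))).meas] at h3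
  have h4 := pow_le_pow_left₀ hδ hRp 8
  linarith

theorem machineC {μ : Measure (V → Bool)} (h : Nice μ) {s : Bool} {δ : ℝ} (hδ : 0 < δ)
    (hV : ∀ N : ℕ, ∃ m : ℕ, N ≤ m ∧ δ ≤ μ.real (VX s 0 m 0 (3 * m))) : ¬ HypP (μ.map notM) (!s) := by
  have := h.prob
  intro hP
  obtain ⟨k, hk⟩ := hP (δ ^ 8 / 2) (by positivity)
  obtain ⟨m, hm, hm2⟩ := hV (8 * k + 8)
  have h1 := four_rect h hδ.le m (by omega) hm2
  have h2 := hk (2 * (m / 8) + m) (by omega)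
  have e : (μ.map notM).real (ArmE (!s) k ((2 * (m / 8) + m : ℕ) : ℤ))ᶜ = 1 - μ.real (DArmE s k ((2 * (m / 8) + m : ℕ) : ℤ)) := by
    rw [← probReal_compl_eq_one_sub (DArmE_meas s _ _)]
    simp only [measureReal_def]
    rw [Measure.map_apply notM_meas (ArmE_meas _ _ _).compl]
    congr 2
    ext ξ
    simp only [Set.mem_preimage, Set.mem_compl_iff, notM_Arm]
  rw [e] at h2
  have h3 : μ.real (DArmE s k ((2 * (m / 8) + m : ℕ) : ℤ)) ≤ μ.real (DArmE s ((2 * (m / 8) : ℕ) : ℤ) ((2 * (m / 8) + m : ℕ) : ℤ)) :=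
    measureReal_mono (fun ξ hξ => Arm_mono_k (by omega) hξ)
  have : 0 < δ ^ 8 := by positivity
  linarith



/-! ### FKG for product measures -/

theorem wB_clamp_nonneg (q : ℝ) (b : Bool) : 0 ≤ wB (clampI q) b := by
  have h0 : 0 ≤ clampI q := by simp [clampI]
  have h1 : clampI q ≤ 1 := by simp [clampI]
  cases b <;> simp [wB] <;> linarith

theorem prod_local (q : V → ℝ) (S : Finset V) (A : Set (V → Bool)) (hA : DepOn A S) :
    (Measure.infinitePi (fun i => bernP (q i))).real A =
      ∑ d : S → Bool, (∏ i : S, wB (clampI (q i)) (d i)) * indN S A d := by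
  classical
  have h := local_sum q (fun i : S => (i : V)) Subtype.val_injective (fun d => extN S d ∈ A)
  have e : {ω : V → Bool | extN S (fun i => ω (i : V)) ∈ A} = A := by
    ext ω
    exact hA.iff fun v hv => by simp [extN, Finset.mem_coe.1 hv]
  rw [e] at h
  rw [h]
  unfold indN
  congr!

theorem extN_mono (S : Finset V) : Monotone (extN S) := by
  intro d d' h v
  unfold extN
  split_ifs
  · exact h _
  · exact le_rfl

theorem prod_one (q : V → ℝ) (S : Finset V) : ∑ d : S → Bool, (∏ i : S, wB (clampI (q i)) (d i)) = 1 := by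
  classical
  have := prod_local q S Set.univ (fun _ _ _ _ => trivial)
  simp [indN] at this
  exact this.symm

theorem prod_fkg (q : V → ℝ) (S : Finset V) (A B : Set (V → Bool)) (hA : DepOn A S) (hB : DepOn B S)
    (uA : IsUpperSet A) (uB : IsUpperSet B) :
    (Measure.infinitePi (fun i => bernP (q i))).real A * (Measure.infinitePi (fun i => bernP (q i))).real B ≤
      (Measure.infinitePi (fun i => bernP (q i))).real (A ∩ B) := by
  classical
  rw [prod_local q S A hA, prod_local q S B hB, prod_local q S _ (hA.inter hB)]
  simp only [indN_mul]
  set wt : (S → Bool) → ℝ := fun d => ∏ i : S, wB (clampI (q i)) (d i) with hwt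
  have hmono : ∀ A : Set (V → Bool), IsUpperSet A → Monotone (indN S A) := by
    intro A uA d d' h
    unfold indN
    split_ifs with h1 h2
    · exact le_rfl
    · exact absurd (uA (extN_mono S h) h1) h2
    · norm_num
    · exact le_rfl
  have hnn : ∀ A : Set (V → Bool), 0 ≤ indN S A := by
    intro A d
    simp only [indN, Pi.zero_apply]
    split_ifs <;> norm_num
  have lat : ∀ {α : Type} [LinearOrder α] (w : α → ℝ) (a b : α), w a * w b = w (a ⊓ b) * w (a ⊔ b) := by
    intro α _ w a b
    rcases le_total a b with h | h
    · rw [inf_eq_left.2 h, sup_eq_right.2 h]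
    · rw [inf_eq_right.2 h, sup_eq_left.2 h, mul_comm]
  have := fkg (indN S A) (indN S B) wt (fun d => Finset.prod_nonneg fun i _ => wB_clamp_nonneg _ _) (hnn A) (hnn B)
    (hmono A uA) (hmono B uB) (fun a b => by
      apply le_of_eq
      simp only [hwt]
      rw [← Finset.prod_mul_distrib, ← Finset.prod_mul_distrib]
      exact Finset.prod_congr rfl fun v _ => lat _ _ _)
  rw [show ∑ d, wt d = 1 from prod_one q S, one_mul] at this
  exact this

/-! ### The self-dual bond model as a site model -/

noncomputable def qB (w : V) : ℝ := if w.1 % 2 = 0 ∧ w.2 % 2 = 0 then 1 else if w.1 % 2 = 1 ∧ w.2 % 2 = 1 then 0 else 1 / 2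

noncomputable def muB : Measure (V → Bool) := Measure.infinitePi (fun w => bernP (qB w))

instance : IsProbabilityMeasure muB := by unfold muB; infer_instance

theorem muB_inv (τ : V → V) (hτ : Function.Injective τ) (h : ∀ v, qB (τ v) = qB v) : InvB muB τ := by
  unfold InvB muB
  rw [reindex (fun w => bernP (qB w)) τ hτ]
  simp only [h]

theorem muB_nice : Nice muB where
  prob := inferInstance
  fkg := fun S A B => prod_fkg qB S A B
  tr := fun a => muB_inv _ (add_left_injective _) (fun v => by
    unfold qB
    simp only [Prod.fst_add, Prod.snd_add]
    congr 1
    · apply propext; omega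
    · congr 1; apply propext; omega)
  rf := muB_inv _ (fun a b h => by
      simp only [rfl1, Prod.mk.injEq] at h
      exact Prod.ext (by omega) h.2) (fun v => by
    unfold qB rfl1
    congr 1
    · apply propext; simp only; omega
    · congr 1; apply propext; simp only; omega)
  sw := muB_inv _ Prod.swap_injective (fun v => by
    unfold qB
    simp only [Prod.fst_swap, Prod.snd_swap]
    congr 1
    · apply propext; omega
    · congr 1; apply propext; omega)

theorem muB_site (v : V) (c : Bool) : muB {ξ | ξ v = c} = ENNReal.ofReal (wB (clampI (qB v)) c) := by
  have := infPi_cyl qB {v} (fun _ => c)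
  simpa [muB] using this

theorem muB_clo : Clo muB (1 / 2) := by
  have e : ∀ v : V, {ξ : V → Bool | ξ v = true}ᶜ = {ξ | ξ v = false} := by intro v; ext ξ; simp
  refine ⟨by norm_num, ?_, ?_⟩
  · rw [e, measureReal_def, muB_site]
    have : qB (1, 0) = 1 / 2 := by norm_num [qB]
    rw [this, clampI_eq (by norm_num) (by norm_num)]
    norm_num [wB]
  · rw [e, measureReal_def, muB_site]
    have : qB (1, 1) = 0 := by norm_num [qB]
    rw [this, clampI_eq (by norm_num) (by norm_num)]
    norm_num [wB]

theorem muB_ae : ∀ᵐ ξ ∂muB, (∀ v : V, v.1 % 2 = 0 → v.2 % 2 = 0 → ξ v = true) ∧ (∀ v : V, v.1 % 2 = 1 → v.2 % 2 = 1 → ξ v = false) := by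
  refine Filter.Eventually.and ?_ ?_
  · rw [ae_all_iff]
    intro v
    by_cases hv : v.1 % 2 = 0 ∧ v.2 % 2 = 0
    · have h0 : muB {ξ | ξ v = false} = 0 := by
        rw [muB_site]
        have : qB v = 1 := by simp [qB, hv]
        rw [this, clampI_eq (by norm_num) (by norm_num)]
        norm_num [wB]
      filter_upwards [measure_eq_zero_iff_ae_notMem.1 h0] with ξ hξ _ _
      simpa using hξ
    · exact Filter.Eventually.of_forall fun ξ h1 h2 => absurd ⟨h1, h2⟩ hv
  · rw [ae_all_iff]
    intro v
    by_cases hv : v.1 % 2 = 1 ∧ v.2 % 2 = 1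
    · have h0 : muB {ξ | ξ v = true} = 0 := by
        rw [muB_site]
        have : qB v = 0 := by simp [qB, hv]
        rw [this, clampI_eq (by norm_num) (by norm_num)]
        norm_num [wB]
      filter_upwards [measure_eq_zero_iff_ae_notMem.1 h0] with ξ hξ _ _
      simpa using hξ
    · exact Filter.Eventually.of_forall fun ξ h1 h2 => absurd ⟨h1, h2⟩ hv

theorem muB_J (k : ℕ) : ∃ J : Set (V → Bool), LU J ∧ 0 < muB.real J ∧ ∀ᵐ ξ ∂muB, ξ ∈ J → ∀ u v, u ∈ Bx k → v ∈ Bx k → ξ u = true → ξ v = true →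
      Cn (Ad false) (Op ξ ∩ Bx k) u v := by
  classical
  have hfin : {v : V | v ∈ Bx k ∧ ¬ (v.1 % 2 = 1 ∧ v.2 % 2 = 1)}.Finite := (Bx_finite k).subset fun v hv => hv.1
  set I := hfin.toFinset with hI
  have hmI : ∀ v, v ∈ I ↔ v ∈ Bx k ∧ ¬ (v.1 % 2 = 1 ∧ v.2 % 2 = 1) := fun v => by simp [hI]
  refine ⟨{ξ | ∀ i ∈ I, ξ i = true}, ⟨⟨I, fun ξ ξ' e h i hi => (e i hi).symm.trans (h i hi)⟩, fun ξ ξ' e h i hi => ?_⟩, ?_, ?_⟩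
  · have := e i
    rw [h i hi] at this
    exact top_le_iff.1 this
  · have h := infPi_cyl qB I (fun _ => true)
    rw [measureReal_def, muB, h, ENNReal.toReal_prod]
    refine Finset.prod_pos fun i hi => ?_
    have hi2 := (hmI i).1 hi
    have : 0 < qB i ∧ qB i ≤ 1 := by
      unfold qB; split_ifs with h1 h2
      · norm_num
      · exact absurd h2 hi2.2
      · norm_num
    rw [clampI_eq this.1.le this.2]
    rw [ENNReal.toReal_ofReal (by simp [wB, this.1.le])]
    simp [wB, this.1]
  · filter_upwards [muB_ae] with ξ hξ hJ
    have key : ∀ u, u ∈ Bx k → ξ u = true → Cn (Ad false) (Op ξ ∩ Bx k) u (0, 0) := by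
      intro u hu hu1
      have hnot : ¬ (u.1 % 2 = 1 ∧ u.2 % 2 = 1) := fun h => by
        have := hξ.2 u h.1 h.2; rw [this] at hu1; exact absurd hu1 (by simp)
      have hu' := mem_Bx.1 hu
      have hmem : ∀ v : V, v ∈ Bx k → ¬ (v.1 % 2 = 1 ∧ v.2 % 2 = 1) → v ∈ Op ξ ∩ Bx k :=
        fun v h1 h2 => ⟨hJ v ((hmI v).2 ⟨h1, h2⟩), h1⟩
      by_cases h1 : u.1 % 2 = 0
      · have a1 : Cn (Ad false) (Op ξ ∩ Bx k) (u.1, 0) u := by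
          rcases le_total 0 u.2 with h | h
          · exact Cn.vline u.1 0 u.2 h fun y hy1 hy2 => hmem _ (by rw [mem_Bx]; simp; omega) (by simp; omega)
          · exact (Cn.vline u.1 u.2 0 h fun y hy1 hy2 => hmem _ (by rw [mem_Bx]; simp; omega) (by simp; omega)).symm
        have a2 : Cn (Ad false) (Op ξ ∩ Bx k) (0, 0) (u.1, 0) := by
          rcases le_total 0 u.1 with h | h
          · exact Cn.hline 0 u.1 0 h fun y hy1 hy2 => hmem _ (by rw [mem_Bx]; simp; omega) (by simp)
          · exact (Cn.hline u.1 0 0 h fun y hy1 hy2 => hmem _ (by rw [mem_Bx]; simp; omega) (by simp)).symm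
        exact (a2.trans a1).symm
      · have h2 : u.2 % 2 = 0 := by omega
        have a1 : Cn (Ad false) (Op ξ ∩ Bx k) (0, u.2) u := by
          rcases le_total 0 u.1 with h | h
          · exact Cn.hline 0 u.1 u.2 h fun y hy1 hy2 => hmem _ (by rw [mem_Bx]; simp; omega) (by simp; omega)
          · exact (Cn.hline u.1 0 u.2 h fun y hy1 hy2 => hmem _ (by rw [mem_Bx]; simp; omega) (by simp; omega)).symm
        have a2 : Cn (Ad false) (Op ξ ∩ Bx k) (0, 0) (0, u.2) := by
          rcases le_total 0 u.2 with h | h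
          · exact Cn.vline 0 0 u.2 h fun y hy1 hy2 => hmem _ (by rw [mem_Bx]; simp; omega) (by simp)
          · exact (Cn.vline 0 u.2 0 h fun y hy1 hy2 => hmem _ (by rw [mem_Bx]; simp; omega) (by simp)).symm
        exact (a2.trans a1).symm
    intro u v hu hv h1 h2
    exact (key u hu h1).trans (key v hv h2).symm

theorem muB_zo (s : Bool) : muB (PercE s) = 0 ∨ muB (PercE s) = 1 :=
  zero_one qB (PercE s) (PercE_meas s) fun ω ω' hf h => perc_finite hf h

theorem qB_dual (v : V) : 1 - qB (v + (1, 1)) = qB v := by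
  unfold qB
  simp only [Prod.fst_add, Prod.snd_add]
  split_ifs <;> first | (exfalso; omega) | norm_num

theorem muB_dual : muB.map (fun ξ v => notM ξ (v + (1, 1))) = muB := by
  have m1 : Measurable (fun (ξ : V → Bool) (v : V) => ξ (v + (1, 1))) := by fun_prop
  have e : (fun (ξ : V → Bool) (v : V) => notM ξ (v + (1, 1))) = (fun ξ v => ξ (v + (1, 1))) ∘ notM := rfl
  rw [e, ← Measure.map_map m1 notM_meas]
  have hq : ∀ w, 0 ≤ qB w ∧ qB w ≤ 1 := by intro w; unfold qB; split_ifs <;> norm_num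
  have h1 : muB.map notM = Measure.infinitePi (fun w => bernP (1 - qB w)) := by
    have := Measure.infinitePi_map_pi (fun w => bernP (qB w)) (f := fun _ => Bool.not) (fun _ => measurable_of_countable _)
    unfold muB
    refine Eq.trans this ?_
    simp only [bernP_not _ (hq _).1 (hq _).2]
  rw [h1, reindex (fun w => bernP (1 - qB w)) _ (add_left_injective _)]
  simp only [qB_dual]
  rfl

theorem perc_shift {s : Bool} {ξ : V → Bool} (z : V) (h : (fun v => ξ (v + z)) ∈ PercE s) : ξ ∈ PercE s := by
  obtain ⟨u, hu⟩ := infC_of_perc h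
  refine perc_of_infC (u := u + z) ?_
  have : ((fun w => w + z) '' {w | Cn (Ad s) (Op (fun v => ξ (v + z))) u w}).Infinite :=
    Set.Infinite.image (add_left_injective z).injOn hu
  refine this.mono ?_
  rintro _ ⟨w, hw, rfl⟩
  exact Cn.map (φ := fun w => w + z) hw (fun a b hab => Ad_add z hab) (fun a ha => ha)

theorem perc_false_true {ξ : V → Bool} (h : ξ ∈ PercE false) : ξ ∈ PercE true := by
  obtain ⟨k, hk⟩ := h
  refine ⟨k, fun n hn => ?_⟩
  obtain ⟨u, x, hu, hx, h⟩ := hk n hn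
  exact ⟨u, x, hu, hx, Cn.map (φ := id) h (fun a b hab => Ad_of_sq hab) (fun a ha => ha)⟩

theorem muB_arm (k : ℕ) : Filter.Tendsto (fun n : ℕ => muB.real (ArmE false k n)) Filter.atTop (nhds 0) := by
  rcases dichotomy muB false (muB_zo false) with ⟨h1, h2⟩ | h
  · exfalso
    obtain ⟨δ, hδ, hV⟩ := machineA muB_nice muB_clo h2 muB_J
    refine machineC muB_nice hδ hV ?_
    have : IsProbabilityMeasure (muB.map notM) := Measure.isProbabilityMeasure_map notM_meas.aemeasurable
    have m1 : Measurable (fun (ξ : V → Bool) v => notM ξ (v + (1, 1))) :=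
      (measurable_pi_lambda _ fun v => measurable_pi_apply (v + (1, 1) : V)).comp notM_meas
    have h3 : (muB.map notM) (PercE true) = 1 := by
      refine le_antisymm prob_le_one ?_
      rw [Measure.map_apply notM_meas (PercE_meas _)]
      calc (1 : ENNReal) = muB (PercE false) := h1.symm
        _ = muB ((fun (ξ : V → Bool) v => notM ξ (v + (1, 1))) ⁻¹' (PercE false)) := by
          rw [← Measure.map_apply m1 (PercE_meas _), muB_dual]
        _ ≤ muB (notM ⁻¹' PercE true) := measure_mono fun ξ hξ => perc_false_true (perc_shift (ξ := notM ξ) (1, 1) hξ)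
    rcases dichotomy (muB.map notM) true (Or.inr h3) with h | h
    · exact h.2
    · rw [h3] at h; exact absurd h.1 one_ne_zero
  · exact h.2 k

/-! ### Transfer to bond percolation at one half -/

def eA (e : V → Bool) (a b : V) : Prop := etaE e a b = true

theorem eA_iff (e : V → Bool) (a b : V) : eA e a b ↔ SqAdj a b ∧ e (a + b) = true := by
  simp [eA, etaE, boolOf]

/-- connection from the origin to the ring inside the box -/
def BArm (n : ℤ) : Set (V → Bool) := {e | ∃ w ∈ Rg n, Cn (eA e) (Bx n) (0, 0) w}

noncomputable def zetaM (e : V → Bool) : V → Bool := fun w =>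
  if w.1 % 2 = 0 ∧ w.2 % 2 = 0 then true else if w.1 % 2 = 1 ∧ w.2 % 2 = 1 then false else e w

theorem bernP_const (q : ℝ) (c : Bool) : (bernP q).map (fun _ => c) = bernP (if c then 1 else 0) := by
  refine Measure.ext_of_singleton fun b => ?_
  rw [Measure.map_apply (measurable_of_countable _) (MeasurableSet.singleton _)]
  have h1 : bernP q Set.univ = 1 := measure_univ
  rw [bernP.eq_1 (if c then 1 else 0), bern_single]
  by_cases h : c = b
  · have e : (fun _ : Bool => c) ⁻¹' {b} = Set.univ := by ext; simp [h]
    rw [e, h1, h]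
    cases b <;> simp [wB, clampI]
  · have e : (fun _ : Bool => c) ⁻¹' {b} = ∅ := by ext; simp [h]
    rw [e]
    cases b <;> cases c <;> simp_all [wB, clampI]

theorem zetaM_law : (Pq (1 / 2)).map zetaM = muB := by
  let f : V → Bool → Bool := fun w c => if w.1 % 2 = 0 ∧ w.2 % 2 = 0 then true else if w.1 % 2 = 1 ∧ w.2 % 2 = 1 then false else c
  have := Measure.infinitePi_map_pi (fun w : V => bernP (1 / 2)) (f := f) (fun _ => measurable_of_countable _)
  refine Eq.trans this ?_
  unfold muB
  congr 1
  ext1 w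
  simp only [f, qB]
  split_ifs
  · simpa using bernP_const (1 / 2) true
  · simpa using bernP_const (1 / 2) false
  · exact Measure.map_id

theorem zetaM_meas : Measurable zetaM := by
  refine measurable_pi_lambda _ fun w => ?_
  unfold zetaM
  split_ifs
  · exact measurable_const
  · exact measurable_const
  · exact measurable_pi_apply w

theorem BArm_zeta {n : ℤ} (hn : 0 ≤ n) {e : V → Bool} (h : e ∈ BArm n) : zetaM e ∈ ArmE false 0 (2 * n) := by
  obtain ⟨w, hw, h⟩ := h
  have hb0 : ∀ a : V, a ∈ Bx n → a + a ∈ Op (zetaM e) ∩ Bx (2 * n) := by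
    intro a ha
    refine ⟨?_, ?_⟩
    · simp only [Op, Set.mem_setOf_eq, zetaM, Prod.fst_add, Prod.snd_add]
      rw [if_pos (by omega)]
    · rw [mem_Bx] at *; simp only [Prod.fst_add, Prod.snd_add]; omega
  have key : w ∈ Bx n ∧ Cn (Ad false) (Op (zetaM e) ∩ Bx (2 * n)) ((0, 0) + (0, 0)) (w + w) := by
    refine Cn.induct (P := fun w => w ∈ Bx n ∧ Cn (Ad false) (Op (zetaM e) ∩ Bx (2 * n)) ((0, 0) + (0, 0)) (w + w)) h ?_ ?_
    · have : ((0, 0) : V) ∈ Bx n := by rw [mem_Bx]; simp; omega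
      exact ⟨this, Cn.refl (hb0 _ this)⟩
    · rintro a b - hab hb ⟨ha, ih⟩
      refine ⟨hb, ?_⟩
      obtain ⟨h1, h2⟩ := (eA_iff e a b).1 hab
      have h3 := (sqAdj_iff _ _).1 h1
      have hmid : a + b ∈ Op (zetaM e) ∩ Bx (2 * n) := by
        refine ⟨?_, ?_⟩
        · simp only [Op, Set.mem_setOf_eq, zetaM, Prod.fst_add, Prod.snd_add]
          rw [if_neg (by omega), if_neg (by omega)]
          exact h2
        · rw [mem_Bx] at *; simp only [Prod.fst_add, Prod.snd_add]; omega
      have s1 : SqAdj (a + a) (a + b) := (sqAdj_iff _ _).2 (by simp only [Prod.fst_add, Prod.snd_add]; omega)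
      have s2 : SqAdj (a + b) (b + b) := (sqAdj_iff _ _).2 (by simp only [Prod.fst_add, Prod.snd_add]; omega)
      exact (ih.step s1 hmid).step s2 (hb0 b hb)
  refine ⟨(0, 0), w + w, by rw [mem_Bx]; simp, ?_, by simpa using key.2⟩
  rw [mem_Rg] at *
  simp only [Prod.fst_add, Prod.snd_add]
  omega

theorem BArm_half : Filter.Tendsto (fun n : ℕ => (Pq (1 / 2)).real (BArm n)) Filter.atTop (nhds 0) := by
  have h := (muB_arm 0).comp (Filter.tendsto_atTop_mono (fun n : ℕ => (by omega : n ≤ 2 * n)) Filter.tendsto_id)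
  refine squeeze_zero (fun _ => measureReal_nonneg) (fun n => ?_) h
  simp only [Function.comp]
  rw [← zetaM_law, measureReal_def, measureReal_def, Measure.map_apply zetaM_meas (ArmE_meas _ _ _)]
  refine ENNReal.toReal_mono (measure_ne_top _ _) (measure_mono fun e he => ?_)
  have := BArm_zeta (n := n) (by omega) he
  simpa using this



/-! ### Russo's formula -/

noncomputable def polyF (S : Finset V) (A : Set (V → Bool)) (p : ℝ) : ℝ :=
  ∑ d : S → Bool, (∏ i : S, wB p (d i)) * indN S A d

theorem polyF_eq {S : Finset V} {A : Set (V → Bool)} (hA : DepOn A S) {p : ℝ} (h0 : 0 ≤ p) (h1 : p ≤ 1) :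
    (Pq p).real A = polyF S A p := by
  have := prod_local (fun _ => p) S A hA
  rw [clampI_eq h0 h1] at this
  exact this

def sgB (c : Bool) : ℝ := if c = true then 1 else -1

theorem wB_deriv (c : Bool) (p : ℝ) : HasDerivAt (fun p => wB p c) (sgB c) p := by
  cases c
  · simpa [wB, sgB] using (hasDerivAt_id p).const_sub 1
  · simpa [wB, sgB] using hasDerivAt_id' p

open Classical in
theorem polyF_deriv (S : Finset V) (A : Set (V → Bool)) (p : ℝ) :
    HasDerivAt (polyF S A) (∑ i : S, ∑ d : S → Bool, (∏ j ∈ Finset.univ.erase i, wB p (d j)) * sgB (d i) * indN S A d) p := by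
  have h : HasDerivAt (polyF S A) (∑ d : S → Bool, (∑ i : S, (∏ j ∈ Finset.univ.erase i, wB p (d j)) • sgB (d i)) * indN S A d) p := by
    unfold polyF
    have := HasDerivAt.fun_sum (u := (Finset.univ : Finset (S → Bool))) (x := p)
      (A := fun d p => (∏ i : S, wB p (d i)) * indN S A d)
      (A' := fun d => (∑ i : S, (∏ j ∈ Finset.univ.erase i, wB p (d j)) • sgB (d i)) * indN S A d)
      (fun d _ => by
        refine HasDerivAt.mul_const ?_ _
        exact HasDerivAt.fun_finset_prod (fun i _ => wB_deriv (d i) p))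
    convert this
  convert h using 1
  rw [Finset.sum_comm]
  refine Finset.sum_congr rfl fun d _ => ?_
  rw [Finset.sum_mul]
  rfl

open Classical in
def Piv (A : Set (V → Bool)) (i : V) : Set (V → Bool) := {e | e i = false ∧ e ∉ A ∧ Function.update e i true ∈ A}

theorem Piv_dep {S : Set V} {A : Set (V → Bool)} (hA : DepOn A S) {i : V} (hi : i ∈ S) : DepOn (Piv A i) S := by
  classical
  rintro e e' h ⟨h1, h2, h3⟩
  refine ⟨(h i hi).symm.trans h1, fun h4 => h2 ((hA.iff h).2 h4), ?_⟩
  refine (hA.iff fun v hv => ?_).1 h3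
  by_cases hvi : v = i
  · subst hvi; simp
  · simp [hvi, h v hv]

open Classical in
theorem extN_update (S : Finset V) (d : S → Bool) (i : S) (c : Bool) :
    extN S (Function.update d i c) = Function.update (extN S d) (i : V) c := by
  funext v
  unfold extN
  by_cases hv : v ∈ S
  · by_cases hvi : (⟨v, hv⟩ : S) = i
    · subst hvi; simp [hv]
    · have : v ≠ i := fun h => hvi (Subtype.ext h)
      simp [hv, hvi, this]
  · have : v ≠ i := fun h => hv (h ▸ i.2)
    simp [hv, this]

open Classical in
theorem russo_term {S : Finset V} {A : Set (V → Bool)} (uA : IsUpperSet A) (p : ℝ) (hp : p < 1) (i : S) :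
    ∑ d : S → Bool, (∏ j ∈ Finset.univ.erase i, wB p (d j)) * sgB (d i) * indN S A d = polyF S (Piv A i) p / (1 - p) := by
  have hp' : (1 - p) ≠ 0 := by linarith
  rw [eq_div_iff hp', polyF]
  set g : (S → Bool) → ℝ := fun d => ∏ j ∈ Finset.univ.erase i, wB p (d j) with hg
  have hgu : ∀ d c, g (Function.update d i c) = g d := by
    intro d c
    refine Finset.prod_congr rfl fun j hj => ?_
    rw [Function.update_of_ne (Finset.ne_of_mem_erase hj)]
  set h : (S → Bool) → ℝ := fun d => g d * sgB (d i) * indN S A d with hh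
  have e1 : ∑ d, h d = ∑ d ∈ Finset.univ.filter (fun d : S → Bool => d i = false), (h d + h (Function.update d i true)) := by
    rw [← Finset.sum_filter_add_sum_filter_not Finset.univ (fun d : S → Bool => d i = false) h, Finset.sum_add_distrib]
    congr 1
    refine Finset.sum_nbij' (fun d => Function.update d i false) (fun d => Function.update d i true) ?_ ?_ ?_ ?_ ?_
    · intro d hd; simp
    · intro d hd; simp
    · intro d hd
      simp only [Finset.mem_filter, Finset.mem_univ, true_and, Bool.not_eq_false] at hd
      simp [← hd]
    · intro d hd
      simp only [Finset.mem_filter, Finset.mem_univ, true_and] at hd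
      simp [← hd]
    · intro d hd
      simp only [Finset.mem_filter, Finset.mem_univ, true_and, Bool.not_eq_false] at hd
      simp [← hd]
  change (∑ d, h d) * (1 - p) = _
  rw [e1, Finset.sum_mul, Finset.sum_filter]
  refine Finset.sum_congr rfl fun d _ => ?_
  have hw : ∏ j : S, wB p (d j) = wB p (d i) * g d := (Finset.mul_prod_erase _ _ (Finset.mem_univ i)).symm
  rw [hw]
  unfold indN
  simp only [hh, hgu, indN, Function.update_self, extN_update, Piv, Set.mem_setOf_eq]
  have hei : extN S d i = d i := by simp [extN]
  rw [hei]
  have up : extN S d ∈ A → Function.update (extN S d) (i : V) true ∈ A := fun h => uA (fun v => by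
    by_cases hv : v = i
    · subst hv; simp
    · simp [hv]) h
  by_cases hd : d i = false <;> by_cases h1 : extN S d ∈ A <;> by_cases h2 : Function.update (extN S d) (i : V) true ∈ A <;>
    simp_all [sgB, wB] <;> ring


theorem russo {S : Finset V} {A : Set (V → Bool)} (uA : IsUpperSet A) {p : ℝ} (hp : p < 1) :
    HasDerivAt (polyF S A) (∑ i ∈ S, polyF S (Piv A i) p / (1 - p)) p := by
  classical
  have h := polyF_deriv S A p
  have e : (∑ i ∈ S, polyF S (Piv A i) p / (1 - p)) =
      ∑ i : S, ∑ d : S → Bool, (∏ j ∈ Finset.univ.erase i, wB p (d j)) * sgB (d i) * indN S A d := by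
    rw [← Finset.sum_coe_sort S (fun i => polyF S (Piv A i) p / (1 - p))]
    refine Finset.sum_congr rfl fun i _ => ?_
    rw [← russo_term uA p hp i]
  rw [e]
  convert h

theorem polyF_nonneg {S : Finset V} {A : Set (V → Bool)} {p : ℝ} (h0 : 0 ≤ p) (h1 : p ≤ 1) : 0 ≤ polyF S A p := by
  refine Finset.sum_nonneg fun d _ => mul_nonneg (Finset.prod_nonneg fun i _ => ?_) ?_
  · unfold wB; split_ifs <;> linarith
  · unfold indN; split_ifs <;> norm_num

theorem polyF_diff {S : Finset V} {A : Set (V → Bool)} : Differentiable ℝ (polyF S A) :=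
  fun p => (polyF_deriv S A p).differentiableAt

theorem Pq_mono {S : Finset V} {A : Set (V → Bool)} (hA : DepOn A S) (uA : IsUpperSet A) {p q : ℝ} (h0 : 0 ≤ p) (hpq : p ≤ q) (h1 : q ≤ 1) :
    (Pq p).real A ≤ (Pq q).real A := by
  rw [polyF_eq hA h0 (hpq.trans h1), polyF_eq hA (h0.trans hpq) h1]
  refine monotoneOn_of_deriv_nonneg (convex_Icc 0 1) polyF_diff.continuous.continuousOn polyF_diff.differentiableOn ?_
    ⟨h0, hpq.trans h1⟩ ⟨h0.trans hpq, h1⟩ hpq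
  intro x hx
  rw [interior_Icc] at hx
  rw [(russo uA hx.2).deriv]
  refine Finset.sum_nonneg fun i _ => div_nonneg (polyF_nonneg hx.1.le hx.2.le) (by linarith [hx.2])

/-! ### Edges and connection events -/

theorem adj_sum_eq {a b c d : V} (h1 : SqAdj a b) (h2 : SqAdj c d) (h : a + b = c + d) : (a = c ∧ b = d) ∨ (a = d ∧ b = c) := by
  have h3 := (sqAdj_iff _ _).1 h1
  have h4 := (sqAdj_iff _ _).1 h2
  have e1 : a.1 + b.1 = c.1 + d.1 := congrArg Prod.fst h
  have e2 : a.2 + b.2 = c.2 + d.2 := congrArg Prod.snd h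
  simp only [Prod.ext_iff]
  omega

/-- edges with both ends in `S` -/
def IE (S : Set V) : Set V := {w | ∃ a b, a ∈ S ∧ b ∈ S ∧ SqAdj a b ∧ w = a + b}

theorem IE_finite {S : Set V} (h : S.Finite) : (IE S).Finite := by
  refine (h.image2 (fun a b => a + b) h).subset ?_
  rintro w ⟨a, b, ha, hb, -, rfl⟩
  exact ⟨a, ha, b, hb, rfl⟩

theorem IE_mono {S T : Set V} (h : S ⊆ T) : IE S ⊆ IE T := by
  rintro w ⟨a, b, ha, hb, h1, h2⟩
  exact ⟨a, b, h ha, h hb, h1, h2⟩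

theorem Cn_eA_congr {e e' : V → Bool} {S : Set V} {u v : V} (h : ∀ w ∈ IE S, e w = e' w) (hc : Cn (eA e) S u v) : Cn (eA e') S u v := by
  refine Cn.induct (P := fun v => Cn (eA e') S u v) hc (Cn.refl hc.left) ?_
  intro a b h1 h2 h3 h4
  obtain ⟨h5, h6⟩ := (eA_iff _ _ _).1 h2
  exact h4.step ((eA_iff _ _ _).2 ⟨h5, (h _ ⟨a, b, h1.right, h3, h5, rfl⟩).symm.trans h6⟩) h3

theorem eA_symm {e : V → Bool} {a b : V} (h : eA e a b) : eA e b a := by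
  rw [eA_iff] at *
  exact ⟨sqAdj_symm h.1, by rw [add_comm]; exact h.2⟩

theorem Cn_eA_symm {e : V → Bool} {S : Set V} {u v : V} (hc : Cn (eA e) S u v) : Cn (eA e) S v u := by
  refine Cn.induct (P := fun v => Cn (eA e) S v u) hc (Cn.refl hc.left) ?_
  intro a b h1 h2 h3 h4
  exact ((Cn.refl h3).step (eA_symm h2) h1.right).trans h4

theorem eA_mono {e e' : V → Bool} (h : e ≤ e') {a b : V} (hab : eA e a b) : eA e' a b := by
  rw [eA_iff] at *
  refine ⟨hab.1, ?_⟩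
  have := h (a + b)
  rw [hab.2] at this
  exact top_le_iff.1 this

theorem Cn_eA_mono {e e' : V → Bool} (h : e ≤ e') {S : Set V} {u v : V} (hc : Cn (eA e) S u v) : Cn (eA e') S u v :=
  Cn.map (φ := id) hc (fun a b hab => eA_mono h hab) (fun a ha => ha)

def CnE (S : Set V) (u v : V) : Set (V → Bool) := {e | Cn (eA e) S u v}

theorem CnE_dep (S : Set V) (u v : V) : DepOn (CnE S u v) (IE S) := fun e e' h hc => Cn_eA_congr h hc

theorem CnE_meas {S : Set V} (hS : S.Finite) (u v : V) : MeasurableSet (CnE S u v) := (CnE_dep S u v).meas (IE_finite hS)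

theorem BArm_dep (n : ℤ) : DepOn (BArm n) (IE (Bx n)) := by
  rintro e e' h ⟨w, hw, hc⟩
  exact ⟨w, hw, Cn_eA_congr h hc⟩

theorem BArm_up (n : ℤ) : IsUpperSet (BArm n) := by
  rintro e e' h ⟨w, hw, hc⟩
  exact ⟨w, hw, Cn_eA_mono h hc⟩

theorem BArm_meas (n : ℤ) : MeasurableSet (BArm n) := (BArm_dep n).meas (IE_finite (Bx_finite n))

theorem Pq_indep {A B : Set (V → Bool)} {S T : Set V} (p : ℝ) (hA : DepOn A S) (hB : DepOn B T)
    (hST : Disjoint S T) (mA : MeasurableSet A) (mB : MeasurableSet B) :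
    (Pq p).real (A ∩ B) = (Pq p).real A * (Pq p).real B := by
  have := indep_dep (fun _ => p) hA hB hST mA mB
  rw [measureReal_def, measureReal_def, measureReal_def, ← ENNReal.toReal_mul]
  exact congrArg ENNReal.toReal this

instance (p : ℝ) : IsProbabilityMeasure (Pq p) := by unfold Pq; infer_instance

/-! ### The quantity phi -/

def nbs : Finset V := {(1, 0), (-1, 0), (0, 1), (0, -1)}

theorem nbs_adj (x d : V) : SqAdj x (x + d) ↔ d ∈ nbs := by
  rw [sqAdj_iff]
  obtain ⟨a, b⟩ := d
  simp only [nbs, Finset.mem_insert, Finset.mem_singleton, Prod.fst_add, Prod.snd_add, Prod.mk.injEq]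
  omega

def bd (S : Finset V) : Finset (V × V) := (S ×ˢ nbs).filter (fun z => z.1 + z.2 ∉ S)

theorem mem_bd {S : Finset V} {z : V × V} : z ∈ bd S ↔ z.1 ∈ S ∧ SqAdj z.1 (z.1 + z.2) ∧ z.1 + z.2 ∉ S := by
  rw [nbs_adj]
  simp [bd, and_assoc]

noncomputable def phi (p : ℝ) (S : Finset V) : ℝ := p * ∑ z ∈ bd S, (Pq p).real (CnE S (0, 0) z.1)

/-- vertices of the box not connected to the ring -/
def Sc (n : ℤ) (e : V → Bool) : Set V := {x | x ∈ Bx n ∧ ∀ w ∈ Rg n, ¬ Cn (eA e) (Bx n) x w}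

theorem Sc_edge {n : ℤ} {e : V → Bool} {a b : V} (ha : a ∈ Sc n e) (hb : b ∈ Bx n) (hb' : b ∉ Sc n e) : ¬ eA e a b := by
  intro h
  apply hb'
  refine ⟨hb, fun w hw hc => ha.2 w hw ?_⟩
  exact ((Cn.refl ha.1).step h hb).trans hc

theorem Rg_sub_Bx {n : ℤ} {x : V} (h : x ∈ Rg n) : x ∈ Bx n := by
  rw [mem_Rg] at h; rw [mem_Bx]; omega

theorem Sc_ring {n : ℤ} {e : V → Bool} {a : V} (ha : a ∈ Sc n e) : a ∉ Rg n := fun h =>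
  ha.2 a h (Cn.refl (Rg_sub_Bx h))

theorem Sc_nb {n : ℤ} {e : V → Bool} {a b : V} (ha : a ∈ Sc n e) (h : SqAdj a b) : b ∈ Bx n := by
  by_contra hb
  exact Sc_ring ha (exit_ring (s := false) ha.1 hb h)

theorem Sc_conn {n : ℤ} {e : V → Bool} {x w : V} (hw : w ∈ Rg n) (hc : Cn (eA e) (Bx n) x w) : Cn (eA e) (Bx n \ Sc n e) w x := by
  have h := Cn_eA_symm hc
  have hwS : w ∉ Sc n e := fun h => Sc_ring h hw
  refine Cn.induct (P := fun x => Cn (eA e) (Bx n \ Sc n e) w x) h (Cn.refl ⟨Rg_sub_Bx hw, hwS⟩) ?_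
  intro a b h1 h2 h3 h4
  refine h4.step h2 ⟨h3, fun hb => ?_⟩
  exact Sc_edge hb h1.right h4.right.2 (eA_symm h2)

theorem Sc_dep (n : ℤ) (S : Set V) : DepOn {e | Sc n e = S} (IE (Bx n) \ IE S) := by
  rintro e e' h (rfl : Sc n e = S)
  have key : ∀ x, x ∉ Sc n e → x ∈ Bx n → ∃ w ∈ Rg n, Cn (eA e') (Bx n) x w := by
    intro x hx hxn
    have : ∃ w ∈ Rg n, Cn (eA e) (Bx n) x w := by
      by_contra hcon
      push Not at hcon
      exact hx ⟨hxn, hcon⟩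
    obtain ⟨w, hw, hc⟩ := this
    refine ⟨w, hw, ?_⟩
    have h1 := Sc_conn hw hc
    refine (Cn_eA_symm (Cn_eA_congr (e' := e') ?_ h1)).mono Set.diff_subset
    rintro _ ⟨a, b, ha, hb, hab, rfl⟩
    refine h _ ⟨⟨a, b, ha.1, hb.1, hab, rfl⟩, ?_⟩
    rintro ⟨c, d, hc, hd, hcd, he⟩
    rcases adj_sum_eq hab hcd he with ⟨rfl, rfl⟩ | ⟨rfl, rfl⟩
    · exact ha.2 hc
    · exact ha.2 hd
  ext x
  constructor
  · intro hx
    by_contra hxS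
    obtain ⟨w, hw, hc⟩ := key x hxS hx.1
    exact hx.2 w hw hc
  · intro hx
    refine ⟨hx.1, fun w hw hc => ?_⟩
    have hwS : w ∉ Sc n e := fun h => Sc_ring h hw
    obtain ⟨a, b, h1, h2, h3, h4⟩ := Cn.first_exit hc hx hwS
    have ha := h1.right.2
    obtain ⟨h5, h6⟩ := (eA_iff _ _ _).1 h2
    refine Sc_edge ha h3 h4 ((eA_iff _ _ _).2 ⟨h5, ?_⟩)
    rw [h _ ⟨⟨a, b, ha.1, h3, h5, rfl⟩, ?_⟩]
    · exact h6
    rintro ⟨c, d, hc, hd, hcd, he⟩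
    rcases adj_sum_eq h5 hcd he with ⟨rfl, rfl⟩ | ⟨rfl, rfl⟩
    · exact h4 hd
    · exact h4 hc

theorem BArm_Sc {n : ℤ} (hn : 0 ≤ n) {e : V → Bool} : e ∉ BArm n ↔ ((0, 0) : V) ∈ Sc n e := by
  have h0 : ((0, 0) : V) ∈ Bx n := by rw [mem_Bx]; simp; omega
  constructor
  · intro h
    exact ⟨h0, fun w hw hc => h ⟨w, hw, hc⟩⟩
  · rintro h ⟨w, hw, hc⟩
    exact h.2 w hw hc

theorem piv_of_Sc {n : ℤ} (hn : 0 ≤ n) {e : V → Bool} {S : Finset V} (hS : Sc n e = S) (h0 : ((0, 0) : V) ∈ S) {z : V × V}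
    (hz : z ∈ bd S) (hc : Cn (eA e) S (0, 0) z.1) : e ∈ Piv (BArm n) (z.1 + (z.1 + z.2)) := by
  classical
  obtain ⟨h1, h2, h3⟩ := mem_bd.1 hz
  set y := z.1 + z.2 with hy
  have h1' : z.1 ∈ Sc n e := by rw [hS]; exact h1
  have h3' : y ∉ Sc n e := by rw [hS]; exact h3
  have hyB := Sc_nb h1' h2
  have hcl := Sc_edge h1' hyB h3'
  refine ⟨?_, ?_, ?_⟩
  · rw [eA_iff] at hcl
    push Not at hcl
    simpa using hcl h2
  · rw [BArm_Sc hn, hS]; exact h0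
  · have : ∃ w ∈ Rg n, Cn (eA e) (Bx n) y w := by
      by_contra hcon
      push Not at hcon
      exact h3' ⟨hyB, hcon⟩
    obtain ⟨w, hw, hcw⟩ := this
    have hle : e ≤ Function.update e (z.1 + y) true := by
      intro v
      by_cases hv : v = z.1 + y
      · subst hv; simp
      · simp [hv]
    refine ⟨w, hw, ?_⟩
    have c1 : Cn (eA e) (Bx n) (0, 0) z.1 := hc.mono fun v hv => by
      have : v ∈ Sc n e := by rw [hS]; exact hv
      exact this.1
    refine ((Cn_eA_mono hle c1).step ?_ hyB).trans (Cn_eA_mono hle hcw)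
    rw [eA_iff]
    exact ⟨h2, by simp⟩



theorem Pq_sum_le (p : ℝ) {κ : Type} (I : Finset κ) (A : κ → Set (V → Bool)) (B : Set (V → Bool))
    (hm : ∀ i ∈ I, MeasurableSet (A i)) (hd : ∀ i ∈ I, ∀ j ∈ I, i ≠ j → Disjoint (A i) (A j)) (hs : ∀ i ∈ I, A i ⊆ B) :
    ∑ i ∈ I, (Pq p).real (A i) ≤ (Pq p).real B := by
  rw [← measureReal_biUnion_finset (fun i hi j hj hij => hd i hi j hj hij) hm]
  exact measureReal_mono (by simpa using hs)

theorem dct_step {n : ℤ} (hn : 0 ≤ n) {p : ℝ} (h0 : 0 < p) (h1 : p < 1)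
    (hphi : ∀ S : Finset V, ((0, 0) : V) ∈ S → 1 ≤ phi p S) (S0 : Finset V) (hS0 : (S0 : Set V) = IE (Bx n)) :
    (1 - (Pq p).real (BArm n)) / p ≤ ∑ i ∈ S0, (Pq p).real (Piv (BArm n) i) := by
  classical
  set B := (Bx_finite n).toFinset with hB
  set I := B.powerset.filter (fun S => ((0, 0) : V) ∈ S) with hI
  have hdep : ∀ i ∈ S0, DepOn (Piv (BArm n) i) (S0 : Set V) := fun i hi => by
    refine Piv_dep ?_ hi
    rw [hS0]; exact BArm_dep n
  have hScm : ∀ S : Set V, MeasurableSet {e | Sc n e = S} := fun S =>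
    (Sc_dep n S).meas ((IE_finite (Bx_finite n)).subset Set.diff_subset)
  have hpivm : ∀ i ∈ S0, MeasurableSet (Piv (BArm n) i) := fun i hi => (hdep i hi).meas S0.finite_toSet
  have hb : ∀ i ∈ S0, ∑ S ∈ I, (Pq p).real (Piv (BArm n) i ∩ {e | Sc n e = (S : Set V)}) ≤ (Pq p).real (Piv (BArm n) i) := by
    intro i hi
    refine Pq_sum_le p I _ _ (fun S _ => (hpivm i hi).inter (hScm _)) ?_ (fun S _ => Set.inter_subset_left)
    intro S _ T _ hST
    rw [Set.disjoint_left]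
    rintro e ⟨-, h1⟩ ⟨-, h2⟩
    simp only [Set.mem_setOf_eq] at h1 h2
    exact hST (Finset.coe_injective (h1.symm.trans h2))
  have hc : ∀ S ∈ I, (Pq p).real {e | Sc n e = (S : Set V)} / p ≤ ∑ i ∈ S0, (Pq p).real (Piv (BArm n) i ∩ {e | Sc n e = (S : Set V)}) := by
    intro S hS
    have hS0' : ((0, 0) : V) ∈ S := (Finset.mem_filter.1 hS).2
    by_cases hemp : ({e | Sc n e = (S : Set V)} : Set (V → Bool)) = ∅
    · rw [hemp]
      simp
    obtain ⟨e0, he0⟩ := Set.nonempty_iff_ne_empty.2 hemp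
    have hinj : Set.InjOn (fun z : V × V => z.1 + (z.1 + z.2)) (bd S : Set (V × V)) := by
      intro z hz z' hz' h
      obtain ⟨a1, a2, a3⟩ := mem_bd.1 hz
      obtain ⟨b1, b2, b3⟩ := mem_bd.1 hz'
      rcases adj_sum_eq a2 b2 h with ⟨c1, c2⟩ | ⟨c1, c2⟩
      · refine Prod.ext c1 ?_
        rw [c1] at c2; exact add_left_cancel c2
      · rw [c1] at a1; exact absurd a1 b3
    have himg : (bd S).image (fun z : V × V => z.1 + (z.1 + z.2)) ⊆ S0 := by
      intro w hw
      obtain ⟨z, hz, rfl⟩ := Finset.mem_image.1 hw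
      obtain ⟨a1, a2, a3⟩ := mem_bd.1 hz
      have h1 : z.1 ∈ Sc n e0 := by
        have : Sc n e0 = S := he0
        rw [this]; exact a1
      have : z.1 + (z.1 + z.2) ∈ (S0 : Set V) := by
        rw [hS0]; exact ⟨z.1, z.1 + z.2, h1.1, Sc_nb h1 a2, a2, rfl⟩
      exact this
    calc (Pq p).real {e | Sc n e = (S : Set V)} / p
        ≤ (Pq p).real {e | Sc n e = (S : Set V)} * ∑ z ∈ bd S, (Pq p).real (CnE S (0, 0) z.1) := by
          have := hphi S hS0'
          unfold phi at this
          rw [div_le_iff₀ h0]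
          have h2 : 0 ≤ (Pq p).real {e | Sc n e = (S : Set V)} := measureReal_nonneg
          nlinarith
      _ = ∑ z ∈ bd S, (Pq p).real ({e | Sc n e = (S : Set V)} ∩ CnE S (0, 0) z.1) := by
          rw [Finset.mul_sum]
          refine Finset.sum_congr rfl fun z _ => ?_
          rw [Pq_indep p (Sc_dep n S) (CnE_dep S _ _) Set.disjoint_sdiff_left (hScm _) (CnE_meas S.finite_toSet _ _)]
      _ ≤ ∑ z ∈ bd S, (Pq p).real (Piv (BArm n) (z.1 + (z.1 + z.2)) ∩ {e | Sc n e = (S : Set V)}) := by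
          refine Finset.sum_le_sum fun z hz => measureReal_mono ?_
          rintro e ⟨h1, h2⟩
          exact ⟨piv_of_Sc hn h1 hS0' hz h2, h1⟩
      _ = ∑ i ∈ (bd S).image (fun z : V × V => z.1 + (z.1 + z.2)), (Pq p).real (Piv (BArm n) i ∩ {e | Sc n e = (S : Set V)}) := by
          rw [Finset.sum_image hinj]
      _ ≤ _ := Finset.sum_le_sum_of_subset_of_nonneg himg fun _ _ _ => measureReal_nonneg
  have hd : 1 - (Pq p).real (BArm n) ≤ ∑ S ∈ I, (Pq p).real {e | Sc n e = (S : Set V)} := by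
    rw [← probReal_compl_eq_one_sub (BArm_meas n)]
    refine le_trans (measureReal_mono ?_ (measure_ne_top _ _)) (measureReal_biUnion_finset_le I _)
    intro e he
    have he' := (BArm_Sc hn).1 he
    have hfin : (Sc n e).Finite := (Bx_finite n).subset fun x hx => hx.1
    simp only [Set.mem_iUnion]
    refine ⟨hfin.toFinset, ?_, by simp⟩
    simp only [hI, hB, Finset.mem_filter, Finset.mem_powerset, Set.Finite.mem_toFinset]
    refine ⟨fun x hx => ?_, he'⟩
    simp only [Set.Finite.mem_toFinset] at hx ⊢
    exact hx.1
  calc (1 - (Pq p).real (BArm n)) / p ≤ (∑ S ∈ I, (Pq p).real {e | Sc n e = (S : Set V)}) / p := by gcongr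
    _ = ∑ S ∈ I, (Pq p).real {e | Sc n e = (S : Set V)} / p := Finset.sum_div _ _ _
    _ ≤ ∑ S ∈ I, ∑ i ∈ S0, (Pq p).real (Piv (BArm n) i ∩ {e | Sc n e = (S : Set V)}) := Finset.sum_le_sum hc
    _ = ∑ i ∈ S0, ∑ S ∈ I, (Pq p).real (Piv (BArm n) i ∩ {e | Sc n e = (S : Set V)}) := Finset.sum_comm
    _ ≤ _ := Finset.sum_le_sum hb

theorem dct {p0 : ℝ} (h0 : 0 < p0) (h1 : p0 < 1 / 2) :
    ∃ p1, p0 ≤ p1 ∧ p1 ≤ 1 / 2 ∧ ∃ S : Finset V, ((0, 0) : V) ∈ S ∧ phi p1 S < 1 := by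
  by_contra hcon
  push Not at hcon
  have key : ∀ n : ℕ, 1 - Real.exp (p0 - 1 / 2) ≤ (Pq (1 / 2)).real (BArm n) := by
    intro n
    set S0 := (IE_finite (Bx_finite n)).toFinset with hS0
    have hS0' : (S0 : Set V) = IE (Bx n) := by simp [hS0]
    have hdep : DepOn (BArm n) (S0 : Set V) := by rw [hS0']; exact BArm_dep n
    set F := polyF S0 (BArm n) with hF
    have hanti : AntitoneOn (fun p => (1 - F p) * Real.exp p) (Set.Icc p0 (1 / 2)) := by
      have hdiff : Differentiable ℝ (fun p => (1 - F p) * Real.exp p) :=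
        ((differentiable_const _).sub polyF_diff).mul Real.differentiable_exp
      refine antitoneOn_of_deriv_nonpos (convex_Icc _ _) hdiff.continuous.continuousOn hdiff.differentiableOn ?_
      intro x hx
      rw [interior_Icc] at hx
      have hx0 : 0 < x := h0.trans hx.1
      have hx1 : x < 1 := by linarith [hx.2]
      have hr := russo (S := S0) (BArm_up (n : ℤ)) hx1
      have hD : HasDerivAt (fun p => (1 - F p) * Real.exp p) _ x := (hr.const_sub 1).mul (Real.hasDerivAt_exp x)
      rw [hD.deriv]
      have h2 := dct_step (n := n) (by omega) hx0 hx1 (hcon x hx.1.le hx.2.le) S0 hS0'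
      have h3 : ∑ i ∈ S0, (Pq x).real (Piv (BArm n) i) = ∑ i ∈ S0, polyF S0 (Piv (BArm n) i) x :=
        Finset.sum_congr rfl fun i hi => polyF_eq (Piv_dep hdep hi) hx0.le hx1.le
      rw [h3, polyF_eq hdep hx0.le hx1.le, ← hF] at h2
      have hF1 : F x ≤ 1 := by
        rw [hF, ← polyF_eq hdep hx0.le hx1.le]; exact measureReal_le_one
      have h4 : 1 - F x ≤ (1 - F x) / x := by
        rw [le_div_iff₀ hx0]; nlinarith
      have h5 : 1 - F x ≤ ∑ i ∈ S0, polyF S0 (Piv (BArm n) i) x / (1 - x) := by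
        rw [← Finset.sum_div, le_div_iff₀ (by linarith)]
        nlinarith
      have := Real.exp_pos x
      nlinarith
    have h2 := hanti ⟨le_rfl, h1.le⟩ ⟨h1.le, le_rfl⟩ h1.le
    simp only at h2
    have hF0 : 0 ≤ F p0 := polyF_nonneg h0.le (by linarith)
    rw [polyF_eq hdep (by norm_num) (by norm_num), ← hF]
    have h3 : (1 - F (1 / 2)) * Real.exp (1 / 2) ≤ Real.exp p0 := by
      have := Real.exp_pos p0
      nlinarith
    have h4 : Real.exp p0 = Real.exp (p0 - 1 / 2) * Real.exp (1 / 2) := by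
      rw [← Real.exp_add]; congr 1; ring
    rw [h4] at h3
    have := le_of_mul_le_mul_right h3 (Real.exp_pos _)
    linarith
  have h2 := ge_of_tendsto' BArm_half key
  have : Real.exp (p0 - 1 / 2) < 1 := Real.exp_lt_one_iff.2 (by linarith)
  linarith



/-! ### Exponential decay -/

def ClS (S : Set V) (e : V → Bool) : Set V := {x | Cn (eA e) S (0, 0) x}

def IEat (S C : Set V) : Set V := {w | ∃ a b, a ∈ C ∧ a ∈ S ∧ b ∈ S ∧ SqAdj a b ∧ w = a + b}

theorem ClS_dep {S : Set V} (h0 : ((0, 0) : V) ∈ S) (C : Set V) : DepOn {e | ClS S e = C} (IEat S C) := by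
  rintro e e' h (rfl : ClS S e = C)
  have h00 : ((0, 0) : V) ∈ ClS S e := Cn.refl h0
  ext x
  constructor
  · intro hx
    refine Cn.induct (P := fun x => x ∈ ClS S e) hx h00 ?_
    intro a b h1 h2 h3 h4
    obtain ⟨h5, h6⟩ := (eA_iff _ _ _).1 h2
    refine Cn.step h4 ((eA_iff _ _ _).2 ⟨h5, ?_⟩) h3
    rw [h _ ⟨a, b, h4, h1.right, h3, h5, rfl⟩]; exact h6
  · intro hx
    refine Cn.induct (P := fun x => x ∈ ClS S e') hx (Cn.refl h0) ?_
    intro a b h1 h2 h3 h4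
    obtain ⟨h5, h6⟩ := (eA_iff _ _ _).1 h2
    refine Cn.step h4 ((eA_iff _ _ _).2 ⟨h5, ?_⟩) h3
    rw [← h _ ⟨a, b, h1, h1.right, h3, h5, rfl⟩]; exact h6

def BTo (n : ℤ) (X : Set V) (b : V) : Set (V → Bool) := {e | ∃ w ∈ Rg n, Cn (eA e) X b w}

theorem BTo_dep (n : ℤ) (X : Set V) (b : V) : DepOn (BTo n X b) (IE X) := by
  rintro e e' h ⟨w, hw, hc⟩
  exact ⟨w, hw, Cn_eA_congr h hc⟩

theorem far_BArm {m : ℤ} (hm : 1 ≤ m) {e : V → Bool} {X : Set V} {w : V} (hc : Cn (eA e) X (0, 0) w) (hw : w ∉ Bx (m - 1)) : e ∈ BArm m := by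
  have h0 : ((0, 0) : V) ∈ Bx (m - 1) := by rw [mem_Bx]; simp; omega
  obtain ⟨a, b, h1, h2, h3, h4⟩ := Cn.first_exit hc h0 hw
  have h5 := ((eA_iff _ _ _).1 h2).1
  have h6 := h1.right.2
  have h7 := (sqAdj_iff _ _).1 h5
  have hb : b ∈ Rg m := by
    rw [mem_Bx] at h4 h6; rw [mem_Rg]; omega
  exact ⟨b, hb, (h1.mono fun v hv => Bx_mono (by omega) hv.2).step h2 (Rg_sub_Bx hb)⟩

theorem Pq_shift (p : ℝ) (z : V) {A : Set (V → Bool)} (hA : MeasurableSet A) :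
    (Pq p).real {e | (fun v => e (v + z)) ∈ A} = (Pq p).real A := by
  have m1 : Measurable (fun (e : V → Bool) (v : V) => e (v + z)) := by fun_prop
  have h : (Pq p).map (fun e v => e (v + z)) = Pq p := reindex (fun _ : V => bernP p) (fun v => v + z) (add_left_injective z)
  have := congrArg (fun ν : Measure (V → Bool) => ν.real A) h
  simp only [measureReal_def, Measure.map_apply m1 hA] at this
  exact this

theorem eA_shift (e : V → Bool) (z a b : V) : eA (fun v => e (v + (z + z))) a b ↔ eA e (a + z) (b + z) := by
  rw [eA_iff, eA_iff]
  refine and_congr ?_ ?_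
  · rw [sqAdj_iff, sqAdj_iff]; simp only [Prod.fst_add, Prod.snd_add]; omega
  · rw [show a + z + (b + z) = a + b + (z + z) by abel]

theorem BTo_le (p : ℝ) {n L : ℤ} (hn : L + 2 ≤ n) {b : V} (hb : b ∈ Bx (L + 1)) :
    (Pq p).real (BTo n (Bx n) b) ≤ (Pq p).real (BArm (n - L - 1)) := by
  rw [← Pq_shift p (b + b) (BArm_meas _)]
  refine measureReal_mono ?_ (measure_ne_top _ _)
  rintro e ⟨w, hw, hc⟩
  have h := Cn.map (φ := fun v => v - b) (adj' := eA (fun v => e (v + (b + b)))) (T := Set.univ) (h := hc)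
    (fun x y hxy => by rw [eA_shift]; simpa using hxy) (fun _ _ => trivial)
  rw [sub_self] at h
  refine far_BArm (by omega) h ?_
  rw [mem_Rg] at hw
  rw [mem_Bx] at hb ⊢
  simp only [Prod.fst_sub, Prod.snd_sub]
  omega

theorem Pq_site (p : ℝ) (h0 : 0 ≤ p) (h1 : p ≤ 1) (i : V) : (Pq p).real {e | e i = true} = p := by
  have := infPi_cyl (fun _ : V => p) {i} (fun _ => true)
  simp only [Finset.mem_singleton, forall_eq, Finset.prod_singleton, clampI_eq h0 h1] at this
  rw [measureReal_def, Pq, this]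
  simp [wB, h0]

theorem decay_step {p : ℝ} (hp0 : 0 ≤ p) (hp1 : p ≤ 1) {S : Finset V} (h0 : ((0, 0) : V) ∈ S) {L : ℤ} (hL : (S : Set V) ⊆ Bx L) {n : ℤ}
    (hn : L + 2 ≤ n) : (Pq p).real (BArm n) ≤ phi p S * (Pq p).real (BArm (n - L - 1)) := by
  classical
  set t := (Pq p).real (BArm (n - L - 1)) with ht
  set J := (S.powerset ×ˢ bd S).filter (fun x => x.2.1 ∈ x.1) with hJ
  set E : Finset V × (V × V) → Set (V → Bool) := fun x =>
    ({e | ClS S e = (x.1 : Set V)} ∩ {e | e (x.2.1 + (x.2.1 + x.2.2)) = true}) ∩ BTo n (Bx n \ x.1) (x.2.1 + x.2.2) with hE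
  have hClm : ∀ C : Set V, MeasurableSet {e | ClS S e = C} := fun C => (ClS_dep h0 C).meas
    ((IE_finite S.finite_toSet).subset (by rintro w ⟨a, b, -, h1, h2, h3, h4⟩; exact ⟨a, b, h1, h2, h3, h4⟩))
  have hcov : BArm n ⊆ ⋃ x ∈ J, E x := by
    rintro e ⟨w, hw, hc⟩
    have hClS : ∀ x ∈ ClS S e, x ∈ S := fun x hx => Cn.right hx
    have hfin : (ClS S e).Finite := S.finite_toSet.subset hClS
    have hwS : w ∉ ClS S e := fun h => by
      have := hL (hClS w h)
      rw [mem_Bx] at this; rw [mem_Rg] at hw; omega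
    obtain ⟨a, b, h1, h2, h3, h4⟩ := Cn.last_exit hc (P := ClS S e) (Cn.refl h0) hwS
    have hbS : b ∉ S := fun hb => h4.left.2 (Cn.step h1 h3 hb)
    obtain ⟨h5, h6⟩ := (eA_iff _ _ _).1 h3
    simp only [Set.mem_iUnion]
    refine ⟨(hfin.toFinset, (a, b - a)), ?_, ⟨?_, ?_⟩, ?_⟩
    · simp only [hJ, Finset.mem_filter, Finset.mem_product, Finset.mem_powerset, Set.Finite.mem_toFinset, mem_bd]
      refine ⟨⟨fun x hx => hClS x (by simpa using hx), hClS a h1, ?_, ?_⟩, h1⟩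
      · simpa using h5
      · simpa using hbS
    · simp
    · simpa using h6
    · refine ⟨w, hw, ?_⟩
      simpa using h4
  have hEx : ∀ x ∈ J, (Pq p).real (E x) ≤ (Pq p).real {e | ClS S e = (x.1 : Set V)} * (p * t) := by
    rintro ⟨C, z⟩ hx
    simp only [hJ, Finset.mem_filter, Finset.mem_product, Finset.mem_powerset, mem_bd] at hx
    obtain ⟨⟨hCS, hz1, hz2, hz3⟩, hzC⟩ := hx
    have d1 : DepOn {e : V → Bool | e (z.1 + (z.1 + z.2)) = true} {z.1 + (z.1 + z.2)} := fun e e' h h1 => (h _ rfl).symm.trans h1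
    have dis1 : Disjoint (IEat S C) {z.1 + (z.1 + z.2)} := by
      rw [Set.disjoint_singleton_right]
      rintro ⟨a, b, -, ha, hb, hab, he⟩
      rcases adj_sum_eq hz2 hab he with ⟨e1, e2⟩ | ⟨e1, e2⟩
      · rw [e2] at hz3; exact hz3 hb
      · rw [e2] at hz3; exact hz3 ha
    have dis2 : Disjoint (IEat S C ∪ {z.1 + (z.1 + z.2)}) (IE (Bx n \ C)) := by
      rw [Set.disjoint_left]
      rintro w hw ⟨a, b, ha, hb, hab, he⟩
      rcases hw with ⟨c, d, hc, -, -, hcd, rfl⟩ | rfl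
      · rcases adj_sum_eq hcd hab he with ⟨e1, e2⟩ | ⟨e1, e2⟩
        · rw [e1] at hc; exact ha.2 hc
        · rw [e1] at hc; exact hb.2 hc
      · rcases adj_sum_eq hz2 hab he with ⟨e1, e2⟩ | ⟨e1, e2⟩
        · rw [e1] at hzC; exact ha.2 hzC
        · rw [e1] at hzC; exact hb.2 hzC
    have m1 : MeasurableSet {e : V → Bool | e (z.1 + (z.1 + z.2)) = true} := d1.meas (Set.finite_singleton _)
    have m2 : MeasurableSet (BTo n (Bx n \ C) (z.1 + z.2)) := (BTo_dep _ _ _).meas (IE_finite ((Bx_finite n).subset Set.diff_subset))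
    have dd := ((ClS_dep h0 (C : Set V)).mono Set.subset_union_left).inter (d1.mono (Set.subset_union_right (s := IEat S C)))
    simp only [hE]
    rw [Pq_indep p dd (BTo_dep _ _ _) dis2 ((hClm _).inter m1) m2, Pq_indep p (ClS_dep h0 (C : Set V)) d1 dis1 (hClm _) m1,
      Pq_site p hp0 hp1, mul_assoc]
    refine mul_le_mul_of_nonneg_left (mul_le_mul_of_nonneg_left ?_ hp0) measureReal_nonneg
    refine le_trans (measureReal_mono ?_ (measure_ne_top _ _)) (BTo_le p hn (b := z.1 + z.2) ?_)
    · rintro e ⟨w, hw, hc⟩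
      exact ⟨w, hw, hc.mono Set.diff_subset⟩
    · have h1 := hL hz1
      have h2 := (sqAdj_iff _ _).1 hz2
      rw [mem_Bx] at h1 ⊢
      omega
  have ht0 : 0 ≤ t := measureReal_nonneg
  calc (Pq p).real (BArm n) ≤ (Pq p).real (⋃ x ∈ J, E x) := measureReal_mono hcov (measure_ne_top _ _)
    _ ≤ ∑ x ∈ J, (Pq p).real (E x) := measureReal_biUnion_finset_le J E
    _ ≤ ∑ x ∈ J, (Pq p).real {e | ClS S e = (x.1 : Set V)} * (p * t) := Finset.sum_le_sum hEx
    _ = ∑ z ∈ bd S, ∑ C ∈ S.powerset.filter (fun C => z.1 ∈ C), (Pq p).real {e | ClS S e = (C : Set V)} * (p * t) := by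
      rw [hJ, Finset.sum_filter, Finset.sum_product_right]
      refine Finset.sum_congr rfl fun z _ => ?_
      rw [Finset.sum_filter]
    _ ≤ ∑ z ∈ bd S, (Pq p).real (CnE S (0, 0) z.1) * (p * t) := by
      refine Finset.sum_le_sum fun z _ => ?_
      rw [← Finset.sum_mul]
      refine mul_le_mul_of_nonneg_right ?_ (mul_nonneg hp0 ht0)
      refine Pq_sum_le p _ _ _ (fun C _ => hClm _) ?_ ?_
      · intro C _ D _ hCD
        rw [Set.disjoint_left]
        intro e h1 h2
        simp only [Set.mem_setOf_eq] at h1 h2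
        exact hCD (Finset.coe_injective (h1.symm.trans h2))
      · intro C hC e he
        have hzC := (Finset.mem_filter.1 hC).2
        have : z.1 ∈ ClS S e := by
          have : ClS S e = C := he
          rw [this]; exact hzC
        exact this
    _ = phi p S * t := by
      rw [phi, Finset.mul_sum, Finset.sum_mul]
      exact Finset.sum_congr rfl fun z _ => by ring

theorem BArm_anti {m n : ℤ} (hm : 1 ≤ m) (h : m ≤ n) : BArm n ⊆ BArm m := by
  rintro e ⟨w, hw, hc⟩
  refine far_BArm hm hc ?_
  rw [mem_Rg] at hw; rw [mem_Bx]; omega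

theorem phi_nonneg {p : ℝ} (hp0 : 0 ≤ p) (S : Finset V) : 0 ≤ phi p S :=
  mul_nonneg hp0 (Finset.sum_nonneg fun _ _ => measureReal_nonneg)

/-- polynomially fast decay, in the form we need -/
theorem decay {p : ℝ} (hp0 : 0 ≤ p) (hp1 : p < 1 / 2) : ∃ K : ℝ, ∀ n : ℕ, (n : ℝ) ^ 3 * (Pq p).real (BArm n) ≤ K := by
  obtain ⟨p1, h1, h2, S, h0, hS⟩ := dct (p0 := max p (1 / 4)) (by positivity) (max_lt hp1 (by norm_num))
  have hpp : p ≤ p1 := (le_max_left _ _).trans h1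
  have hp10 : 0 ≤ p1 := hp0.trans hpp
  obtain ⟨L, hL⟩ : ∃ L : ℕ, (S : Set V) ⊆ Bx L := by
    choose f hf using exists_box
    refine ⟨S.sup f, fun v hv => Bx_mono ?_ (hf v)⟩
    exact_mod_cast Finset.le_sup (f := f) hv
  set c := phi p1 S with hc
  have hc0 : 0 ≤ c := phi_nonneg hp10 S
  have hstep : ∀ k : ℕ, (Pq p1).real (BArm ((k + 1) * (L + 1) + 1 : ℤ)) ≤ c ^ k := by
    intro k
    induction k with
    | zero => simpa using measureReal_le_one
    | succ k ih =>
      have hn : (L : ℤ) + 2 ≤ (((k + 1 : ℕ) : ℤ) + 1) * (L + 1) + 1 := by push_cast; nlinarith [Int.natCast_nonneg k, Int.natCast_nonneg L]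
      have := decay_step hp10 (by linarith) h0 hL hn
      rw [pow_succ, mul_comm (c ^ k) c]
      refine this.trans (mul_le_mul_of_nonneg_left ?_ hc0)
      have he : (((k + 1 : ℕ) : ℤ) + 1) * (L + 1) + 1 - L - 1 = (k + 1) * (L + 1) + 1 := by push_cast; ring
      rw [he]; exact ih
  have hlim := tendsto_pow_const_mul_const_pow_of_lt_one 3 hc0 hS
  obtain ⟨K, hK⟩ := hlim.bddAbove_range
  have hKk : ∀ k : ℕ, (k : ℝ) ^ 3 * c ^ k ≤ K := fun k => hK ⟨k, rfl⟩
  have hK0 : 0 ≤ K := by have := hKk 0; simpa using this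
  -- small values are bounded trivially
  refine ⟨(2 * L + 4 : ℝ) ^ 3 + (6 * L + 6 : ℝ) ^ 3 * K, fun n => ?_⟩
  have hmono : (Pq p).real (BArm n) ≤ (Pq p1).real (BArm n) := by
    have hd := BArm_dep (n : ℤ)
    have hf := IE_finite (Bx_finite (n : ℤ))
    have : DepOn (BArm n) (hf.toFinset : Set V) := by simpa using hd
    exact Pq_mono this (BArm_up _) hp0 hpp (by linarith)
  by_cases hsm : n ≤ 2 * L + 4
  · have h3 : (n : ℝ) ≤ 2 * L + 4 := by exact_mod_cast hsm
    have h4 : (Pq p).real (BArm n) ≤ 1 := measureReal_le_one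
    have h5 : (0 : ℝ) ≤ (Pq p).real (BArm n) := measureReal_nonneg
    calc (n : ℝ) ^ 3 * (Pq p).real (BArm n) ≤ (n : ℝ) ^ 3 * 1 := by gcongr
      _ ≤ (2 * L + 4 : ℝ) ^ 3 := by rw [mul_one]; gcongr
      _ ≤ _ := by
        have : 0 ≤ (6 * L + 6 : ℝ) ^ 3 * K := by positivity
        linarith
  · push Not at hsm
    set k := (n - 1) / (L + 1) - 1 with hk
    have hdm := Nat.div_add_mod (n - 1) (L + 1)
    have hml : (n - 1) % (L + 1) < L + 1 := Nat.mod_lt _ (Nat.succ_pos L)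
    have hq : 2 ≤ (n - 1) / (L + 1) := (Nat.le_div_iff_mul_le (Nat.succ_pos L)).2 (by omega)
    have hk1 : (n - 1) / (L + 1) = k + 1 := by omega
    have hk2 : 1 ≤ k := by omega
    rw [hk1] at hdm
    have hle : (k + 1) * (L + 1) + 1 ≤ n := by
      have : (L + 1) * (k + 1) = (k + 1) * (L + 1) := mul_comm _ _
      omega
    have hup : n ≤ (6 * L + 6) * k := by
      have : n ≤ (L + 1) * (k + 1) + (L + 1) + 1 := by omega
      nlinarith
    have h3 : (Pq p).real (BArm n) ≤ c ^ k := by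
      refine hmono.trans (le_trans (measureReal_mono (BArm_anti ?_ ?_) (measure_ne_top _ _)) (hstep k))
      · nlinarith [Int.natCast_nonneg k, Int.natCast_nonneg L]
      · exact_mod_cast hle
    have h4 : (n : ℝ) ≤ (6 * L + 6) * k := by exact_mod_cast hup
    calc (n : ℝ) ^ 3 * (Pq p).real (BArm n) ≤ ((6 * L + 6) * k : ℝ) ^ 3 * c ^ k := by gcongr
      _ = (6 * L + 6 : ℝ) ^ 3 * ((k : ℝ) ^ 3 * c ^ k) := by ring
      _ ≤ (6 * L + 6 : ℝ) ^ 3 * K := by gcongr; exact hKk k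
      _ ≤ _ := by
        have : 0 ≤ (2 * L + 4 : ℝ) ^ 3 := by positivity
        linarith



/-! ### Finiteness of bond clusters -/

def edg (ω : Om) : V → Bool := fun w => ω (true, w)

theorem measurable_edg : Measurable edg := by unfold edg; fun_prop

theorem eta_edg (ω : Om) (u v : V) : eta ω u v = true ↔ eA (edg ω) u v := by
  rw [eta_iff, eA_iff]; rfl

theorem edg_law (p r : ℝ) {A : Set (V → Bool)} (hA : MeasurableSet A) :
    (PP p r).real {ω | edg ω ∈ A} = (Pq p).real A := by
  have h : (PP p r).map edg = Pq p :=
    reindex (fun i : Bool × V => bernP (if i.1 then p else r)) (fun v => (true, v)) (fun a b h => (Prod.mk.inj h).2)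
  have := congrArg (fun ν : Measure (V → Bool) => ν.real A) h
  simp only [measureReal_def, Measure.map_apply measurable_edg hA] at this
  exact this

/-- long bond connection from `v` -/
def FarE (m : ℤ) (v : V) : Set Om := {ω | (fun x => edg ω (x + (v + v))) ∈ BArm m}

theorem FarE_meas (m : ℤ) (v : V) : MeasurableSet (FarE m v) := by
  have h : Measurable (fun (ω : Om) x => edg ω (x + (v + v))) := by unfold edg; fun_prop
  exact h (BArm_meas m)

theorem FarE_real (p r : ℝ) (m : ℤ) (v : V) : (PP p r).real (FarE m v) = (Pq p).real (BArm m) := by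
  rw [← Pq_shift p (v + v) (BArm_meas m), ← edg_law p r]
  · rfl
  · have h : Measurable (fun (e : V → Bool) x => e (x + (v + v))) := by fun_prop
    exact h (BArm_meas m)

theorem conn_far {ω : Om} {v w : V} {m : ℤ} (hm : 1 ≤ m) (hc : Conn (eta ω) v w) (hw : w - v ∉ Bx (m - 1)) : ω ∈ FarE m v := by
  have h0 : Cn (eA (edg ω)) Set.univ v w :=
    ⟨trivial, Relation.ReflTransGen.mono (fun a b h => ⟨(eta_edg _ _ _).1 h, trivial⟩) _ _ hc⟩
  have h := Cn.map (φ := fun x => x - v) (adj' := eA (fun x => edg ω (x + (v + v)))) (T := Set.univ) (h := h0)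
    (fun x y hxy => by rw [eA_shift]; simpa using hxy) (fun _ _ => trivial)
  rw [sub_self] at h
  exact far_BArm hm h hw

theorem decay0 {p : ℝ} (hp0 : 0 ≤ p) (hp1 : p < 1 / 2) {ε : ℝ} (hε : 0 < ε) : ∃ n : ℕ, 1 ≤ n ∧ (Pq p).real (BArm n) ≤ ε := by
  obtain ⟨K, hK⟩ := decay hp0 hp1
  obtain ⟨n, hn⟩ := exists_nat_gt (K / ε)
  refine ⟨n + 1, by omega, ?_⟩
  have h1 := hK (n + 1)
  rw [div_lt_iff₀ hε] at hn
  by_contra hc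
  push Not at hc
  have h2 : ((n + 1 : ℕ) : ℝ) ≤ ((n + 1 : ℕ) : ℝ) ^ 3 := le_self_pow₀ (by push_cast; linarith [Nat.cast_nonneg (α := ℝ) n]) (by norm_num)
  have h3 : (n : ℝ) * ε ≤ ((n + 1 : ℕ) : ℝ) ^ 3 * (Pq p).real (BArm ((n + 1 : ℕ) : ℤ)) := by
    refine mul_le_mul (le_trans ?_ h2) hc.le hε.le (by positivity)
    push_cast; linarith
  linarith

theorem finite_ae {p : ℝ} (r : ℝ) (hp0 : 0 ≤ p) (hp1 : p < 1 / 2) : ∀ᵐ ω ∂(PP p r), ∀ v, (pCluster (eta ω) v).Finite := by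
  rw [ae_all_iff]
  intro v
  rw [ae_iff]
  have h : ∀ ε : ℝ, 0 < ε → (PP p r).real {ω | ¬ (pCluster (eta ω) v).Finite} ≤ ε := by
    intro ε hε
    obtain ⟨n, h1, h2⟩ := decay0 hp0 hp1 hε
    refine le_trans (measureReal_mono ?_ (measure_ne_top _ _)) ((FarE_real p r n v).le.trans h2)
    intro ω hω
    by_contra hc
    refine hω (((Bx_finite ((n : ℤ) - 1)).image (fun x => x + v)).subset fun w hw => ?_)
    by_contra hcc
    exact hc (conn_far (by exact_mod_cast h1) hw fun hb => hcc ⟨w - v, hb, by simp⟩)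
  have h0 : (PP p r).real {ω | ¬ (pCluster (eta ω) v).Finite} = 0 :=
    le_antisymm (le_of_forall_pos_le_add fun ε hε => by simpa using h ε hε) measureReal_nonneg
  exact (measureReal_eq_zero_iff).1 h0

theorem fin_meas (v : V) : MeasurableSet {ω : Om | (pCluster (eta ω) v).Finite} := by
  have e : {ω : Om | (pCluster (eta ω) v).Finite} = ⋃ N : ℕ, ⋂ w ∈ (Bx N)ᶜ, {ω | Conn (eta ω) v w}ᶜ := by
    ext ω
    simp only [Set.mem_setOf_eq, Set.mem_iUnion, Set.mem_iInter, Set.mem_compl_iff]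
    constructor
    · intro h
      choose f hf using exists_box
      refine ⟨h.toFinset.sup f, fun w hw hc => hw ?_⟩
      have : w ∈ h.toFinset := by rw [Set.Finite.mem_toFinset]; exact hc
      exact Bx_mono (by exact_mod_cast Finset.le_sup (f := f) this) (hf w)
    · rintro ⟨N, h⟩
      refine (Bx_finite N).subset fun w hw => ?_
      by_contra hc
      exact h w hc hw
  rw [e]
  exact MeasurableSet.iUnion fun N => MeasurableSet.biInter (Set.to_countable _) fun w _ =>
    (measurableSet_conn (fun u v => measurableSet_eta u v true) v w).compl

/-- the vertices touched by a change -/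
def ChD (ω ω' : Om) : Set V :=
  {u | (∃ v, SqAdj u v ∧ ω (true, u + v) ≠ ω' (true, u + v)) ∨ ω (false, u) ≠ ω' (false, u)}

theorem ChD_finite {ω ω' : Om} (h : {i | ω i ≠ ω' i}.Finite) : (ChD ω ω').Finite := by
  have h1 : ∀ i : Bool × V, {u : V | ∃ v, SqAdj u v ∧ u + v = i.2}.Finite := by
    intro i
    obtain ⟨N, hN⟩ := exists_box i.2
    refine (Bx_finite (N + 1)).subset ?_
    rintro u ⟨v, hv, hs⟩
    rw [← hs, mem_Bx] at hN
    rw [sqAdj_iff] at hv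
    simp only [Prod.fst_add, Prod.snd_add] at hN
    rw [mem_Bx]; omega
  refine ((h.biUnion fun i _ => h1 i).union (h.image Prod.snd)).subset ?_
  rintro u (⟨v, h2, h3⟩ | h2)
  · left
    simp only [Set.mem_iUnion]
    exact ⟨_, h3, v, h2, rfl⟩
  · right
    exact ⟨_, h2, rfl⟩

theorem eta_chg {ω ω' : Om} {a b : V} (ha : a ∉ ChD ω ω' ∨ b ∉ ChD ω ω') : eta ω a b = true ↔ eta ω' a b = true := by
  rw [eta_iff, eta_iff]
  refine and_congr_right fun h => ?_
  have : ω (true, a + b) = ω' (true, a + b) := by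
    by_contra hc
    rcases ha with ha | ha
    · exact ha (Or.inl ⟨b, h, hc⟩)
    · exact ha (Or.inl ⟨a, sqAdj_symm h, by rw [add_comm]; exact hc⟩)
  rw [this]

theorem finite_chg {ω ω' : Om} (h : {i | ω i ≠ ω' i}.Finite) (hf : ∀ v, (pCluster (eta ω) v).Finite) (v : V) :
    (pCluster (eta ω') v).Finite := by
  refine ((hf v).union ((ChD_finite h).biUnion fun d _ => hf d)).subset fun w hw => ?_
  change Relation.ReflTransGen _ v w at hw
  induction hw with
  | refl => exact Or.inl Relation.ReflTransGen.refl
  | @tail a b _ hab ih =>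
    by_cases hb : b ∈ ChD ω ω'
    · right
      simp only [Set.mem_iUnion]
      exact ⟨b, hb, Relation.ReflTransGen.refl⟩
    · have hab' : eta ω a b = true := (eta_chg (Or.inr hb)).2 hab
      rcases ih with ih | ih
      · exact Or.inl (Relation.ReflTransGen.tail ih hab')
      · right
        simp only [Set.mem_iUnion] at ih ⊢
        obtain ⟨d, hd, hc⟩ := ih
        exact ⟨d, hd, Relation.ReflTransGen.tail hc hab'⟩

theorem conn_chg {ω ω' : Om} {v : V} (hd : ∀ d ∈ ChD ω ω', ¬ Conn (eta ω) v d) (w : V) :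
    Conn (eta ω) v w ↔ Conn (eta ω') v w := by
  constructor
  · intro h
    change Relation.ReflTransGen _ v w at h
    induction h with
    | refl => exact Relation.ReflTransGen.refl
    | @tail a b ha hab ih => exact Relation.ReflTransGen.tail ih ((eta_chg (Or.inl fun h => hd a h ha)).1 hab)
  · intro h
    change Relation.ReflTransGen _ v w at h
    induction h with
    | refl => exact Relation.ReflTransGen.refl
    | @tail a b ha hab ih => exact Relation.ReflTransGen.tail ih ((eta_chg (Or.inl fun h => hd a h ih)).2 hab)

theorem col_chg {ω ω' : Om} {v : V} (hd : ∀ d ∈ ChD ω ω', ¬ Conn (eta ω) v d) : col ω v = col ω' v := by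
  have h := conn_chg hd
  have hr : clusterRep (eta ω') v = clusterRep (eta ω) v := by
    rw [rep_eq_iff]
    obtain ⟨h1, h2⟩ := rep_mem (eta ω) v
    exact ⟨(h _).1 h1, fun w' hw' => h2 w' ((h w').2 hw')⟩
  unfold col
  rw [hr]
  by_contra hc
  exact hd _ (Or.inr hc) (rep_mem (eta ω) v).1

theorem perc01 {p : ℝ} (r : ℝ) (hp0 : 0 ≤ p) (hp1 : p < 1 / 2) (s : Bool) : mu p r (PercE s) = 0 ∨ mu p r (PercE s) = 1 := by
  set T : Set Om := {ω | (∀ v, (pCluster (eta ω) v).Finite) ∧ col ω ∈ PercE s} with hT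
  have mT : MeasurableSet T := by
    have e : T = (⋂ v, {ω : Om | (pCluster (eta ω) v).Finite}) ∩ col ⁻¹' (PercE s) := by ext; simp [hT]
    rw [e]
    exact (MeasurableSet.iInter fun v => fin_meas v).inter (measurable_col (PercE_meas s))
  have h := zero_one (fun i : Bool × V => if i.1 then p else r) T mT (by
    rintro ω ω' hf ⟨h1, h2⟩
    refine ⟨finite_chg hf h1, perc_finite ?_ h2⟩
    refine ((ChD_finite hf).biUnion fun d _ => h1 d).subset fun v hv => ?_
    by_contra hc
    refine hv (col_chg fun d hd hcd => hc ?_)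
    simp only [Set.mem_iUnion]
    exact ⟨d, hd, Conn.symm (eta_symm ω) hcd⟩)
  have e : mu p r (PercE s) = PP p r T := by
    rw [mu, Measure.map_apply measurable_col (PercE_meas s)]
    apply measure_congr
    filter_upwards [finite_ae r hp0 hp1] with ω hω
    apply propext
    exact ⟨fun h => ⟨hω, h⟩, fun h => h.2⟩
  rw [e]
  exact h



theorem mu_tr (p r : ℝ) (a : V) : InvB (mu p r) (fun v => v + a) :=
  mu_sym p r (Equiv.addRight a) (fun w => w + (a + a)) (add_left_injective _)
    (fun u v => by
      rw [sqAdj_iff, sqAdj_iff]; simp only [Equiv.coe_addRight, Prod.fst_add, Prod.snd_add]; omega)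
    (fun u v _ => by simp only [Equiv.coe_addRight]; abel)

theorem mu_nice {p r : ℝ} (hp0 : 0 ≤ p) (hp1 : p < 1 / 2) (hr0 : 0 ≤ r) (hr1 : r ≤ 1) : Nice (mu p r) where
  prob := inferInstance
  fkg := fun S A B => mu_fkg p r hp0 hp1.le hr0 hr1 S A B
  tr := fun a => mu_tr p r (a + a)
  rf := mu_sym p r ⟨rfl1, rfl1, fun v => by simp [rfl1], fun v => by simp [rfl1]⟩ rfl1
    (fun a b h => by
      simp only [rfl1, Prod.mk.injEq] at h
      exact Prod.ext (by omega) h.2)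
    (fun u v => by
      rw [sqAdj_iff, sqAdj_iff]; simp only [Equiv.coe_fn_mk, rfl1]; omega)
    (fun u v _ => by
      simp only [Equiv.coe_fn_mk, rfl1]
      exact Prod.ext (by simp; ring) rfl)
  sw := mu_sym p r (Equiv.prodComm ℤ ℤ) Prod.swap Prod.swap_injective
    (fun u v => by
      rw [sqAdj_iff, sqAdj_iff]; simp only [Equiv.prodComm_apply, Prod.fst_swap, Prod.snd_swap]; omega)
    (fun u v _ => rfl)

theorem mu_site (p r : ℝ) (h0 : 0 ≤ r) (h1 : r ≤ 1) (v : V) : (mu p r).real {ξ | ξ v = true} = r := by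
  have h := mu_cyl p r {v} (fun _ => true) id
  have h2 : ∀ e : V → Bool, Pq r {b | ∀ w ∈ ({v} : Finset V), b (clusterRep (etaE e) (id w)) = true} = ENNReal.ofReal r := by
    intro e
    have h3 := infPi_cyl (fun _ : V => r) {clusterRep (etaE e) v} (fun _ => true)
    simp only [Finset.mem_singleton, forall_eq, Finset.prod_singleton, clampI_eq h0 h1] at h3
    simp only [Finset.mem_singleton, forall_eq, id]
    rw [Pq, h3]
    simp [wB]
  simp only [h2] at h
  simp only [Finset.mem_singleton, forall_eq, id, lintegral_const, measure_univ, mul_one] at h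
  rw [measureReal_def, h, ENNReal.toReal_ofReal h0]

theorem mu_clo {p r : ℝ} (h0 : 0 ≤ r) (h1 : r < 1) : Clo (mu p r) (1 - r) := by
  have h : ∀ v : V, (mu p r).real {ξ | ξ v = true}ᶜ = 1 - r := fun v => by
    rw [probReal_compl_eq_one_sub (LU_site v).meas, mu_site p r h0 h1.le]
  exact ⟨by linarith, (h _).ge, (h _).ge⟩

theorem mu_J {p r : ℝ} (hp0 : 0 ≤ p) (hp1 : p < 1 / 2) (hr0 : 0 < r) (hr1 : r ≤ 1) (s : Bool) (k : ℕ) :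
    ∃ J : Set (V → Bool), LU J ∧ 0 < (mu p r).real J ∧ ∀ᵐ ξ ∂(mu p r), ξ ∈ J → ∀ u v, u ∈ Bx k → v ∈ Bx k → ξ u = true → ξ v = true →
      Cn (Ad s) (Op ξ ∩ Bx k) u v := by
  have hn := mu_nice hp0 hp1 hr0.le hr1
  set I := (Bx_finite (k : ℤ)).toFinset with hI
  refine ⟨⋂ i ∈ I, {ξ | ξ i = true}, LU.iInter I _ fun i _ => LU_site i, ?_, Filter.Eventually.of_forall ?_⟩
  · refine lt_of_lt_of_le ?_ (hn.fkg_prod I _ fun i _ => LU_site i)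
    exact Finset.prod_pos fun i _ => by rw [mu_site p r hr0.le hr1]; exact hr0
  · intro ξ hξ
    have hmem : ∀ v : V, v ∈ Bx k → v ∈ Op ξ ∩ Bx k := fun v hv => by
      simp only [Set.mem_iInter] at hξ
      exact ⟨hξ v (by simp [hI, hv]), hv⟩
    have key : ∀ u, u ∈ Bx k → Cn (Ad s) (Op ξ ∩ Bx k) (0, 0) u := by
      intro u hu
      have hu' := mem_Bx.1 hu
      have a1 : Cn (Ad s) (Op ξ ∩ Bx k) (u.1, 0) u := by
        rcases le_total 0 u.2 with h | h
        · exact Cn.vline u.1 0 u.2 h fun y hy1 hy2 => hmem _ (by rw [mem_Bx]; simp; omega)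
        · exact (Cn.vline u.1 u.2 0 h fun y hy1 hy2 => hmem _ (by rw [mem_Bx]; simp; omega)).symm
      have a2 : Cn (Ad s) (Op ξ ∩ Bx k) (0, 0) (u.1, 0) := by
        rcases le_total 0 u.1 with h | h
        · exact Cn.hline 0 u.1 0 h fun y hy1 hy2 => hmem _ (by rw [mem_Bx]; simp; omega)
        · exact (Cn.hline u.1 0 0 h fun y hy1 hy2 => hmem _ (by rw [mem_Bx]; simp; omega)).symm
      exact a2.trans a1
    intro u v hu hv _ _
    exact (key u hu).symm.trans (key v hv)

theorem claim2 {p r : ℝ} (hp0 : 0 ≤ p) (hp1 : p < 1 / 2) (hr0 : 0 < r) (hr1 : r < 1) (s : Bool) (hperc : mu p r (PercE s) ≠ 0)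
    (δ : ℝ) (hδ : 0 < δ) (N : ℕ) : ∃ m : ℕ, N ≤ m ∧ 1 - δ ≤ (mu p r).real (VX s 0 m 0 (3 * m)) := by
  have hn := mu_nice hp0 hp1 hr0.le hr1.le
  rcases dichotomy (mu p r) s (perc01 r hp0 hp1 s) with ⟨h1, hP⟩ | ⟨h1, -⟩
  swap
  · exact absurd h1 hperc
  obtain ⟨δ', hδ', hV⟩ := machineA hn (mu_clo hr0.le hr1) hP (mu_J hp0 hp1 hr0 hr1.le s)
  have hC := machineC hn hδ' hV
  have hflip : (mu p r).map notM = mu p (1 - r) := mu_flip p r hr0.le hr1.le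
  rw [hflip] at hC
  rcases dichotomy (mu p (1 - r)) (!s) (perc01 (1 - r) hp0 hp1 (!s)) with ⟨h2, hP'⟩ | ⟨h2, hA⟩
  · exact absurd hP' hC
  refine machineB hn (mu_clo hr0.le hr1) hP (fun k => ?_) δ hδ N
  convert hA k using 2 with n
  rw [← hflip, measureReal_def, measureReal_def, Measure.map_apply notM_meas (ArmE_meas _ _ _)]
  congr 2
  ext ξ
  exact notM_Arm.symm



/-! ### Stacking crossings -/

theorem stack {s : Bool} {ξ : V → Bool} {x0 x1 y0 y1 y2 y3 : ℤ} (h02 : y0 ≤ y2) (h21 : y2 ≤ y1) (h13 : y1 ≤ y3)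
    (hV : ξ ∈ VX s x0 x1 y0 y1) (hH : ξ ∈ HX s x0 x1 y2 y1) (hW : ξ ∈ VX s x0 x1 y2 y3) : ξ ∈ VX s x0 x1 y0 y3 := by
  obtain ⟨a, b, ha, hb, hab⟩ := hV
  obtain ⟨c, d, hc, hd, hcd⟩ := hH
  obtain ⟨e, f, he, hf, hef⟩ := hW
  have j1 := cross_join hcd hab (fun v hv => by have := hv.2; simp only [Rc, Set.mem_setOf_eq] at this; omega)
    (fun v hv => by have := hv.2; simp only [Rc, Set.mem_setOf_eq] at this; omega)
  have j2 := cross_join hcd hef (fun v hv => by have := hv.2; simp only [Rc, Set.mem_setOf_eq] at this; omega)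
    (fun v hv => by have := hv.2; simp only [Rc, Set.mem_setOf_eq] at this; omega)
  have m1 : Op ξ ∩ Rc x0 x1 y0 y1 ⊆ Op ξ ∩ Rc x0 x1 y0 y3 := fun v hv => ⟨hv.1, by have := hv.2; simp only [Rc, Set.mem_setOf_eq] at *; omega⟩
  have m2 : Op ξ ∩ Rc x0 x1 y2 y1 ⊆ Op ξ ∩ Rc x0 x1 y0 y3 := fun v hv => ⟨hv.1, by have := hv.2; simp only [Rc, Set.mem_setOf_eq] at *; omega⟩
  have m3 : Op ξ ∩ Rc x0 x1 y2 y3 ⊆ Op ξ ∩ Rc x0 x1 y0 y3 := fun v hv => ⟨hv.1, by have := hv.2; simp only [Rc, Set.mem_setOf_eq] at *; omega⟩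
  exact ⟨a, f, ha, hf, ((j1.mono (Set.union_subset m2 m1)).symm.trans (j2.mono (Set.union_subset m2 m3))).trans (hef.mono m3)⟩

theorem VX_short {s : Bool} {x0 x1 y0 y1 y2 : ℤ} (h : y0 ≤ y1) (h' : y1 ≤ y2) : VX s x0 x1 y0 y2 ⊆ VX s x0 x1 y0 y1 := by
  rintro ξ ⟨a, b, ha, hb, hab⟩
  obtain ⟨u, v, hu, hv, huv⟩ := trim (fun w => w.2) (fun a b h => lip_snd a b h) h hab ha.le (by rw [hb]; exact h')
  refine ⟨u, v, hu, hv, huv.mono ?_⟩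
  rintro w ⟨⟨h1, h2⟩, h3⟩
  refine ⟨h1, ?_⟩
  simp only [Rc, Set.mem_setOf_eq] at *
  omega

theorem mu_VX_shift (p r : ℝ) (s : Bool) {x0 x1 y0 y1 x0' x1' y0' y1' : ℤ} (zx zy : ℤ) (e0 : x0' = x0 + zx) (e1 : x1' = x1 + zx)
    (e2 : y0' = y0 + zy) (e3 : y1' = y1 + zy) :
    (mu p r).real (VX s x0' x1' y0' y1')ᶜ = (mu p r).real (VX s x0 x1 y0 y1)ᶜ := by
  subst e0 e1 e2 e3
  rw [← (mu_tr p r (zx, zy)).real (VX_LU s x0 x1 y0 y1).meas.compl]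
  have := VX_shift_eq s x0 x1 y0 y1 (zx, zy)
  rw [← this]; rfl

theorem mu_HX_compl {p r : ℝ} (hn : Nice (mu p r)) (s : Bool) (x0 x1 y0 y1 : ℤ) :
    (mu p r).real (HX s x0 x1 y0 y1)ᶜ = (mu p r).real (VX s y0 y1 x0 x1)ᶜ := by
  rw [probReal_compl_eq_one_sub (HX_LU s x0 x1 y0 y1).meas, probReal_compl_eq_one_sub (VX_LU s y0 y1 x0 x1).meas, hn.HX_eq]

/-- probability of not having the crossing -/
noncomputable def qn (p r : ℝ) (s : Bool) (n : ℤ) : ℝ := (mu p r).real (VX s 0 n 0 (3 * n))ᶜ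

theorem tall {p r : ℝ} (hn : Nice (mu p r)) (s : Bool) {n : ℤ} (h0 : 0 ≤ n) (j : ℕ) :
    (mu p r).real (VX s 0 n 0 ((2 * j + 3) * n))ᶜ ≤ (1 + 2 * j) * qn p r s n := by
  induction j with
  | zero => simp [qn]
  | succ j ih =>
    have hsub : (VX s 0 n 0 ((2 * ((j + 1 : ℕ) : ℤ) + 3) * n))ᶜ ⊆
        ((VX s 0 n 0 ((2 * j + 3) * n))ᶜ ∪ (HX s 0 n ((2 * j + 2) * n) ((2 * j + 3) * n))ᶜ) ∪
          (VX s 0 n ((2 * j + 2) * n) ((2 * ((j + 1 : ℕ) : ℤ) + 3) * n))ᶜ := by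
      intro ξ hξ
      by_contra hc
      simp only [Set.mem_union, Set.mem_compl_iff, not_or, not_not] at hc
      refine hξ (stack ?_ ?_ ?_ hc.1.1 hc.1.2 hc.2)
      · positivity
      · nlinarith
      · push_cast; nlinarith
    have h1 := (measureReal_mono hsub (measure_ne_top (mu p r) _)).trans ((measureReal_union_le _ _).trans (add_le_add_left (measureReal_union_le _ _) _))
    have h2 : (mu p r).real (HX s 0 n ((2 * j + 2) * n) ((2 * j + 3) * n))ᶜ ≤ qn p r s n := by
      rw [mu_HX_compl hn, mu_VX_shift p r s (x0 := 0) (x1 := n) (y0 := 0) (y1 := n) ((2 * j + 2) * n) 0 (by ring) (by ring) (by ring) (by ring)]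
      exact measureReal_mono (Set.compl_subset_compl.2 (VX_short h0 (by linarith))) (measure_ne_top _ _)
    have h3 : (mu p r).real (VX s 0 n ((2 * j + 2) * n) ((2 * ((j + 1 : ℕ) : ℤ) + 3) * n))ᶜ = qn p r s n :=
      mu_VX_shift p r s 0 ((2 * j + 2) * n) (by ring) (by ring) (by ring) (by push_cast; ring)
    push_cast
    push_cast at h1 h3
    linarith

/-! ### Localised colours -/

theorem rep_etaN_mem {Λ : Set V} {ω : Om} {v w : V} (hv : v ∈ Λ) (h : Conn (etaN Λ ω) v w) : w ∈ Λ := by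
  change Relation.ReflTransGen _ v w at h
  induction h with
  | refl => exact hv
  | tail _ h _ => exact ((etaN_iff _ _ _ _).1 h).2.2

/-- coordinates used by the localised colours -/
def LocI (Λ : Set V) : Set (Bool × V) := {i | (i.1 = true ∧ ∃ u v, u ∈ Λ ∧ v ∈ Λ ∧ u + v = i.2) ∨ (i.1 = false ∧ i.2 ∈ Λ)}

theorem etaN_congr {Λ : Set V} {ω ω' : Om} (h : ∀ i ∈ LocI Λ, ω i = ω' i) : etaN Λ ω = etaN Λ ω' := by
  ext u v
  rw [Bool.eq_iff_iff, etaN_iff, etaN_iff, eta_iff, eta_iff]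
  constructor
  · rintro ⟨⟨h1, h2⟩, h3, h4⟩
    exact ⟨⟨h1, (h _ (Or.inl ⟨rfl, u, v, h3, h4, rfl⟩)).symm.trans h2⟩, h3, h4⟩
  · rintro ⟨⟨h1, h2⟩, h3, h4⟩
    exact ⟨⟨h1, (h _ (Or.inl ⟨rfl, u, v, h3, h4, rfl⟩)).trans h2⟩, h3, h4⟩

theorem loc_dep {Λ : Set V} {A : Set ColourCfg} (hA : DepOn A Λ) : DepOn {ω | colN Λ ω ∈ A} (LocI Λ) := by
  intro ω ω' h hm
  refine hA _ _ (fun v hv => ?_) hm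
  unfold colN
  rw [← etaN_congr h]
  exact h _ (Or.inr ⟨rfl, rep_etaN_mem hv (rep_mem _ v).1⟩)

theorem loc_eq {Λ : Set V} {ω : Om} {v : V} (h : ∀ w, Conn (eta ω) v w → w ∈ Λ) : colN Λ ω v = col ω v := by
  have hc : ∀ w, Conn (eta ω) v w → Conn (etaN Λ ω) v w := by
    intro w hw
    change Relation.ReflTransGen _ v w at hw
    induction hw with
    | refl => exact Relation.ReflTransGen.refl
    | @tail a b ha hab ih => exact Relation.ReflTransGen.tail ih ((etaN_iff _ _ _ _).2 ⟨hab, h _ ha, h _ (Relation.ReflTransGen.tail ha hab)⟩)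
  have hr : clusterRep (etaN Λ ω) v = clusterRep (eta ω) v := by
    rw [rep_eq_iff]
    obtain ⟨h1, h2⟩ := rep_mem (eta ω) v
    exact ⟨hc _ h1, fun w hw => h2 w (conn_etaN_le hw)⟩
  unfold colN col
  rw [hr]

/-- some vertex of `S` has a long bond connection -/
def FarS (S : Finset V) (m : ℤ) : Set Om := ⋃ v ∈ S, FarE m v

theorem FarS_real (p r : ℝ) (S : Finset V) (m : ℤ) : (PP p r).real (FarS S m) ≤ S.card * (Pq p).real (BArm m) := by
  refine (measureReal_biUnion_finset_le _ _).trans ?_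
  simp only [FarE_real, Finset.sum_const, nsmul_eq_mul, le_refl]

theorem loc_iff {S : Finset V} {m : ℤ} (hm : 1 ≤ m) {Λ : Set V} (hΛ : ∀ v ∈ S, ∀ w, w - v ∈ Bx (m - 1) → w ∈ Λ) {A : Set ColourCfg}
    (hA : DepOn A S) {ω : Om} (hω : ω ∉ FarS S m) : colN Λ ω ∈ A ↔ col ω ∈ A := by
  refine hA.iff fun v hv => loc_eq fun w hw => hΛ v hv w ?_
  by_contra hc
  refine hω ?_
  simp only [FarS, Set.mem_iUnion]
  exact ⟨v, hv, conn_far hm hw hc⟩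

theorem mu_PP (p r : ℝ) {A : Set ColourCfg} (hA : MeasurableSet A) : (mu p r).real A = (PP p r).real {ω | col ω ∈ A} := by
  rw [measureReal_def, mu, Measure.map_apply measurable_col hA]; rfl

/-- approximate independence of colours in distant sets -/
theorem approx_indep (p r : ℝ) {S T : Finset V} {m : ℤ} (hm : 1 ≤ m) {Λ Λ' : Set V} (hd : Disjoint (LocI Λ) (LocI Λ'))
    (hS : ∀ v ∈ S, ∀ w, w - v ∈ Bx (m - 1) → w ∈ Λ) (hT : ∀ v ∈ T, ∀ w, w - v ∈ Bx (m - 1) → w ∈ Λ')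
    {A B : Set ColourCfg} (hA : DepOn A S) (hB : DepOn B T) {δ : ℝ} (h1 : S.card * (Pq p).real (BArm m) ≤ δ) (h2 : T.card * (Pq p).real (BArm m) ≤ δ) :
    (mu p r).real (A ∩ B) ≤ ((mu p r).real A + δ) * ((mu p r).real B + δ) + 2 * δ := by
  have mA := hA.meas S.finite_toSet
  have mB := hB.meas T.finite_toSet
  have hSΛ : (S : Set V) ⊆ Λ := fun v hv => hS v hv v (by rw [sub_self, mem_Bx]; simp; omega)
  have hTΛ : (T : Set V) ⊆ Λ' := fun v hv => hT v hv v (by rw [sub_self, mem_Bx]; simp; omega)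
  rw [mu_PP p r (mA.inter mB), mu_PP p r mA, mu_PP p r mB]
  have hind : (PP p r).real ({ω | colN Λ ω ∈ A} ∩ {ω | colN Λ' ω ∈ B}) = (PP p r).real {ω | colN Λ ω ∈ A} * (PP p r).real {ω | colN Λ' ω ∈ B} := by
    have := indep_dep (fun i : Bool × V => if i.1 then p else r) (loc_dep (hA.mono hSΛ)) (loc_dep (hB.mono hTΛ)) hd
      (measurable_colN Λ mA) (measurable_colN Λ' mB)
    rw [measureReal_def, measureReal_def, measureReal_def, ← ENNReal.toReal_mul]
    exact congrArg ENNReal.toReal this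
  have f1 := (FarS_real p r S m).trans h1
  have f2 := (FarS_real p r T m).trans h2
  have a1 : (PP p r).real {ω | col ω ∈ A ∩ B} ≤ (PP p r).real ({ω | colN Λ ω ∈ A} ∩ {ω | colN Λ' ω ∈ B}) + δ + δ := by
    have hsub : {ω | col ω ∈ A ∩ B} ⊆ (({ω | colN Λ ω ∈ A} ∩ {ω | colN Λ' ω ∈ B}) ∪ FarS S m) ∪ FarS T m := by
      intro ω hω
      by_cases g1 : ω ∈ FarS S m
      · exact Or.inl (Or.inr g1)
      by_cases g2 : ω ∈ FarS T m
      · exact Or.inr g2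
      exact Or.inl (Or.inl ⟨(loc_iff hm hS hA g1).2 hω.1, (loc_iff hm hT hB g2).2 hω.2⟩)
    have := (measureReal_mono hsub (measure_ne_top (PP p r) _)).trans ((measureReal_union_le _ _).trans (add_le_add_left (measureReal_union_le _ _) _))
    linarith
  have a2 : (PP p r).real {ω | colN Λ ω ∈ A} ≤ (PP p r).real {ω | col ω ∈ A} + δ := by
    have hsub : {ω | colN Λ ω ∈ A} ⊆ {ω | col ω ∈ A} ∪ FarS S m := by
      intro ω hω
      by_cases g1 : ω ∈ FarS S m
      · exact Or.inr g1
      exact Or.inl ((loc_iff hm hS hA g1).1 hω)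
    have := (measureReal_mono hsub (measure_ne_top (PP p r) _)).trans (measureReal_union_le _ _)
    linarith
  have a3 : (PP p r).real {ω | colN Λ' ω ∈ B} ≤ (PP p r).real {ω | col ω ∈ B} + δ := by
    have hsub : {ω | colN Λ' ω ∈ B} ⊆ {ω | col ω ∈ B} ∪ FarS T m := by
      intro ω hω
      by_cases g1 : ω ∈ FarS T m
      · exact Or.inr g1
      exact Or.inl ((loc_iff hm hT hB g1).1 hω)
    have := (measureReal_mono hsub (measure_ne_top (PP p r) _)).trans (measureReal_union_le _ _)
    linarith
  rw [hind] at a1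
  have a4 := mul_le_mul a2 a3 measureReal_nonneg (measureReal_nonneg.trans a2)
  linarith



theorem qstep {p r : ℝ} (hp0 : 0 ≤ p) (hp1 : p < 1 / 2) (hr0 : 0 ≤ r) (hr1 : r ≤ 1) (s : Bool) :
    ∃ C : ℝ, 0 ≤ C ∧ ∀ n : ℕ, 2 ≤ n → qn p r s (3 * n : ℕ) ≤ (7 * qn p r s n + C / n) ^ 2 + 2 * (C / n) := by
  have hn := mu_nice hp0 hp1 hr0 hr1
  obtain ⟨K, hK⟩ := decay hp0 hp1
  have hK0 : 0 ≤ K := by have := hK 0; simpa using this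
  refine ⟨540 * K, by positivity, fun n h2 => ?_⟩
  set m := n / 2 with hm
  have hnpos : (0 : ℝ) < n := by exact_mod_cast (by omega : 0 < n)
  have hcard : (((n : ℝ) + 1) * (9 * n + 1)) * (Pq p).real (BArm m) ≤ 540 * K / n := by
    have hb : (0 : ℝ) ≤ (Pq p).real (BArm m) := measureReal_nonneg
    have h3 : (n : ℝ) ≤ 3 * m := by exact_mod_cast (by omega : n ≤ 3 * m)
    have h4 : (n : ℝ) ^ 3 ≤ 27 * (m : ℝ) ^ 3 := by
      calc (n : ℝ) ^ 3 ≤ (3 * m : ℝ) ^ 3 := by gcongr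
        _ = _ := by ring
    have h1 : (1 : ℝ) ≤ n := by exact_mod_cast (by omega : 1 ≤ n)
    rw [le_div_iff₀ hnpos]
    have h5 : ((n : ℝ) + 1) * (9 * n + 1) * n ≤ 20 * (n : ℝ) ^ 3 := by nlinarith [sq_nonneg (n : ℝ), mul_nonneg hnpos.le (sq_nonneg ((n : ℝ) - 1))]
    calc ((n : ℝ) + 1) * (9 * n + 1) * (Pq p).real (BArm m) * n = ((n : ℝ) + 1) * (9 * n + 1) * n * (Pq p).real (BArm m) := by ring
      _ ≤ 20 * (27 * (m : ℝ) ^ 3) * (Pq p).real (BArm m) := mul_le_mul_of_nonneg_right (by linarith) hb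
      _ = 540 * ((m : ℝ) ^ 3 * (Pq p).real (BArm m)) := by ring
      _ ≤ 540 * K := by gcongr; exact hK m
  let S : Finset V := Finset.Icc (0 : ℤ) n ×ˢ Finset.Icc (0 : ℤ) (9 * n)
  let T : Finset V := Finset.Icc (2 * n : ℤ) (3 * n) ×ˢ Finset.Icc (0 : ℤ) (9 * n)
  have hS : ∀ v, v ∈ S ↔ v ∈ Rc 0 n 0 (9 * n) := fun v => by simp [S, Rc]
  have hT : ∀ v, v ∈ T ↔ v ∈ Rc (2 * n) (3 * n) 0 (9 * n) := fun v => by simp [T, Rc]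
  have cS : (S.card : ℝ) = ((n : ℝ) + 1) * (9 * n + 1) := by
    have : S.card = (n + 1) * (9 * n + 1) := by
      simp only [S, Finset.card_product, Int.card_Icc]; congr 1 <;> omega
    rw [this]; push_cast; ring
  have cT : (T.card : ℝ) = ((n : ℝ) + 1) * (9 * n + 1) := by
    have : T.card = (n + 1) * (9 * n + 1) := by
      simp only [T, Finset.card_product, Int.card_Icc]; congr 1 <;> omega
    rw [this]; push_cast; ring
  have hdis : Disjoint (LocI {v : V | v.1 ≤ n + m}) (LocI {v : V | (n : ℤ) + m + 1 ≤ v.1}) := by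
    rw [Set.disjoint_left]
    rintro ⟨c, w⟩ (⟨h1, u, v, h3, h4, h5⟩ | ⟨h1, h3⟩) (⟨h1', u', v', h3', h4', h5'⟩ | ⟨h1', h3'⟩)
    · have := congrArg Prod.fst (h5.trans h5'.symm)
      simp only [Prod.fst_add, Set.mem_setOf_eq] at *
      omega
    · simp_all
    · simp_all
    · simp only [Set.mem_setOf_eq] at *
      omega
  have key := approx_indep p r (S := S) (T := T) (m := m) (by omega) hdis
    (fun v hv w hw => by
      rw [hS] at hv
      rw [mem_Bx] at hw
      simp only [Rc, Set.mem_setOf_eq, Prod.fst_sub, Prod.snd_sub] at *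
      omega)
    (fun v hv w hw => by
      rw [hT] at hv
      rw [mem_Bx] at hw
      simp only [Rc, Set.mem_setOf_eq, Prod.fst_sub, Prod.snd_sub] at *
      omega)
    (A := (VX s 0 n 0 (9 * n))ᶜ) (B := (VX s (2 * n) (3 * n) 0 (9 * n))ᶜ)
    ((VX_dep s 0 n 0 (9 * n)).compl.mono fun v hv => (hS v).2 hv)
    ((VX_dep s (2 * n) (3 * n) 0 (9 * n)).compl.mono fun v hv => (hT v).2 hv)
    (δ := 540 * K / n) (by rw [cS]; exact hcard) (by rw [cT]; exact hcard)
  have h7 := tall hn s (n := n) (by omega) 3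
  have e9 : (2 * ((3 : ℕ) : ℤ) + 3) * n = 9 * n := by push_cast; ring
  rw [e9] at h7
  have h7' : (mu p r).real (VX s 0 n 0 (9 * n))ᶜ ≤ 7 * qn p r s n := by
    refine h7.trans (le_of_eq ?_); push_cast; ring
  have h8 : (mu p r).real (VX s (2 * n) (3 * n) 0 (9 * n))ᶜ ≤ 7 * qn p r s n := by
    rw [mu_VX_shift p r s (x0 := 0) (x1 := n) (y0 := 0) (y1 := 9 * n) (2 * n) 0 (by ring) (by ring) (by ring) (by ring)]
    exact h7'
  have hsub : qn p r s (3 * n : ℕ) ≤ (mu p r).real ((VX s 0 n 0 (9 * n))ᶜ ∩ (VX s (2 * n) (3 * n) 0 (9 * n))ᶜ) := by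
    refine measureReal_mono ?_ (measure_ne_top _ _)
    rw [← Set.compl_union]
    refine Set.compl_subset_compl.2 ?_
    rintro ξ (⟨a, b, ha, hb, h⟩ | ⟨a, b, ha, hb, h⟩)
    · refine ⟨a, b, ha, by rw [hb]; push_cast; ring, h.mono fun v hv => ⟨hv.1, ?_⟩⟩
      have := hv.2
      simp only [Rc, Set.mem_setOf_eq] at *
      push_cast; omega
    · refine ⟨a, b, ha, by rw [hb]; push_cast; ring, h.mono fun v hv => ⟨hv.1, ?_⟩⟩
      have := hv.2
      simp only [Rc, Set.mem_setOf_eq] at *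
      push_cast; omega
  have hd0 : 0 ≤ 540 * K / n := by positivity
  have hq0 : 0 ≤ qn p r s n := measureReal_nonneg
  refine hsub.trans (key.trans ?_)
  rw [sq]
  gcongr

theorem qdecay {p r : ℝ} (hp0 : 0 ≤ p) (hp1 : p < 1 / 2) (hr0 : 0 ≤ r) (hr1 : r ≤ 1) (s : Bool)
    (h : ∀ ε : ℝ, 0 < ε → ∀ N : ℕ, ∃ n : ℕ, N ≤ n ∧ qn p r s n ≤ ε) :
    ∃ N : ℕ, 1 ≤ N ∧ ∀ j : ℕ, qn p r s (3 ^ j * N : ℕ) ≤ (1 / 400) * (1 / 2) ^ j := by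
  obtain ⟨C, hC, hst⟩ := qstep hp0 hp1 hr0 hr1 s
  obtain ⟨M, hM⟩ := exists_nat_gt (3200 * C)
  obtain ⟨N, hN, hq⟩ := h (1 / 400) (by norm_num) (M + 2)
  refine ⟨N, by omega, fun j => ?_⟩
  induction j with
  | zero => simpa using hq
  | succ j ih =>
    have hN2 : 2 ≤ 3 ^ j * N := le_trans (by omega : 2 ≤ N) (Nat.le_mul_of_pos_left N (by positivity))
    have h1 := hst (3 ^ j * N) hN2
    have e : 3 ^ (j + 1) * N = 3 * (3 ^ j * N) := by ring
    rw [e]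
    refine h1.trans ?_
    have hNr : (0 : ℝ) < N := by exact_mod_cast (by omega : 0 < N)
    have hMN : (M : ℝ) ≤ N := by exact_mod_cast (by omega : M ≤ N)
    set t : ℝ := (1 / 2) ^ j with ht
    have ht0 : 0 < t := by positivity
    have ht1 : t ≤ 1 := pow_le_one₀ (by norm_num) (by norm_num)
    have hd : C / ((3 ^ j * N : ℕ) : ℝ) ≤ t / 3200 := by
      push_cast
      rw [div_le_iff₀ (by positivity)]
      have h3 : (1 : ℝ) ≤ t * 3 ^ j := by
        rw [ht, ← mul_pow]
        exact one_le_pow₀ (by norm_num)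
      nlinarith
    have hd0 : 0 ≤ C / ((3 ^ j * N : ℕ) : ℝ) := by positivity
    have hq0 : 0 ≤ qn p r s (3 ^ j * N : ℕ) := measureReal_nonneg
    calc (7 * qn p r s (3 ^ j * N : ℕ) + C / ((3 ^ j * N : ℕ) : ℝ)) ^ 2 + 2 * (C / ((3 ^ j * N : ℕ) : ℝ))
        ≤ (7 * (1 / 400 * t) + t / 3200) ^ 2 + 2 * (t / 3200) := by gcongr
      _ ≤ 1 / 400 * (1 / 2) ^ (j + 1) := by
        rw [pow_succ (1 / 2 : ℝ) j, ← ht]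
        nlinarith

theorem infinite_of_crossings {s : Bool} {ξ : V → Bool} {N : ℕ} (hN : 1 ≤ N)
    (hV : ∀ j : ℕ, ξ ∈ VX s 0 (3 ^ j * N : ℕ) 0 (3 * (3 ^ j * N : ℕ))) (hH : ∀ j : ℕ, ξ ∈ HX s 0 (3 * (3 ^ j * N : ℕ)) 0 (3 ^ j * N : ℕ)) :
    ∃ u, infC s ξ u := by
  choose a b ha hb hab using hV
  choose c d hc hd hcd using hH
  have hsub : ∀ X : Set V, Op ξ ∩ X ⊆ Op ξ := fun X => Set.inter_subset_left
  have j1 : ∀ j, Cn (Ad s) (Op ξ) (c j) (a j) := fun j => by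
    refine (cross_join (hcd j) (hab j) (fun v hv => ?_) (fun v hv => ?_)).mono (Set.union_subset (hsub _) (hsub _))
    · have := hv.2; simp only [Rc, Set.mem_setOf_eq] at this; rw [ha, hb]; omega
    · have := hv.2; simp only [Rc, Set.mem_setOf_eq] at this; rw [hc, hd]; omega
  have e : ∀ j : ℕ, ((3 ^ (j + 1) * N : ℕ) : ℤ) = 3 * (3 ^ j * N : ℕ) := fun j => by push_cast; ring
  have j2 : ∀ j, Cn (Ad s) (Op ξ) (c (j + 1)) (a j) := fun j => by
    refine (cross_join (hcd (j + 1)) (hab j) (fun v hv => ?_) (fun v hv => ?_)).mono (Set.union_subset (hsub _) (hsub _))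
    · have := hv.2; simp only [Rc, Set.mem_setOf_eq] at this; rw [e] at this; rw [ha, hb]; omega
    · have := hv.2; simp only [Rc, Set.mem_setOf_eq] at this; rw [hc, hd, e]; omega
  have j3 : ∀ j, Cn (Ad s) (Op ξ) (a 0) (a j) := by
    intro j
    induction j with
    | zero => exact Cn.refl (j1 0).right
    | succ j ih => exact ih.trans ((j2 j).symm.trans (j1 (j + 1)))
  refine ⟨a 0, fun hf => ?_⟩
  have hmem : ∀ j, b j ∈ {w | Cn (Ad s) (Op ξ) (a 0) w} := fun j => (j3 j).trans ((hab j).mono (hsub _))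
  have hinj : Function.Injective b := by
    intro i j hij
    have h1 := hb i
    rw [hij, hb j] at h1
    have h2 : 3 ^ j * N = 3 ^ i * N := by exact_mod_cast (by omega : ((3 ^ j * N : ℕ) : ℤ) = ((3 ^ i * N : ℕ) : ℤ))
    have h3 := Nat.eq_of_mul_eq_mul_right (by omega) h2
    exact (Nat.pow_right_injective (le_refl 3 |>.trans' (by norm_num)) h3).symm
  exact Set.infinite_of_injective_forall_mem hinj hmem hf

theorem infC_shift (p r : ℝ) (s : Bool) (u : V) : mu p r {ξ | infC s ξ u} = mu p r {ξ | infC s ξ (0, 0)} := by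
  have h := mu_tr p r u
  have m1 : Measurable (fun (ξ : V → Bool) v => ξ (v + u)) := by fun_prop
  have h2 := congrArg (fun ν : Measure (V → Bool) => ν {ξ | infC s ξ (0, 0)}) h
  simp only [Measure.map_apply m1 (infC_meas s (0, 0))] at h2
  rw [← h2]
  congr 1
  ext ξ
  simp only [Set.mem_setOf_eq, Set.mem_preimage, infC]
  have e : {w | Cn (Ad s) (Op ξ) u w} = (fun v => v + u) '' {w | Cn (Ad s) (Op fun v => ξ (v + u)) (0, 0) w} := by
    ext w
    constructor
    · intro hw
      have := Cn.map (φ := fun v => v + -u) (adj' := Ad s) (T := Op fun v => ξ (v + u)) (h := hw) (fun x y hxy => Ad_add (-u) hxy)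
        (fun x hx => by simp only [Op, Set.mem_setOf_eq, neg_add_cancel_right] at *; exact hx)
      rw [add_neg_cancel] at this
      exact ⟨w + -u, this, by simp⟩
    · rintro ⟨v, hv, rfl⟩
      have := Cn.map (φ := fun v => v + u) (adj' := Ad s) (T := Op ξ) (h := hv) (fun x y hxy => Ad_add u hxy)
        (fun x hx => hx)
      have e0 : ((0, 0) : V) + u = u := zero_add u
      rw [e0] at this
      exact this
  rw [e, Set.infinite_image_iff (add_left_injective u).injOn]

theorem infC_pos {p r : ℝ} {s : Bool} (h : mu p r (PercE s) ≠ 0) : 0 < mu p r {ξ | infC s ξ (0, 0)} := by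
  rw [pos_iff_ne_zero]
  intro h0
  refine h (measure_mono_null (t := ⋃ u, {ξ | infC s ξ u}) (fun ξ hξ => ?_) (measure_iUnion_null fun u => by rw [infC_shift]; exact h0))
  simp only [Set.mem_iUnion]
  exact infC_of_perc hξ

theorem claim1 {p r : ℝ} (hp0 : 0 ≤ p) (hp1 : p < 1 / 2) (hr0 : 0 ≤ r) (hr1 : r ≤ 1) (s : Bool)
    (h : ∀ ε : ℝ, 0 < ε → ∀ N : ℕ, ∃ n : ℕ, N ≤ n ∧ qn p r s n ≤ ε) : 0 < mu p r {ξ | infC s ξ (0, 0)} := by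
  have hn := mu_nice hp0 hp1 hr0 hr1
  obtain ⟨N, hN, hq⟩ := qdecay hp0 hp1 hr0 hr1 s h
  refine infC_pos fun h0 => ?_
  set F : ℕ → Set (V → Bool) := fun j => (VX s 0 (3 ^ j * N : ℕ) 0 (3 * (3 ^ j * N : ℕ)))ᶜ with hF
  set G : ℕ → Set (V → Bool) := fun j => (HX s 0 (3 * (3 ^ j * N : ℕ)) 0 (3 ^ j * N : ℕ))ᶜ with hG
  have hcov : (Set.univ : Set (V → Bool)) ⊆ (PercE s ∪ ⋃ j, F j) ∪ ⋃ j, G j := by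
    intro ξ _
    by_contra hc
    simp only [Set.mem_union, Set.mem_iUnion, not_or, not_exists, hF, hG, Set.mem_compl_iff, not_not] at hc
    obtain ⟨u, hu⟩ := infinite_of_crossings hN hc.1.2 hc.2
    exact hc.1.1 (perc_of_infC hu)
  have bF : ∀ j, mu p r (F j) ≤ ENNReal.ofReal (1 / 400 * (1 / 2) ^ j) := fun j => by
    rw [← ofReal_measureReal (measure_ne_top _ _)]
    exact ENNReal.ofReal_le_ofReal (hq j)
  have bG : ∀ j, mu p r (G j) ≤ ENNReal.ofReal (1 / 400 * (1 / 2) ^ j) := fun j => by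
    rw [← ofReal_measureReal (measure_ne_top _ _)]
    refine ENNReal.ofReal_le_ofReal (le_trans (le_of_eq ?_) (hq j))
    exact mu_HX_compl hn _ _ _ _ _
  have hsum : ∑' j : ℕ, ENNReal.ofReal (1 / 400 * (1 / 2) ^ j) = ENNReal.ofReal (1 / 200) := by
    rw [← ENNReal.ofReal_tsum_of_nonneg (fun j => by positivity) (summable_geometric_two.mul_left _), tsum_mul_left, tsum_geometric_two]
    norm_num
  have sF : mu p r (⋃ j, F j) ≤ ENNReal.ofReal (1 / 200) := hsum ▸ (measure_iUnion_le F).trans (ENNReal.tsum_le_tsum bF)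
  have sG : mu p r (⋃ j, G j) ≤ ENNReal.ofReal (1 / 200) := hsum ▸ (measure_iUnion_le G).trans (ENNReal.tsum_le_tsum bG)
  have hle : (1 : ℝ≥0∞) ≤ ENNReal.ofReal (1 / 100) := by
    calc (1 : ℝ≥0∞) = mu p r Set.univ := measure_univ.symm
      _ ≤ (mu p r (PercE s) + mu p r (⋃ j, F j)) + mu p r (⋃ j, G j) :=
        (measure_mono hcov).trans ((measure_union_le _ _).trans (add_le_add_left (measure_union_le _ _) _))
      _ ≤ (0 + ENNReal.ofReal (1 / 200)) + ENNReal.ofReal (1 / 200) := by rw [h0]; gcongr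
      _ = ENNReal.ofReal (1 / 100) := by
        rw [zero_add, ← ENNReal.ofReal_add (by norm_num) (by norm_num)]; norm_num
  rw [ENNReal.one_le_ofReal] at hle
  norm_num at hle



theorem main_mu {p r : ℝ} (hp0 : 0 ≤ p) (hp1 : p < 1 / 2) (hr0 : 0 ≤ r) (hr1 : r ≤ 1) (s : Bool) :
    Filter.limsup (fun n : ℕ => mu p r (VX s 0 n 0 (3 * n))) Filter.atTop = 1 ↔ 0 < mu p r {ξ | infC s ξ (0, 0)} := by
  have hle : Filter.limsup (fun n : ℕ => mu p r (VX s 0 n 0 (3 * n))) Filter.atTop ≤ 1 :=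
    Filter.limsup_le_of_le (by isBoundedDefault) (Filter.Eventually.of_forall fun n => prob_le_one)
  constructor
  · intro h
    refine claim1 hp0 hp1 hr0 hr1 s fun ε hε N => ?_
    have hlt : ENNReal.ofReal (1 - ε) < Filter.limsup (fun n : ℕ => mu p r (VX s 0 n 0 (3 * n))) Filter.atTop := by
      rw [h]
      exact ENNReal.ofReal_lt_one.2 (by linarith)
    have hf := Filter.frequently_lt_of_lt_limsup (by isBoundedDefault) hlt
    obtain ⟨n, hn, h2⟩ := Filter.frequently_atTop.1 hf N
    refine ⟨n, hn, ?_⟩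
    unfold qn
    rw [probReal_compl_eq_one_sub (VX_LU s 0 n 0 (3 * n)).meas]
    have h3 := (ENNReal.ofReal_le_iff_le_toReal (measure_ne_top _ _)).1 h2.le
    rw [measureReal_def]
    linarith
  · intro h
    have hperc : mu p r (PercE s) ≠ 0 := fun h0 => h.ne' (measure_mono_null (fun ξ hξ => perc_of_infC hξ) h0)
    refine le_antisymm hle ?_
    have key : ∀ δ : ℝ, 0 < δ → ∀ N : ℕ, ∃ m : ℕ, N ≤ m ∧ 1 - δ ≤ (mu p r).real (VX s 0 m 0 (3 * m)) := by
      rcases hr0.eq_or_lt with e | hr0'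
      · exfalso
        have h1 := mu_site p r hr0 hr1 (0, 0)
        rw [← e, measureReal_eq_zero_iff] at h1
        rw [← e] at h
        refine h.ne' (measure_mono_null (fun ξ (hξ : infC s ξ (0, 0)) => ?_) h1)
        obtain ⟨w, hw⟩ := hξ.nonempty
        exact hw.left
      · rcases hr1.eq_or_lt with e | hr1'
        · intro δ hδ N
          refine ⟨N, le_rfl, ?_⟩
          have hall : ∀ᵐ ξ ∂(mu p r), ∀ v : V, ξ v = true := by
            rw [ae_all_iff]
            intro v
            have h1 := mu_site p r hr0 hr1 v
            rw [e] at h1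
            rw [e, ae_iff, ← Set.compl_setOf, ← measureReal_eq_zero_iff, probReal_compl_eq_one_sub (LU_site v).meas, h1]
            simp
          have h2 : (mu p r).real (VX s 0 N 0 (3 * N)) = 1 := by
            rw [measureReal_def]
            have : VX s 0 N 0 (3 * N) =ᵐ[mu p r] Set.univ := by
              rw [ae_eq_univ]
              refine measure_mono_null (fun ξ hξ => ?_) (ae_iff.1 hall)
              intro hξ'
              refine hξ ⟨(0, 0), (0, 3 * N), rfl, rfl, Cn.vline 0 0 _ (by omega) fun t h1 h2 => ⟨hξ' _, ?_⟩⟩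
              simp only [Rc, Set.mem_setOf_eq]; omega
            rw [measure_congr this]; simp
          rw [h2]; linarith
        · exact claim2 hp0 hp1 hr0' hr1' s hperc
    refine ENNReal.le_of_forall_pos_le_add fun ε hε _ => ?_
    have hε' : (0 : ℝ) < ε := hε
    have hfr : ∃ᶠ n : ℕ in Filter.atTop, ENNReal.ofReal (1 - ε) ≤ mu p r (VX s 0 n 0 (3 * n)) := by
      rw [Filter.frequently_atTop]
      intro N
      obtain ⟨m, hm, h2⟩ := key ε hε' N
      exact ⟨m, hm, ENNReal.ofReal_le_of_le_toReal h2⟩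
    have h3 := Filter.le_limsup_of_frequently_le hfr (by isBoundedDefault)
    calc (1 : ℝ≥0∞) = ENNReal.ofReal ((1 - ε) + ε) := by simp
      _ ≤ ENNReal.ofReal (1 - ε) + ENNReal.ofReal ε := ENNReal.ofReal_add_le
      _ ≤ _ := by rw [ENNReal.ofReal_coe_nnreal]; gcongr

theorem crossing_VX {s : Bool} {ξ : V → Bool} {n : ℕ} {good : V → Prop} (hg : ∀ v, good v ↔ v ∈ Op ξ) :
    HasCrossing (Ad s) good (Rect n (3 * n)) (TopSide n (3 * n)) (BotSide n (3 * n)) ↔ ξ ∈ VX s 0 n 0 (3 * n) := by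
  have hR : ∀ v : V, v ∈ Rect n (3 * n) ↔ v ∈ Rc 0 n 0 (3 * n) := fun v => by
    simp only [Rect, Rc, Set.mem_setOf_eq]; push_cast; omega
  constructor
  · rintro ⟨k, f, h1, h2, h3, h4⟩
    refine ⟨f (Fin.last k), f 0, h4.2, by rw [h3.2]; push_cast; rfl, Cn.symm ?_⟩
    have := Cn.ofFun (adj := Ad s) (S := Op ξ ∩ Rc 0 n 0 (3 * n)) (k := k) (f := fun i => f (Fin.ofNat (k + 1) i))
      (fun i hi => ⟨(hg _).1 (h1 _).2, (hR _).1 (h1 _).1⟩) (fun i hi => by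
        have := h2 ⟨i, hi⟩
        convert this using 2
        · ext; simp [Fin.ofNat]; omega
        · ext; simp [Fin.ofNat]; omega)
    have e0 : Fin.ofNat (k + 1) 0 = 0 := rfl
    have ek : Fin.ofNat (k + 1) k = Fin.last k := by ext; simp [Fin.ofNat]
    simp only [e0, ek] at this
    exact this
  · rintro ⟨a, b, ha, hb, h⟩
    obtain ⟨k, f, f0, fk, hS, hadj⟩ := h.symm.toFun
    refine ⟨k, fun i => f i, fun i => ⟨(hR _).2 (hS _ (by omega)).2, (hg _).2 (hS _ (by omega)).1⟩, fun i => hadj i i.2, ⟨(hR _).2 (hS _ (by simp)).2, ?_⟩,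
      ⟨(hR _).2 (hS _ (by simp)).2, ?_⟩⟩
    · simp only [Fin.val_zero, f0, hb]; push_cast; rfl
    · simp only [Fin.val_last, fk, ha]

theorem cluster_Cn {adj : V → V → Prop} {ξ η : V → Bool} {c : Bool} (hg : ∀ v, ξ v = c ↔ v ∈ Op η) (u : V) :
    monoCluster adj ξ c u = {w | Cn adj (Op η) u w} := by
  ext w
  simp only [monoCluster, Set.mem_setOf_eq, MonoConn]
  constructor
  · rintro ⟨h0, h⟩
    refine ⟨(hg u).1 h0, Relation.ReflTransGen.mono (fun a b hab => ⟨hab.1, (hg b).1 hab.2.2⟩) _ _ h⟩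
  · intro h
    refine ⟨(hg u).2 h.left, ?_⟩
    refine h.induct (P := fun w => Relation.ReflTransGen (fun a b => adj a b ∧ ξ a = c ∧ ξ b = c) u w) .refl ?_
    intro a b ha hab hb ih
    exact ih.tail ⟨hab, (hg a).2 ha.right, (hg b).2 hb⟩

theorem notM_iff (ξ : V → Bool) (v : V) : ξ v = false ↔ v ∈ Op (notM ξ) := by
  simp [Op, notM]

theorem mu_notM {p r : ℝ} (h0 : 0 ≤ r) (h1 : r ≤ 1) {C : Set ColourCfg} (hC : MeasurableSet C) :
    mu p r (notM ⁻¹' C) = mu p (1 - r) C := by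
  rw [← mu_flip p r h0 h1]
  exact (Measure.map_apply notM_meas hC).symm


/-- **Crossings and percolation (Lemma 2.9).** For `p < 1/2`:
(a) `limsup ℙ_{p,r}(V^b_{n,3n}) = 1` iff `Θ(p,r) > 0`, and
(b) `limsup ℙ_{p,r}(V^{w*}_{n,3n}) = 1` iff `Θ*(p,1−r) > 0`. -/
theorem crossing_iff_percolation (p r : ℝ) (hp0 : 0 ≤ p) (hp : p < 1 / 2)
    (hr0 : 0 ≤ r) (hr1 : r ≤ 1) :
    (Filter.limsup
        (fun n : ℕ => DaCMeasure SqAdj p r (colourEvent (VertBC SqAdj n (3 * n))))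
        Filter.atTop = 1 ↔ 0 < thetaSq p r) ∧
    (Filter.limsup
        (fun n : ℕ => DaCMeasure SqAdj p r (colourEvent (VertWStarC n (3 * n))))
        Filter.atTop = 1 ↔ 0 < thetaStarSq p (1 - r)) := by
  have hp1 : p ≤ 1 := by linarith
  constructor
  · have e1 : ∀ n : ℕ, DaCMeasure SqAdj p r (colourEvent (VertBC SqAdj n (3 * n))) = mu p r (VX false 0 n 0 (3 * n)) := fun n => by
      have e : VertBC SqAdj n (3 * n) = VX false 0 n 0 (3 * n) :=
        Set.ext fun ξ => crossing_VX (s := false) (ξ := ξ) (fun v => Iff.rfl)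
      rw [e, DaC_mu p r hp0 hp1 hr0 hr1 _ (VX_LU _ _ _ _ _).meas]
    have e2 : thetaSq p r = mu p r {ξ | infC false ξ (0, 0)} := by
      rw [← DaC_mu p r hp0 hp1 hr0 hr1 _ (infC_meas _ _)]
      unfold thetaSq percProb
      congr 1
      ext ω
      simp only [Set.mem_setOf_eq, colourEvent, infC]
      rw [cluster_Cn (η := ω.2) (fun v => Iff.rfl)]
      rfl
    simp only [e1, e2]
    exact main_mu hp0 hp hr0 hr1 false
  · have e1 : ∀ n : ℕ, DaCMeasure SqAdj p r (colourEvent (VertWStarC n (3 * n))) = mu p (1 - r) (VX true 0 n 0 (3 * n)) := fun n => by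
      have e : VertWStarC n (3 * n) = notM ⁻¹' VX true 0 n 0 (3 * n) :=
        Set.ext fun ξ => crossing_VX (s := true) (ξ := notM ξ) (notM_iff ξ)
      rw [e, DaC_mu p r hp0 hp1 hr0 hr1 _ (notM_meas (VX_LU _ _ _ _ _).meas), mu_notM hr0 hr1 (VX_LU _ _ _ _ _).meas]
    have e2 : thetaStarSq p (1 - r) = mu p (1 - r) {ξ | infC true ξ (0, 0)} := by
      rw [← mu_notM hr0 hr1 (infC_meas _ _), ← DaC_mu p r hp0 hp1 hr0 hr1 _ (notM_meas (infC_meas _ _))]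
      unfold thetaStarSq percProb
      rw [show (1 : ℝ) - (1 - r) = r by ring]
      congr 1
      ext ω
      simp only [Set.mem_setOf_eq, colourEvent, infC, Set.mem_preimage]
      rw [cluster_Cn (η := notM ω.2) (notM_iff ω.2)]
      rfl
    simp only [e1, e2]
    exact main_mu hp0 hp (by linarith) (by linarith) true

end DaC
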